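/- Let I ⊆ ℝ be a nonempty open interval and let λ be a real number with 1/3 ≤ λ ≤ 1/2. Then the Hausdorff dimension of S_3(I,λ) equals (2−2λ)/(1+λ). -/

import Mathlib

open MeasureTheory
open scoped ENNReal

/-- Distance from a real number to the nearest integer. -/
noncomputable def distNearestInt (y : ℝ) : ℝ := |y - round y|

/-- The `n`-th simultaneous Diophantine exponent `λ_n(x) ∈ [0,∞]`: the supremum of all
`λ > 0` such that `max_{1 ≤ i ≤ n} ‖q x^i‖ ≤ q^{-λ}` holds for infinitely many positive
integers `q`. -/
noncomputable def simExponent (n : ℕ) (x : ℝ) : ℝ≥0∞ :=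
  sSup (ENNReal.ofReal '' {l : ℝ | 0 < l ∧
    {q : ℕ | 0 < q ∧
      ∀ i ∈ Finset.Icc 1 n, distNearestInt ((q : ℝ) * x ^ i) ≤ (q : ℝ) ^ (-l)}.Infinite})

/-- `S_n(I, λ) = {x ∈ I : λ_n(x) > λ}`. -/
noncomputable def SimSet (n : ℕ) (I : Set ℝ) (lam : ℝ) : Set ℝ :=
  {x ∈ I | ENNReal.ofReal lam < simExponent n x}

section Part1
/-- Gauss reduction of positive definite binary quadratic forms. -/
theorem gaussRed (p q r : ℝ) (hp : 0 < p) (hD : 0 < 4 * p * r - q ^ 2) :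
    ∃ x y z w : ℤ, x * w - z * y = 1 ∧
      0 < p * x ^ 2 + q * x * y + r * y ^ 2 ∧
      p * x ^ 2 + q * x * y + r * y ^ 2 ≤ p * z ^ 2 + q * z * w + r * w ^ 2 ∧
      |2 * p * x * z + q * (x * w + y * z) + 2 * r * y * w| ≤
        p * x ^ 2 + q * x * y + r * y ^ 2 := by
  set N : ℤ × ℤ → ℝ := fun v => p * v.1 ^ 2 + q * v.1 * v.2 + r * v.2 ^ 2 with hN
  have hr : 0 < r := by
    by_contra h
    have : p * r ≤ 0 := mul_nonpos_of_nonneg_of_nonpos hp.le (not_lt.mp h)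
    nlinarith [sq_nonneg q]
  set De := 4 * p * r - q ^ 2 with hDe
  have id1 : ∀ v : ℤ × ℤ, 4 * p * N v = (2 * p * v.1 + q * v.2) ^ 2 + De * (v.2 : ℝ) ^ 2 := by
    intro v; simp only [hN, hDe]; ring
  have id2 : ∀ v : ℤ × ℤ, 4 * r * N v = (2 * r * v.2 + q * v.1) ^ 2 + De * (v.1 : ℝ) ^ 2 := by
    intro v; simp only [hN, hDe]; ring
  have hpos : ∀ v : ℤ × ℤ, v ≠ 0 → 0 < N v := by
    intro v hv
    by_cases h2 : v.2 = 0
    · have h1 : v.1 ≠ 0 := fun h1 => hv (Prod.ext h1 h2)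
      have : (0 : ℝ) < (v.1 : ℝ) ^ 2 := by positivity
      have h3 := id2 v
      have : 0 < De * (v.1 : ℝ) ^ 2 := mul_pos hD this
      have : 0 < 4 * r * N v := by nlinarith [sq_nonneg (2 * r * (v.2 : ℝ) + q * v.1)]
      exact pos_of_mul_pos_right this (by positivity)
    · have : (0 : ℝ) < (v.2 : ℝ) ^ 2 := by positivity
      have h3 := id1 v
      have : 0 < De * (v.2 : ℝ) ^ 2 := mul_pos hD this
      have : 0 < 4 * p * N v := by nlinarith [sq_nonneg (2 * p * (v.1 : ℝ) + q * v.2)]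
      exact pos_of_mul_pos_right this (by positivity)
  -- finiteness
  set S : Set (ℤ × ℤ) := {v | v ≠ 0 ∧ N v ≤ N (1, 0)} with hS
  have hSfin : S.Finite := by
    obtain ⟨n, hn⟩ := exists_nat_gt ((4 * r * N (1,0)) / De)
    obtain ⟨m, hm⟩ := exists_nat_gt ((4 * p * N (1,0)) / De)
    refine Set.Finite.subset ((Set.finite_Icc (-(n:ℤ)) n).prod (Set.finite_Icc (-(m:ℤ)) m)) ?_
    rintro v ⟨_, hv⟩
    rw [div_lt_iff₀ hD] at hn hm
    have key : ∀ (k : ℕ) (z : ℤ), De * (z:ℝ)^2 < k * De → z ∈ Set.Icc (-(k:ℤ)) k := by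
      intro k z hz
      have h1 : (z:ℝ)^2 < k := by
        by_contra hcon
        push Not at hcon
        nlinarith
      have h2 : z^2 < (k:ℤ) := by exact_mod_cast h1
      constructor <;> nlinarith
    constructor
    · apply key
      have := id2 v
      have h4 : 4 * r * N v ≤ 4 * r * N (1,0) := by gcongr
      nlinarith [sq_nonneg (2 * r * (v.2 : ℝ) + q * v.1)]
    · apply key
      have := id1 v
      have h4 : 4 * p * N v ≤ 4 * p * N (1,0) := by gcongr
      nlinarith [sq_nonneg (2 * p * (v.1 : ℝ) + q * v.2)]
  have hSne : S.Nonempty := ⟨(1,0), by simp, le_refl _⟩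
  obtain ⟨v, ⟨hv0, hvle⟩, hvmin⟩ := Set.exists_min_image S N hSfin hSne
  have hmin : ∀ u : ℤ × ℤ, u ≠ 0 → N v ≤ N u := by
    intro u hu
    by_cases h : N u ≤ N (1,0)
    · exact hvmin u ⟨hu, h⟩
    · exact hvle.trans (not_le.mp h).le
  -- primitive
  have hcop : Int.gcd v.1 v.2 = 1 := by
    set g := Int.gcd v.1 v.2 with hg
    have hg0 : g ≠ 0 := by
      intro h
      rw [hg, Int.gcd_eq_zero_iff] at h
      exact hv0 (Prod.ext h.1 h.2)
    obtain ⟨a, ha⟩ := Int.gcd_dvd_left v.1 v.2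
    obtain ⟨b, hb⟩ := Int.gcd_dvd_right v.1 v.2
    rw [← hg] at ha hb
    have hu : ((a, b) : ℤ × ℤ) ≠ 0 := by
      intro h
      have h1 : a = 0 := congrArg Prod.fst h
      have h2 : b = 0 := congrArg Prod.snd h
      apply hv0
      refine Prod.ext ?_ ?_
      · rw [ha, h1]; simp
      · rw [hb, h2]; simp
    have h1 := hmin _ hu
    have h2 : N v = (g:ℝ)^2 * N (a,b) := by
      simp only [hN]
      rw [ha, hb]; push_cast; ring
    have h3 := hpos _ hu
    by_contra hne
    have h4 : 2 ≤ g := by omega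
    have h5 : (2:ℝ) ≤ g := by exact_mod_cast h4
    have h6 : (4:ℝ) ≤ (g:ℝ)^2 := by nlinarith
    have h7 := mul_le_mul_of_nonneg_right h6 h3.le
    linarith
  obtain ⟨z0, w0, hzw⟩ : ∃ z0 w0 : ℤ, v.1 * w0 - z0 * v.2 = 1 := by
    have := Int.gcd_eq_gcd_ab v.1 v.2
    rw [hcop] at this
    refine ⟨-Int.gcdB v.1 v.2, Int.gcdA v.1 v.2, ?_⟩
    push_cast at this
    linarith
  have hn1 := hpos v hv0
  set t0 : ℝ := 2 * p * v.1 * z0 + q * (v.1 * w0 + v.2 * z0) + 2 * r * v.2 * w0 with ht0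
  set k : ℤ := round (t0 / (2 * N v)) with hk
  have hround := abs_sub_round (t0 / (2 * N v))
  rw [← hk] at hround
  have hne : ((z0 - k * v.1, w0 - k * v.2) : ℤ × ℤ) ≠ 0 := by
    intro h
    have h1 : z0 - k * v.1 = 0 := congrArg Prod.fst h
    have h2 : w0 - k * v.2 = 0 := congrArg Prod.snd h
    have h3 : z0 = k * v.1 := by linarith
    have h4 : w0 = k * v.2 := by linarith
    rw [h3, h4] at hzw
    have : v.1 * (k * v.2) - k * v.1 * v.2 = 0 := by ring
    omega
  refine ⟨v.1, v.2, z0 - k * v.1, w0 - k * v.2, ?_, hn1, ?_, ?_⟩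
  · linear_combination hzw
  · have := hmin _ hne
    simpa [hN] using this
  · have h6 : 2 * p * v.1 * ((z0 - k * v.1 : ℤ):ℝ) + q * (v.1 * ((w0 - k * v.2:ℤ):ℝ) + v.2 * ((z0 - k * v.1 : ℤ):ℝ)) + 2 * r * v.2 * ((w0 - k * v.2:ℤ):ℝ) = (t0 / (2 * N v) - k) * (2 * N v) := by
      have : (t0 / (2 * N v) - k) * (2 * N v) = t0 - k * (2 * N v) := by
        field_simp
      rw [this, ht0]; simp only [hN]; push_cast; ring
    rw [h6, abs_mul, abs_of_pos (by positivity : 0 < 2 * N v)]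
    change _ ≤ N v
    nlinarith

/-- A finite set of integers in a real interval. -/
theorem card_int_le (S : Finset ℤ) (u l : ℝ) (hl : 0 ≤ l) (h : ∀ z ∈ S, u ≤ z ∧ (z:ℝ) ≤ u + l) :
    (S.card : ℝ) ≤ l + 1 := by
  have hsub : S ⊆ Finset.Icc ⌈u⌉ ⌊u + l⌋ := by
    intro z hz
    rw [Finset.mem_Icc]
    exact ⟨Int.ceil_le.mpr (h z hz).1, Int.le_floor.mpr (h z hz).2⟩
  have h1 : (S.card : ℝ) ≤ ((Finset.Icc ⌈u⌉ ⌊u + l⌋).card : ℝ) := by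
    exact_mod_cast Finset.card_le_card hsub
  rw [Int.card_Icc] at h1
  have h2 : (((⌊u + l⌋ + 1 - ⌈u⌉).toNat : ℤ) : ℝ) ≤ l + 1 := by
    rcases le_total 0 (⌊u + l⌋ + 1 - ⌈u⌉) with h3 | h3
    · rw [Int.toNat_of_nonneg h3]
      push_cast
      have := Int.floor_le (u + l)
      have := Int.le_ceil u
      linarith
    · rw [Int.toNat_of_nonpos h3]; simp; linarith
  exact h1.trans (by exact_mod_cast h2)

set_option maxHeartbeats 1000000 in
/-- Number of coprime lattice points in an ellipse. -/
theorem card_ellipse (p q r : ℝ) (hp : 0 < p) (hD : 0 < 4 * p * r - q ^ 2) (S : Finset (ℤ × ℤ))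
    (hS : ∀ w ∈ S, Int.gcd w.1 w.2 = 1 ∧ p * (w.1:ℝ) ^ 2 + q * w.1 * w.2 + r * (w.2:ℝ) ^ 2 ≤ 1) :
    (S.card : ℝ) ≤ 2 + 36 / √(4 * p * r - q ^ 2) := by
  obtain ⟨x, y, z, w, hdet, hn1, hn12, ht⟩ := gaussRed p q r hp hD
  set n1 := p * (x:ℝ) ^ 2 + q * x * y + r * (y:ℝ) ^ 2 with hn1d
  set n2 := p * (z:ℝ) ^ 2 + q * z * w + r * (w:ℝ) ^ 2 with hn2d
  set t := 2 * p * x * z + q * (x * w + y * z) + 2 * r * y * w with htd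
  have hdetR : (x:ℝ) * w - z * y = 1 := by exact_mod_cast hdet
  have hdisc : 4 * n1 * n2 - t ^ 2 = 4 * p * r - q ^ 2 := by
    have : 4 * n1 * n2 - t ^ 2 = (4 * p * r - q ^ 2) * ((x:ℝ) * w - z * y)^2 := by
      rw [hn1d, hn2d, htd]; ring
    rw [this, hdetR]; ring
  set De := 4 * p * r - q ^ 2 with hDe
  have hn2 : 0 < n2 := lt_of_lt_of_le hn1 hn12
  -- coordinates
  let φ : ℤ × ℤ → ℤ × ℤ := fun u => (w * u.1 - z * u.2, -y * u.1 + x * u.2)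
  have hinv1 : ∀ u : ℤ × ℤ, u.1 = x * (φ u).1 + z * (φ u).2 := by
    intro u; simp only [φ]; linear_combination (-u.1) * hdet
  have hinv2 : ∀ u : ℤ × ℤ, u.2 = y * (φ u).1 + w * (φ u).2 := by
    intro u; simp only [φ]; linear_combination (-u.2) * hdet
  have hφinj : Function.Injective φ := by
    intro u u' h
    refine Prod.ext ?_ ?_
    · rw [hinv1 u, hinv1 u', h]
    · rw [hinv2 u, hinv2 u', h]
  have hval : ∀ u ∈ S, n1 * ((φ u).1:ℝ)^2 + n2 * ((φ u).2:ℝ)^2 ≤ 2 := by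
    intro u hu
    have h1 := (hS u hu).2
    have e1 : (u.1:ℝ) = x * ((φ u).1:ℝ) + z * ((φ u).2:ℝ) := by exact_mod_cast hinv1 u
    have e2 : (u.2:ℝ) = y * ((φ u).1:ℝ) + w * ((φ u).2:ℝ) := by exact_mod_cast hinv2 u
    set i : ℝ := ((φ u).1:ℝ)
    set j : ℝ := ((φ u).2:ℝ)
    have h2 : n1 * i^2 + t * i * j + n2 * j^2 ≤ 1 := by
      calc n1 * i^2 + t * i * j + n2 * j^2 = p * (u.1:ℝ) ^ 2 + q * u.1 * u.2 + r * (u.2:ℝ) ^ 2 := by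
            rw [e1, e2, hn1d, hn2d, htd]; ring
        _ ≤ 1 := h1
    have h3 : -(t * i * j) ≤ n1 * (i^2 + j^2) / 2 := by
      have h4 : -(t * i * j) ≤ |t| * |i * j| := by
        rw [← abs_mul, ← mul_assoc]; exact neg_le_abs _
      have h5 : |i * j| ≤ (i^2 + j^2)/2 := by
        rw [abs_le]; constructor <;> nlinarith [sq_nonneg (i + j), sq_nonneg (i - j)]
      have h6 : |t| * |i * j| ≤ n1 * ((i^2 + j^2)/2) := by gcongr
      linarith
    have h7 := mul_le_mul_of_nonneg_right hn12 (sq_nonneg j)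
    have h8 : n1 * (i^2 + j^2) / 2 = n1 * i^2 / 2 + n1 * j^2 / 2 := by ring
    linarith
  have hsq : 0 < √De := Real.sqrt_pos.mpr hD
  rw [← Finset.card_image_of_injective S hφinj]
  by_cases hbig : 2 < n2
  · have hsub : S.image φ ⊆ {((1:ℤ),(0:ℤ)), ((-1:ℤ),(0:ℤ))} := by
      intro v hv
      obtain ⟨u, hu, rfl⟩ := Finset.mem_image.mp hv
      have h1 := hval u hu
      have hj : (φ u).2 = 0 := by
        by_contra hne
        have : (1:ℝ) ≤ ((φ u).2:ℝ)^2 := by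
          have : 1 ≤ (φ u).2^2 := by
            have : 0 < (φ u).2^2 := by positivity
            omega
          exact_mod_cast this
        nlinarith [mul_nonneg hn1.le (sq_nonneg ((φ u).1:ℝ))]
      have hg := (hS u hu).1
      rw [hinv1 u, hinv2 u, hj, mul_zero, mul_zero, add_zero, add_zero, Int.gcd_mul_right] at hg
      have h2 : ((φ u).1).natAbs = 1 := Nat.eq_one_of_mul_eq_one_left hg
      rcases Int.natAbs_eq_iff.mp h2 with h3 | h3
      · simp [Prod.ext_iff, hj, h3]
      · simp [Prod.ext_iff, hj, h3]
    have h2 : (S.image φ).card ≤ 2 := (Finset.card_le_card hsub).trans Finset.card_le_two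
    have h3 : ((S.image φ).card : ℝ) ≤ 2 := by exact_mod_cast h2
    have : 0 ≤ 36 / √De := by positivity
    linarith
  · push Not at hbig
    have aux : ∀ (n : ℝ) (T : Finset ℤ), 0 < n → n ≤ 2 → (∀ k ∈ T, n * (k:ℝ)^2 ≤ 2) →
        (T.card : ℝ) ≤ 3 * √2 / √n := by
      intro n T hn hn2 hT
      have hs : 0 < √n := Real.sqrt_pos.mpr hn
      have h1 : (1:ℝ) ≤ √2 / √n := by
        rw [le_div_iff₀ hs, one_mul]; exact Real.sqrt_le_sqrt hn2
      have h2 := card_int_le T (-(√2/√n)) (2 * (√2/√n)) (by positivity) (by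
        intro k hk
        have h3 : |(k:ℝ)| ≤ √2 / √n := by
          rw [← Real.sqrt_div (by norm_num)]
          apply Real.abs_le_sqrt
          rw [le_div_iff₀ hn]; linarith [hT k hk]
        rw [abs_le] at h3
        constructor <;> linarith)
      calc (T.card : ℝ) ≤ 2 * (√2/√n) + 1 := h2
        _ ≤ 3 * (√2/√n) := by linarith
        _ = 3 * √2 / √n := by ring
    have hsub : S.image φ ⊆ ((S.image φ).image Prod.fst) ×ˢ ((S.image φ).image Prod.snd) :=
      Finset.subset_product
    have c1 := aux n1 ((S.image φ).image Prod.fst) hn1 (hn12.trans hbig) (by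
      intro k hk
      obtain ⟨v, hv, rfl⟩ := Finset.mem_image.mp hk
      obtain ⟨u, hu, rfl⟩ := Finset.mem_image.mp hv
      have := hval u hu
      nlinarith [mul_nonneg hn2.le (sq_nonneg ((φ u).2:ℝ))])
    have c2 := aux n2 ((S.image φ).image Prod.snd) hn2 hbig (by
      intro k hk
      obtain ⟨v, hv, rfl⟩ := Finset.mem_image.mp hk
      obtain ⟨u, hu, rfl⟩ := Finset.mem_image.mp hv
      have := hval u hu
      nlinarith [mul_nonneg hn1.le (sq_nonneg ((φ u).1:ℝ))])
    have c3 : ((S.image φ).card : ℝ) ≤ (3 * √2 / √n1) * (3 * √2 / √n2) := by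
      have := Finset.card_le_card hsub
      rw [Finset.card_product] at this
      calc ((S.image φ).card : ℝ) ≤ (((S.image φ).image Prod.fst).card : ℝ) * (((S.image φ).image Prod.snd).card : ℝ) := by exact_mod_cast this
        _ ≤ _ := mul_le_mul c1 c2 (Nat.cast_nonneg _) ((Nat.cast_nonneg _).trans c1)
    have c4 : √De ≤ 2 * (√n1 * √n2) := by
      rw [← Real.sqrt_mul hn1.le n2]
      apply Real.sqrt_le_iff.mpr
      refine ⟨mul_nonneg (by norm_num) (Real.sqrt_nonneg _), ?_⟩
      rw [mul_pow, Real.sq_sqrt (mul_nonneg hn1.le hn2.le)]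
      have := sq_nonneg t
      linarith [hdisc]
    have s1 : 0 < √n1 := Real.sqrt_pos.mpr hn1
    have s2 : 0 < √n2 := Real.sqrt_pos.mpr hn2
    have c5 : (3 * √2 / √n1) * (3 * √2 / √n2) = 18 / (√n1 * √n2) := by
      have : √2 * √2 = 2 := Real.mul_self_sqrt (by norm_num)
      field_simp
      nlinarith
    have c6 : 18 / (√n1 * √n2) ≤ 36 / √De := by
      rw [div_le_div_iff₀ (by positivity) hsq]
      linarith
    linarith

end Part1

section Part2
section forms
variable {R : Type*} [CommRing R]
def cF (a b c d X Y : R) : R := a * X ^ 3 + 3 * b * X ^ 2 * Y + 3 * c * X * Y ^ 2 + d * Y ^ 3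
def cA (a b c : R) : R := a * c - b ^ 2
def cB (a b c d : R) : R := a * d - b * c
def cD (a b c d : R) : R := (cB a b c d) ^ 2 - 4 * cA a b c * cA b c d
def cH (a b c d X Y : R) : R := cA a b c * X ^ 2 + cB a b c d * X * Y + cA b c d * Y ^ 2
end forms

theorem cube_root (k : ℝ) : ∃ r : ℝ, r ^ 3 = k := by
  have key : ∀ k : ℝ, 0 ≤ k → ∃ r : ℝ, 0 ≤ r ∧ r ^ 3 = k := by
    intro k hk
    refine ⟨k ^ ((1:ℝ)/3), by positivity, ?_⟩
    rw [← Real.rpow_natCast, ← Real.rpow_mul hk]; norm_num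
  rcases le_total 0 k with h | h
  · obtain ⟨r, _, hr⟩ := key k h; exact ⟨r, hr⟩
  · obtain ⟨r, _, hr⟩ := key (-k) (by linarith)
    exact ⟨-r, by rw [Odd.neg_pow (by decide), hr]; ring⟩

theorem canon_aux (a b c d : ℝ) (hD : 0 < cD a b c d) (hA : cA a b c ≠ 0) :
    ∃ α β γ δ : ℝ, a = α ^ 3 + γ ^ 3 ∧ b = α ^ 2 * β + γ ^ 2 * δ ∧
      c = α * β ^ 2 + γ * δ ^ 2 ∧ d = β ^ 3 + δ ^ 3 := by
  set A := cA a b c with hAd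
  set B := cB a b c d with hBd
  set C := cA b c d with hCd
  set s := √(cD a b c d) with hs
  have hs2 : s ^ 2 = B ^ 2 - 4 * A * C := by rw [hs, Real.sq_sqrt hD.le]; rfl
  have hspos : 0 < s := Real.sqrt_pos.mpr hD
  set t1 := (B + s) / (2 * A) with ht1
  set t2 := (B - s) / (2 * A) with ht2
  have q1 : A * t1 ^ 2 = B * t1 - C := by
    rw [ht1]; field_simp; linear_combination hs2
  have q2 : A * t2 ^ 2 = B * t2 - C := by
    rw [ht2]; field_simp; linear_combination hs2
  have hdiff : t1 - t2 ≠ 0 := by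
    have : t1 - t2 = s / A := by rw [ht1, ht2]; field_simp; ring
    rw [this]; positivity
  set k1 := (b - a * t2) / (t1 - t2) with hk1
  set k2 := (a * t1 - b) / (t1 - t2) with hk2
  have e1 : k1 + k2 = a := by rw [hk1, hk2]; field_simp; ring
  have e2 : k1 * t1 + k2 * t2 = b := by rw [hk1, hk2]; field_simp; ring
  have i1 : B * b - C * a = c * A := by rw [hAd, hBd, hCd]; simp only [cA, cB]; ring
  have i2 : B * c - C * b = d * A := by rw [hAd, hBd, hCd]; simp only [cA, cB]; ring
  have e3 : k1 * t1 ^ 2 + k2 * t2 ^ 2 = c := by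
    apply mul_right_cancel₀ hA
    linear_combination k1 * q1 + k2 * q2 + B * e2 - C * e1 + i1
  have e4 : k1 * t1 ^ 3 + k2 * t2 ^ 3 = d := by
    apply mul_right_cancel₀ hA
    linear_combination k1 * t1 * q1 + k2 * t2 * q2 + B * e3 - C * e2 + i2
  obtain ⟨α, hα⟩ := cube_root k1
  obtain ⟨γ, hγ⟩ := cube_root k2
  refine ⟨α, α * t1, γ, γ * t2, ?_, ?_, ?_, ?_⟩
  · rw [hα, hγ, e1]
  · rw [← e2, ← hα, ← hγ]; ring
  · rw [← e3, ← hα, ← hγ]; ring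
  · rw [← e4, ← hα, ← hγ]; ring

theorem canon (a b c d : ℝ) (hD : 0 < cD a b c d) :
    ∃ α β γ δ : ℝ, a = α ^ 3 + γ ^ 3 ∧ b = α ^ 2 * β + γ ^ 2 * δ ∧
      c = α * β ^ 2 + γ * δ ^ 2 ∧ d = β ^ 3 + δ ^ 3 := by
  by_cases hA : cA a b c ≠ 0
  · exact canon_aux a b c d hD hA
  by_cases hC : cA b c d ≠ 0
  · have hsw : cD d c b a = cD a b c d := by simp only [cD, cA, cB]; ring
    obtain ⟨α, β, γ, δ, h1, h2, h3, h4⟩ := canon_aux d c b a (by rw [hsw]; exact hD) (by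
      have : cA d c b = cA b c d := by simp only [cA]; ring
      rw [this]; exact hC)
    refine ⟨β, α, δ, γ, h4, ?_, ?_, h1⟩
    · rw [h3]; ring
    · rw [h2]; ring
  push Not at hA hC
  have hB : cB a b c d ≠ 0 := by
    intro h
    rw [cD, hA, h] at hD
    norm_num at hD
  have hb : b = 0 := by
    apply mul_right_cancel₀ hB
    have : b * cB a b c d = c * cA a b c + a * cA b c d := by simp only [cA, cB]; ring
    rw [this, hA, hC]; ring
  have hc : c = 0 := by
    apply mul_right_cancel₀ hB
    have : c * cB a b c d = d * cA a b c + b * cA b c d := by simp only [cA, cB]; ring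
    rw [this, hA, hC]; ring
  obtain ⟨α, hα⟩ := cube_root a
  obtain ⟨δ, hδ⟩ := cube_root d
  exact ⟨α, 0, 0, δ, by simp [hα], by simp [hb], by simp [hc], by simp [hδ]⟩

theorem syzygy (a b c d X Y : ℝ) :
    ∃ G : ℝ, G ^ 2 + 4 * (cH a b c d X Y) ^ 3 = cD a b c d * (cF a b c d X Y) ^ 2 := by
  refine ⟨(a * X ^ 2 + 2 * b * X * Y + c * Y ^ 2) * (cB a b c d * X + 2 * cA b c d * Y) -
    (b * X ^ 2 + 2 * c * X * Y + d * Y ^ 2) * (2 * cA a b c * X + cB a b c d * Y), ?_⟩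
  simp only [cH, cD, cF, cA, cB]; ring

theorem negA (a b c d : ℝ) (hD : cD a b c d < 0) : cA a b c < 0 := by
  obtain ⟨G, hG⟩ := syzygy a b c d 1 0
  have h1 : cH a b c d 1 0 = cA a b c := by simp [cH]
  rw [h1] at hG
  have h2 : cA a b c ^ 3 ≤ 0 := by nlinarith [sq_nonneg G, sq_nonneg (cF a b c d 1 0)]
  have h3 : cA a b c ≠ 0 := by
    intro h; rw [cD, h] at hD; nlinarith [sq_nonneg (cB a b c d)]
  by_contra hcon
  push Not at hcon
  have : 0 < cA a b c := lt_of_le_of_ne hcon (Ne.symm h3)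
  have : 0 < cA a b c ^ 3 := by positivity
  linarith

theorem lemmaN (a b c d : ℝ) (hD : cD a b c d ≠ 0) :
    ∃ p q r : ℝ, 0 < p ∧ 0 < 4 * p * r - q ^ 2 ∧ (4 * p * r - q ^ 2) ^ 3 ≤ 64 * |cD a b c d| ∧
      ∀ X Y : ℝ, (cF a b c d X Y) ^ 2 ≤ (p * X ^ 2 + q * X * Y + r * Y ^ 2) ^ 3 := by
  rcases lt_or_gt_of_ne hD with h | h
  · have hA := negA a b c d h
    obtain ⟨k, hk⟩ := cube_root (4 / |cD a b c d|)
    have hDa : |cD a b c d| = - cD a b c d := abs_of_neg h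
    have hDp : 0 < |cD a b c d| := abs_pos.mpr hD
    have hk0 : 0 < k := by
      have : 0 < k ^ 3 := by rw [hk]; positivity
      by_contra hcon
      push Not at hcon
      nlinarith [sq_nonneg k, pow_succ k 2, mul_nonneg (sq_nonneg k) (neg_nonneg.mpr hcon)]
    have hΔ : 4 * (-k * cA a b c) * (-k * cA b c d) - (-k * cB a b c d) ^ 2
        = k ^ 2 * |cD a b c d| := by rw [hDa]; simp only [cD]; ring
    refine ⟨-k * cA a b c, -k * cB a b c d, -k * cA b c d, by nlinarith, ?_, ?_, ?_⟩
    · rw [hΔ]; positivity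
    · rw [hΔ]
      have : (k ^ 2 * |cD a b c d|) ^ 3 = (k ^ 3) ^ 2 * |cD a b c d| ^ 3 := by ring
      rw [this, hk]
      have : (4 / |cD a b c d|) ^ 2 * |cD a b c d| ^ 3 = 16 * |cD a b c d| := by
        field_simp; norm_num
      rw [this]; linarith
    · intro X Y
      obtain ⟨G, hG⟩ := syzygy a b c d X Y
      have e : (-k * cA a b c * X ^ 2 + -k * cB a b c d * X * Y + -k * cA b c d * Y ^ 2) ^ 3
          = k ^ 3 * (- (cH a b c d X Y) ^ 3) := by simp only [cH]; ring
      rw [e, hk, div_mul_eq_mul_div, le_div_iff₀ hDp, hDa]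
      nlinarith [sq_nonneg G]
  · obtain ⟨α, β, γ, δ, rfl, rfl, rfl, rfl⟩ := canon a b c d h
    have hDe : cD (α ^ 3 + γ ^ 3) (α ^ 2 * β + γ ^ 2 * δ) (α * β ^ 2 + γ * δ ^ 2) (β ^ 3 + δ ^ 3)
        = (α * δ - γ * β) ^ 6 := by simp only [cD, cA, cB]; ring
    rw [hDe] at h hD ⊢
    have hne : α * δ - γ * β ≠ 0 := by
      intro h0; rw [h0] at h; norm_num at h
    have hΔ : 4 * (α ^ 2 + γ ^ 2) * (β ^ 2 + δ ^ 2) - (2 * (α * β + γ * δ)) ^ 2 =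
        4 * (α * δ - γ * β) ^ 2 := by ring
    refine ⟨α ^ 2 + γ ^ 2, 2 * (α * β + γ * δ), β ^ 2 + δ ^ 2, ?_, ?_, ?_, ?_⟩
    · by_contra hcon
      have h1 : α = 0 := by nlinarith [sq_nonneg α, sq_nonneg γ]
      have h2 : γ = 0 := by nlinarith [sq_nonneg α, sq_nonneg γ]
      apply hne; rw [h1, h2]; ring
    · rw [hΔ]; positivity
    · rw [hΔ, abs_of_pos h]; apply le_of_eq; ring
    · intro X Y
      have e1 : cF (α ^ 3 + γ ^ 3) (α ^ 2 * β + γ ^ 2 * δ) (α * β ^ 2 + γ * δ ^ 2) (β ^ 3 + δ ^ 3) X Y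
        = (α * X + β * Y) ^ 3 + (γ * X + δ * Y) ^ 3 := by simp only [cF]; ring
      have e2 : (α ^ 2 + γ ^ 2) * X ^ 2 + 2 * (α * β + γ * δ) * X * Y + (β ^ 2 + δ ^ 2) * Y ^ 2
        = (α * X + β * Y) ^ 2 + (γ * X + δ * Y) ^ 2 := by ring
      rw [e1, e2]
      generalize α * X + β * Y = u
      generalize γ * X + δ * Y = v
      have : 0 ≤ (u * v) ^ 2 * (2 * u ^ 2 + 2 * v ^ 2 + (u - v) ^ 2) := by positivity
      nlinarith

theorem card_ellipse2 (α β γ δ u v : ℝ) (hu : 0 < u) (hv : 0 < v) (hδ : α * δ - γ * β ≠ 0)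
    (S : Finset (ℤ × ℤ))
    (hS : ∀ w ∈ S, Int.gcd w.1 w.2 = 1 ∧
      u * (α * w.1 + β * w.2) ^ 2 + v * (γ * w.1 + δ * w.2) ^ 2 ≤ 1) :
    (S.card : ℝ) ≤ 2 + 36 / √(4 * u * v * (α * δ - γ * β) ^ 2) := by
  have hΔ : 4 * (u * α ^ 2 + v * γ ^ 2) * (u * β ^ 2 + v * δ ^ 2) -
      (2 * (u * α * β + v * γ * δ)) ^ 2 = 4 * u * v * (α * δ - γ * β) ^ 2 := by ring
  rw [← hΔ]
  apply card_ellipse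
  · by_contra hcon
    have h1 : 0 ≤ u * α ^ 2 := by positivity
    have h2 : 0 ≤ v * γ ^ 2 := by positivity
    have h3 : u * α ^ 2 = 0 := by linarith
    have h4 : v * γ ^ 2 = 0 := by linarith
    have h5 : α = 0 := by
      rcases mul_eq_zero.mp h3 with h | h
      · linarith
      · exact pow_eq_zero_iff (by norm_num) |>.mp h
    have h6 : γ = 0 := by
      rcases mul_eq_zero.mp h4 with h | h
      · linarith
      · exact pow_eq_zero_iff (by norm_num) |>.mp h
    apply hδ; rw [h5, h6]; ring
  · rw [hΔ]; positivity
  · intro w hw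
    refine ⟨(hS w hw).1, le_trans (le_of_eq ?_) (hS w hw).2⟩
    ring

theorem split_est (R m u v : ℝ) (hR : 0 < R) (hm : 0 < m) (h1 : R ^ 3 ≤ u ^ 3 + v ^ 3)
    (h2 : u ^ 3 + v ^ 3 ≤ 2 * R ^ 3) (huv : |u * v| ≤ m) (h : |v| ≤ |u| / 2) :
    1 / (8 * R ^ 2) * u ^ 2 + R ^ 2 / (8 * m ^ 2) * v ^ 2 ≤ 1 := by
  have hv3 : |v| ^ 3 ≤ |u| ^ 3 / 8 := by
    calc |v| ^ 3 ≤ (|u| / 2) ^ 3 := by gcongr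
      _ = _ := by ring
  have a1 : |u ^ 3| = |u| ^ 3 := abs_pow u 3
  have a2 : |v ^ 3| = |v| ^ 3 := abs_pow v 3
  have b1 := le_abs_self (u ^ 3)
  have b2 := le_abs_self (v ^ 3)
  have b3 := neg_abs_le (v ^ 3)
  have hR3 : 0 < R ^ 3 := by positivity
  have hu3 : u ^ 3 = |u| ^ 3 := by
    rcases abs_choice (u ^ 3) with hh | hh
    · rw [← a1, hh]
    · exfalso
      rw [a1] at hh; rw [a2] at b2 b3
      have := abs_nonneg u
      have : 0 ≤ |u| ^ 3 := by positivity
      linarith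
  rw [a2] at b2 b3
  have c1 : R ^ 3 / 8 ≤ |u| ^ 3 := by
    have : R ^ 3 ≤ |u| ^ 3 * (9/8) := by linarith
    linarith
  have c2 : |u| ^ 3 ≤ (2 * R) ^ 3 := by
    have : (2 * R) ^ 3 = 8 * R ^ 3 := by ring
    linarith
  have d1 : R / 2 ≤ |u| := by
    apply le_of_pow_le_pow_left₀ (n := 3) (by norm_num) (abs_nonneg u)
    calc (R/2) ^ 3 = R ^ 3 / 8 := by ring
      _ ≤ _ := c1
  have d2 : |u| ≤ 2 * R := le_of_pow_le_pow_left₀ (n := 3) (by norm_num) (by positivity) c2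
  have d3 : |v| * R ≤ 2 * m := by
    rw [abs_mul] at huv
    have := mul_le_mul_of_nonneg_right d1 (abs_nonneg v)
    linarith
  have e1 : u ^ 2 ≤ 4 * R ^ 2 := by
    rw [← sq_abs u]; nlinarith [abs_nonneg u]
  have e2 : R ^ 2 * v ^ 2 ≤ 4 * m ^ 2 := by
    rw [← sq_abs v]
    calc R ^ 2 * |v| ^ 2 = (|v| * R) ^ 2 := by ring
      _ ≤ (2 * m) ^ 2 := by gcongr
      _ = _ := by ring
  have f1 : 1 / (8 * R ^ 2) * u ^ 2 ≤ 1 / 2 := by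
    rw [div_mul_eq_mul_div, div_le_iff₀ (by positivity)]; linarith
  have f2 : R ^ 2 / (8 * m ^ 2) * v ^ 2 ≤ 1 / 2 := by
    rw [div_mul_eq_mul_div, div_le_iff₀ (by positivity)]; linarith
  linarith

theorem lemmaW (a b c d Q M : ℝ) (hQ : 0 < Q) (hM : 0 < M) (hD : cD a b c d ≠ 0)
    (S : Finset (ℤ × ℤ))
    (hS : ∀ w ∈ S, Int.gcd w.1 w.2 = 1 ∧ Q ≤ cF a b c d w.1 w.2 ∧ cF a b c d w.1 w.2 ≤ 2 * Q ∧
      |cH a b c d w.1 w.2| ≤ M) :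
    (S.card : ℝ) ≤ 360 * (1 + M / √|cD a b c d|) := by
  rcases lt_or_gt_of_ne hD with h | h
  · have hA := negA a b c d h
    have hDa : |cD a b c d| = - cD a b c d := abs_of_neg h
    have hDp : 0 < |cD a b c d| := abs_pos.mpr hD
    have hΔ : 4 * (- cA a b c / M) * (- cA b c d / M) - (- cB a b c d / M) ^ 2
        = |cD a b c d| / M ^ 2 := by rw [hDa]; simp only [cD]; field_simp; ring
    have := card_ellipse (- cA a b c / M) (- cB a b c d / M) (- cA b c d / M)
      (div_pos (by linarith) hM) (by rw [hΔ]; positivity) S (by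
        intro w hw
        obtain ⟨h1, _, _, h4⟩ := hS w hw
        refine ⟨h1, ?_⟩
        have e : - cA a b c / M * (w.1:ℝ) ^ 2 + - cB a b c d / M * w.1 * w.2 + - cA b c d / M * (w.2:ℝ) ^ 2
          = - cH a b c d w.1 w.2 / M := by simp only [cH]; ring
        rw [e, div_le_one hM]
        exact (neg_le_abs _).trans h4)
    rw [hΔ, Real.sqrt_div hDp.le, Real.sqrt_sq hM.le, div_div_eq_mul_div] at this
    have h3 : 36 * M / √|cD a b c d| = 36 * (M / √|cD a b c d|) := by ring
    rw [h3] at this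
    have : 0 ≤ M / √|cD a b c d| := by positivity
    linarith
  · obtain ⟨α, β, γ, δ, rfl, rfl, rfl, rfl⟩ := canon a b c d h
    have hDe : cD (α ^ 3 + γ ^ 3) (α ^ 2 * β + γ ^ 2 * δ) (α * β ^ 2 + γ * δ ^ 2) (β ^ 3 + δ ^ 3)
        = (α * δ - γ * β) ^ 6 := by simp only [cD, cA, cB]; ring
    have hFe : ∀ X Y : ℝ, cF (α ^ 3 + γ ^ 3) (α ^ 2 * β + γ ^ 2 * δ) (α * β ^ 2 + γ * δ ^ 2)
        (β ^ 3 + δ ^ 3) X Y = (α * X + β * Y) ^ 3 + (γ * X + δ * Y) ^ 3 := by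
      intro X Y; simp only [cF]; ring
    have hHe : ∀ X Y : ℝ, cH (α ^ 3 + γ ^ 3) (α ^ 2 * β + γ ^ 2 * δ) (α * β ^ 2 + γ * δ ^ 2)
        (β ^ 3 + δ ^ 3) X Y = (α * δ - γ * β) ^ 2 * ((α * X + β * Y) * (γ * X + δ * Y)) := by
      intro X Y; simp only [cH, cA, cB]; ring
    rw [hDe] at h hD ⊢
    simp only [hFe, hHe] at hS
    have hne : α * δ - γ * β ≠ 0 := by
      intro h0; rw [h0] at h; norm_num at h
    have hne2 : γ * β - α * δ ≠ 0 := by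
      intro h0; apply hne; linarith
    set e := α * δ - γ * β with he
    have he2 : 0 < e ^ 2 := by positivity
    obtain ⟨R, hR3⟩ := cube_root Q
    have hR : 0 < R := by
      by_contra hcon
      push Not at hcon
      have : R ^ 3 ≤ 0 := by
        have := mul_nonneg (sq_nonneg R) (neg_nonneg.mpr hcon)
        nlinarith
      linarith
    obtain ⟨m, hm⟩ : ∃ m, m = M / e ^ 2 := ⟨_, rfl⟩
    have hmp : 0 < m := by rw [hm]; positivity
    have hprod : ∀ w ∈ S, |(α * w.1 + β * w.2) * (γ * w.1 + δ * w.2)| ≤ m := by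
      intro w hw
      have := (hS w hw).2.2.2
      rw [abs_mul, abs_of_pos he2] at this
      rw [hm, le_div_iff₀ he2]; linarith
    set S1 := S.filter (fun w => |γ * w.1 + δ * w.2| ≤ |α * w.1 + β * w.2| / 2) with hS1
    set S2 := S.filter (fun w => |α * w.1 + β * w.2| ≤ |γ * w.1 + δ * w.2| / 2) with hS2
    set S3 := S.filter (fun w => |α * w.1 + β * w.2| / 2 < |γ * w.1 + δ * w.2| ∧
      |γ * w.1 + δ * w.2| / 2 < |α * w.1 + β * w.2|) with hS3
    have hsub : S ⊆ S1 ∪ S2 ∪ S3 := by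
      intro w hw
      simp only [hS1, hS2, hS3, Finset.mem_union, Finset.mem_filter, hw, true_and]
      by_cases g1 : |γ * (w.1:ℝ) + δ * w.2| ≤ |α * w.1 + β * w.2| / 2
      · exact Or.inl (Or.inl g1)
      by_cases g2 : |α * (w.1:ℝ) + β * w.2| ≤ |γ * w.1 + δ * w.2| / 2
      · exact Or.inl (Or.inr g2)
      · exact Or.inr ⟨not_le.mp g1, not_le.mp g2⟩
    have hcard : (S.card : ℝ) ≤ S1.card + S2.card + S3.card := by
      have t1 := Finset.card_le_card hsub
      have t2 := Finset.card_union_le (S1 ∪ S2) S3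
      have t3 := Finset.card_union_le S1 S2
      have : S.card ≤ S1.card + S2.card + S3.card := by omega
      exact_mod_cast this
    have he6 : √(e ^ 6) = |e| ^ 3 := by
      have : e ^ 6 = (|e| ^ 3) ^ 2 := by
        rw [← pow_mul]; exact (Even.pow_abs (by decide) e).symm
      rw [this, Real.sqrt_sq (by positivity)]
    have hae : 0 < |e| := abs_pos.mpr hne
    have hmM : m * |e| ^ 2 = M := by
      rw [sq_abs, hm]; field_simp
    have hX : M / √|e ^ 6| = m / |e| := by
      rw [abs_of_pos h, he6, ← hmM]; field_simp
    rw [hX]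
    have c1 : (S1.card : ℝ) ≤ 2 + 144 * (m / |e|) := by
      have := card_ellipse2 α β γ δ (1 / (8 * R ^ 2)) (R ^ 2 / (8 * m ^ 2)) (by positivity)
        (by positivity) hne S1 (by
          intro w hw
          rw [hS1, Finset.mem_filter] at hw
          obtain ⟨g1, g2, g3, g4⟩ := hS w hw.1
          exact ⟨g1, split_est R m _ _ hR hmp (by rw [hR3]; exact g2) (by rw [hR3]; exact g3)
            (hprod w hw.1) hw.2⟩)
      have e1 : 4 * (1 / (8 * R ^ 2)) * (R ^ 2 / (8 * m ^ 2)) * (α * δ - γ * β) ^ 2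
          = (|e| / (4 * m)) ^ 2 := by
        rw [← he, div_pow |e|, sq_abs]; field_simp; norm_num
      rw [e1, Real.sqrt_sq (by positivity)] at this
      have e2 : 36 / (|e| / (4 * m)) = 144 * (m / |e|) := by field_simp; norm_num
      rw [e2] at this; exact this
    have c2 : (S2.card : ℝ) ≤ 2 + 144 * (m / |e|) := by
      have := card_ellipse2 γ δ α β (1 / (8 * R ^ 2)) (R ^ 2 / (8 * m ^ 2)) (by positivity)
        (by positivity) hne2 S2 (by
          intro w hw
          rw [hS2, Finset.mem_filter] at hw
          obtain ⟨g1, g2, g3, g4⟩ := hS w hw.1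
          exact ⟨g1, split_est R m _ _ hR hmp (by rw [hR3]; linarith) (by rw [hR3]; linarith)
            (by rw [mul_comm]; exact hprod w hw.1) hw.2⟩)
      have e1 : 4 * (1 / (8 * R ^ 2)) * (R ^ 2 / (8 * m ^ 2)) * (γ * β - α * δ) ^ 2
          = (|e| / (4 * m)) ^ 2 := by
        have : (γ * β - α * δ) ^ 2 = e ^ 2 := by rw [he]; ring
        rw [this, div_pow |e|, sq_abs]; field_simp; norm_num
      rw [e1, Real.sqrt_sq (by positivity)] at this
      have e2 : 36 / (|e| / (4 * m)) = 144 * (m / |e|) := by field_simp; norm_num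
      rw [e2] at this; exact this
    have c3 : (S3.card : ℝ) ≤ 2 + 72 * (m / |e|) := by
      have := card_ellipse2 α β γ δ (1 / (4 * m)) (1 / (4 * m)) (by positivity)
        (by positivity) hne S3 (by
          intro w hw
          rw [hS3, Finset.mem_filter] at hw
          obtain ⟨g1, g2, g3, g4⟩ := hS w hw.1
          obtain ⟨k1, k2⟩ := hw.2
          have hp := hprod w hw.1
          refine ⟨g1, ?_⟩
          generalize α * (w.1:ℝ) + β * w.2 = u at *
          generalize γ * (w.1:ℝ) + δ * w.2 = v at *
          rw [abs_mul] at hp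
          rw [← sq_abs u, ← sq_abs v]
          have f1 : |u| ^ 2 ≤ 2 * m := by nlinarith [abs_nonneg u]
          have f2 : |v| ^ 2 ≤ 2 * m := by nlinarith [abs_nonneg v]
          rw [← mul_add, div_mul_eq_mul_div, div_le_iff₀ (by positivity)]
          linarith)
      have e1 : 4 * (1 / (4 * m)) * (1 / (4 * m)) * (α * δ - γ * β) ^ 2
          = (|e| / (2 * m)) ^ 2 := by
        rw [← he, div_pow |e|, sq_abs]; field_simp; norm_num
      rw [e1, Real.sqrt_sq (by positivity)] at this
      have e2 : 36 / (|e| / (2 * m)) = 72 * (m / |e|) := by field_simp; norm_num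
      rw [e2] at this; exact this
    have : 0 ≤ m / |e| := by positivity
    linarith

end Part2

section Part3
section forms
variable {R : Type*} [CommRing R]
def tB (a b c d p q r s : R) : R :=
  a * p ^ 2 * q + b * (p ^ 2 * s + 2 * p * q * r) + c * (2 * p * r * s + q * r ^ 2) + d * r ^ 2 * s
def tC (a b c d p q r s : R) : R :=
  a * p * q ^ 2 + b * (q ^ 2 * r + 2 * p * q * s) + c * (2 * q * r * s + p * s ^ 2) + d * r * s ^ 2

theorem tF_eq (a b c d p q r s X Y : R) :
    cF (cF a b c d p r) (tB a b c d p q r s) (tC a b c d p q r s) (cF a b c d q s) X Y =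
      cF a b c d (p * X + q * Y) (r * X + s * Y) := by
  simp only [cF, tB, tC]; ring

theorem tH_eq (a b c d p q r s X Y : R) :
    cH (cF a b c d p r) (tB a b c d p q r s) (tC a b c d p q r s) (cF a b c d q s) X Y =
      (p * s - q * r) ^ 2 * cH a b c d (p * X + q * Y) (r * X + s * Y) := by
  simp only [cF, tB, tC, cH, cA, cB]; ring

theorem tA_eq (a b c d p q r s : R) :
    cA (cF a b c d p r) (tB a b c d p q r s) (tC a b c d p q r s) =
      (p * s - q * r) ^ 2 * cH a b c d p r := by
  simp only [cF, tB, tC, cH, cA, cB]; ring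
theorem tBB_eq (a b c d p q r s : R) :
    cB (cF a b c d p r) (tB a b c d p q r s) (tC a b c d p q r s) (cF a b c d q s) =
      (p * s - q * r) ^ 2 * (2 * cA a b c * p * q + cB a b c d * (p * s + q * r) + 2 * cA b c d * r * s) := by
  simp only [cF, tB, tC, cA, cB]; ring
theorem tCC_eq (a b c d p q r s : R) :
    cA (tB a b c d p q r s) (tC a b c d p q r s) (cF a b c d q s) =
      (p * s - q * r) ^ 2 * cH a b c d q s := by
  simp only [cF, tB, tC, cH, cA, cB]; ring

theorem tD_eq (a b c d p q r s : R) :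
    cD (cF a b c d p r) (tB a b c d p q r s) (tC a b c d p q r s) (cF a b c d q s) =
      (p * s - q * r) ^ 6 * cD a b c d := by
  have : cD (cF a b c d p r) (tB a b c d p q r s) (tC a b c d p q r s) (cF a b c d q s) =
    (cB (cF a b c d p r) (tB a b c d p q r s) (tC a b c d p q r s) (cF a b c d q s)) ^ 2 -
    4 * cA (cF a b c d p r) (tB a b c d p q r s) (tC a b c d p q r s) *
      cA (tB a b c d p q r s) (tC a b c d p q r s) (cF a b c d q s) := rfl
  rw [this, tA_eq, tBB_eq, tCC_eq]
  simp only [cD, cH]; ring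
end forms

/-- Reduced forms with discriminant bounded by `X`. -/
def IsRed (X : ℝ) (v : ℤ × ℤ × ℤ × ℤ) : Prop :=
  cD v.1 v.2.1 v.2.2.1 v.2.2.2 ≠ 0 ∧ |(cD v.1 v.2.1 v.2.2.1 v.2.2.2 : ℤ)| ≤ X ∧
  ((v.1 = 0 ∧ |v.2.2.1| ≤ |v.2.1|) ∨
   ((|v.1| ≤ 10 * √X ∧ |v.2.2.2| ≤ 10 * √X ∧ |v.1 * v.2.2.2| ≤ 10 * √X) ∧
    (|v.2.1| ≤ 10 * √X ∧ |v.2.2.1| ≤ 10 * √X ∧ |v.2.1 * v.2.2.1| ≤ 10 * √X)))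

set_option maxHeartbeats 1000000 in
theorem type2_est (a b c d n1 n2 t X : ℝ) (hn1 : 0 < n1) (hn12 : n1 ≤ n2) (ht : |t| ≤ n1)
    (h1 : 1 ≤ |a|) (hdisc : (4 * n1 * n2 - t ^ 2) ^ 3 ≤ 64 * X)
    (hFN : ∀ u v : ℝ, (a * u ^ 3 + 3 * b * u ^ 2 * v + 3 * c * u * v ^ 2 + d * v ^ 3) ^ 2 ≤
        (n1 * u ^ 2 + t * u * v + n2 * v ^ 2) ^ 3) :
    (|a| ≤ 10 * √X ∧ |d| ≤ 10 * √X ∧ |a * d| ≤ 10 * √X) ∧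
    (|b| ≤ 10 * √X ∧ |c| ≤ 10 * √X ∧ |b * c| ≤ 10 * √X) := by
  have hn2 : 0 < n2 := hn1.trans_le hn12
  obtain ⟨y, hy⟩ : ∃ y, y = √n1 := ⟨_, rfl⟩
  obtain ⟨x, hx⟩ : ∃ x, x = √n2 := ⟨_, rfl⟩
  have hy2 : y ^ 2 = n1 := by rw [hy, Real.sq_sqrt hn1.le]
  have hx2 : x ^ 2 = n2 := by rw [hx, Real.sq_sqrt hn2.le]
  have hy0 : 0 < y := by rw [hy]; exact Real.sqrt_pos.mpr hn1
  have hx0 : 0 < x := by rw [hx]; exact Real.sqrt_pos.mpr hn2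
  have hyx : y ≤ x := by rw [hy, hx]; exact Real.sqrt_le_sqrt hn12
  have A1 : |a| ≤ y ^ 3 := by
    apply abs_le_of_sq_le_sq _ (by positivity)
    have := hFN 1 0
    have e : (y ^ 3) ^ 2 = n1 ^ 3 := by rw [← hy2]; ring
    rw [e]; ring_nf at this ⊢; exact this
  have D1 : |d| ≤ x ^ 3 := by
    apply abs_le_of_sq_le_sq _ (by positivity)
    have := hFN 0 1
    have e : (x ^ 3) ^ 2 = n2 ^ 3 := by rw [← hx2]; ring
    rw [e]; ring_nf at this ⊢; exact this
  have hyone : 1 ≤ y := by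
    by_contra hcon
    push Not at hcon
    have : y ^ 3 < 1 := pow_lt_one₀ hy0.le hcon (by norm_num)
    linarith
  have hxone : 1 ≤ x := hyone.trans hyx
  have htb : |t| ≤ x * y := by
    rw [← hy2] at ht; nlinarith
  obtain ⟨E, hE⟩ : ∃ E, E = (x * y) ^ 3 := ⟨_, rfl⟩
  have hxy1 : 1 ≤ x * y := by nlinarith
  have hE1 : 1 ≤ E := by rw [hE]; exact one_le_pow₀ hxy1
  have hEX : E ≤ 2 * √X := by
    have h1 : 3 * (x * y) ^ 2 ≤ 4 * n1 * n2 - t ^ 2 := by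
      rw [← hy2, ← hx2]
      have : t ^ 2 ≤ (x * y) ^ 2 := by
        rw [← sq_abs t]; gcongr
      linarith [show 4 * y ^ 2 * x ^ 2 = 4 * (x * y) ^ 2 by ring]
    have h2 : (3 * (x * y) ^ 2) ^ 3 ≤ 64 * X := by
      calc (3 * (x * y) ^ 2) ^ 3 ≤ (4 * n1 * n2 - t ^ 2) ^ 3 := by gcongr
        _ ≤ 64 * X := hdisc
    have h3 : E ^ 2 ≤ 4 * X := by
      rw [hE]
      have e : (3 * (x * y) ^ 2) ^ 3 = 27 * ((x * y) ^ 3) ^ 2 := by ring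
      rw [e] at h2
      linarith [sq_nonneg ((x * y) ^ 3)]
    have h4 : E ≤ √(4 * X) := Real.le_sqrt_of_sq_le h3
    rw [Real.sqrt_mul (by norm_num)] at h4
    have : √(4:ℝ) = 2 := by
      rw [show (4:ℝ) = 2 ^ 2 by norm_num]; exact Real.sqrt_sq (by norm_num)
    rw [this] at h4; exact h4
  have hbd : ∀ σ : ℝ, σ ^ 2 = 1 → |a * x ^ 3 + 3 * b * x ^ 2 * (σ * y) + 3 * c * x * (σ * y) ^ 2
      + d * (σ * y) ^ 3| ≤ 5.2 * E := by
    intro σ hσ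
    apply abs_le_of_sq_le_sq _ (by positivity)
    refine (hFN x (σ * y)).trans ?_
    have h1 : n1 * x ^ 2 + t * x * (σ * y) + n2 * (σ * y) ^ 2 ≤ 3 * (x * y) ^ 2 := by
      have e : n2 * (σ * y) ^ 2 = (x * y) ^ 2 := by rw [mul_pow, hσ, ← hx2]; ring
      rw [e, ← hy2]
      have h2 : t * x * (σ * y) ≤ (x * y) ^ 2 := by
        have h3 : |σ| = 1 := by
          have := sq_abs σ
          rw [hσ] at this
          have h5 := abs_nonneg σ
          nlinarith
        calc t * x * (σ * y) ≤ |t * x * (σ * y)| := le_abs_self _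
          _ = |t| * (x * y) := by
            rw [abs_mul, abs_mul, abs_mul, h3, abs_of_pos hx0, abs_of_pos hy0]; ring
          _ ≤ (x * y) * (x * y) := by gcongr
          _ = _ := by ring
      nlinarith
    have h0 : 0 ≤ n1 * x ^ 2 + t * x * (σ * y) + n2 * (σ * y) ^ 2 := by
      have : 0 ≤ (n1 * x ^ 2 + t * x * (σ * y) + n2 * (σ * y) ^ 2) ^ 3 :=
        (sq_nonneg _).trans (hFN x (σ * y))
      by_contra hcon
      push Not at hcon
      have := Odd.pow_neg (n := 3) (by decide) hcon
      linarith
    calc _ ≤ (3 * (x * y) ^ 2) ^ 3 := by gcongr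
      _ = 27 * E ^ 2 := by rw [hE]; ring
      _ ≤ (5.2 * E) ^ 2 := by nlinarith
  have hp := abs_le.mp (hbd 1 (by norm_num))
  have hm := abs_le.mp (hbd (-1) (by norm_num))
  have ep : a * x ^ 3 + 3 * b * x ^ 2 * (1 * y) + 3 * c * x * (1 * y) ^ 2 + d * (1 * y) ^ 3
    = a * x ^ 3 + 3 * (b * (x ^ 2 * y)) + 3 * (c * (x * y ^ 2)) + d * y ^ 3 := by ring
  have em : a * x ^ 3 + 3 * b * x ^ 2 * (-1 * y) + 3 * c * x * (-1 * y) ^ 2 + d * (-1 * y) ^ 3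
    = a * x ^ 3 - 3 * (b * (x ^ 2 * y)) + 3 * (c * (x * y ^ 2)) - d * y ^ 3 := by ring
  rw [ep] at hp
  rw [em] at hm
  have A2 := abs_le.mp A1
  have D2 := abs_le.mp D1
  have A3 : |a * x ^ 3| ≤ E := by
    rw [abs_mul, abs_of_pos (by positivity : 0 < x ^ 3), hE]
    calc |a| * x ^ 3 ≤ y ^ 3 * x ^ 3 := by gcongr
      _ = _ := by ring
  have D3 : |d * y ^ 3| ≤ E := by
    rw [abs_mul, abs_of_pos (by positivity : 0 < y ^ 3), hE]
    calc |d| * y ^ 3 ≤ x ^ 3 * y ^ 3 := by gcongr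
      _ = _ := by ring
  have A4 := abs_le.mp A3
  have D4 := abs_le.mp D3
  have C1 : |c * (x * y ^ 2)| ≤ 2.1 * E := by
    rw [abs_le]; constructor <;> linarith
  have B1 : |b * (x ^ 2 * y)| ≤ 2.1 * E := by
    rw [abs_le]; constructor <;> linarith
  have C2 : |c| ≤ 2.1 * (x ^ 2 * y) := by
    rw [abs_mul, abs_of_pos (by positivity : 0 < x * y ^ 2), hE] at C1
    have : 2.1 * (x * y) ^ 3 = (2.1 * (x ^ 2 * y)) * (x * y ^ 2) := by ring
    rw [this] at C1
    exact le_of_mul_le_mul_right C1 (by positivity)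
  have B2 : |b| ≤ 2.1 * (x * y ^ 2) := by
    rw [abs_mul, abs_of_pos (by positivity : 0 < x ^ 2 * y), hE] at B1
    have : 2.1 * (x * y) ^ 3 = (2.1 * (x * y ^ 2)) * (x ^ 2 * y) := by ring
    rw [this] at B1
    exact le_of_mul_le_mul_right B1 (by positivity)
  have hx1 : 1 ≤ x ^ 3 := one_le_pow₀ hxone
  have hy1 : 1 ≤ y ^ 3 := one_le_pow₀ hyone
  have hE2 : E = x ^ 3 * y ^ 3 := by rw [hE]; ring
  have hbnd : 4.41 * E ≤ 10 * √X := by linarith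
  have g1 : y ^ 3 ≤ E := by rw [hE2]; nlinarith
  have g2 : x ^ 3 ≤ E := by rw [hE2]; nlinarith
  have g3 : x ^ 2 * y ≤ E := by
    have : E = (x ^ 2 * y) * (x * y ^ 2) := by rw [hE]; ring
    rw [this]
    apply le_mul_of_one_le_right (by positivity)
    have : 1 ≤ y ^ 2 := one_le_pow₀ hyone
    nlinarith
  have g4 : x * y ^ 2 ≤ E := by
    have : E = (x * y ^ 2) * (x ^ 2 * y) := by rw [hE]; ring
    rw [this]
    apply le_mul_of_one_le_right (by positivity)
    have : 1 ≤ x ^ 2 := one_le_pow₀ hxone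
    nlinarith
  refine ⟨⟨?_, ?_, ?_⟩, ?_, ?_, ?_⟩
  · linarith
  · linarith
  · rw [abs_mul]
    calc |a| * |d| ≤ y ^ 3 * x ^ 3 := by gcongr
      _ = E := by rw [hE]; ring
      _ ≤ _ := by linarith
  · linarith
  · linarith
  · rw [abs_mul]
    calc |b| * |c| ≤ (2.1 * (x * y ^ 2)) * (2.1 * (x ^ 2 * y)) := by gcongr
      _ = 4.41 * E := by rw [hE]; ring
      _ ≤ _ := hbnd

set_option maxHeartbeats 1000000 in
theorem reduction (a b c d : ℤ) (X : ℝ) (hD : cD a b c d ≠ 0) (hX : |(cD a b c d : ℤ)| ≤ X) :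
    ∃ p q r s : ℤ, p * s - q * r = 1 ∧
      IsRed X (cF a b c d p r, tB a b c d p q r s, tC a b c d p q r s, cF a b c d q s) := by
  have castD : ((cD a b c d : ℤ) : ℝ) = cD (a:ℝ) b c d := by
    simp only [cD, cA, cB]; push_cast; ring
  have hDR : cD (a:ℝ) b c d ≠ 0 := by rw [← castD]; exact_mod_cast hD
  obtain ⟨P, Q, R, hP, hΔ, hΔ3, hN⟩ := lemmaN (a:ℝ) b c d hDR
  obtain ⟨p, r, q, s, hdet, hn1, hn12, ht⟩ := gaussRed P Q R hP hΔ
  have hdetR : (p:ℝ) * s - q * r = 1 := by exact_mod_cast hdet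
  have hXD : |cD (a:ℝ) b c d| ≤ X := by
    rw [← castD]
    have : ((|cD a b c d| : ℤ) : ℝ) = |((cD a b c d : ℤ):ℝ)| := by push_cast; rfl
    rw [← this]; exact_mod_cast hX
  by_cases ha : cF a b c d p r = 0
  · -- type one
    set B' := tB a b c d p q r s with hB'
    set C' := tC a b c d p q r s with hC'
    have hB0 : B' ≠ 0 := by
      intro h0
      apply hD
      have h1 := tD_eq a b c d p q r s
      rw [hdet, one_pow, one_mul, ← hB', ← hC', ha, h0] at h1
      rw [← h1]; simp only [cD, cA, cB]; ring
    set k : ℤ := round (-(C':ℝ) / (2 * B')) with hk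
    have e1 : tB a b c d p (q + k * p) r (s + k * r) = B' := by
      have : tB a b c d p (q + k * p) r (s + k * r) = B' + k * cF a b c d p r := by
        rw [hB']; simp only [tB, cF]; ring
      rw [this, ha]; ring
    have e2 : tC a b c d p (q + k * p) r (s + k * r) = C' + 2 * k * B' := by
      have : tC a b c d p (q + k * p) r (s + k * r) = C' + 2 * k * B' + k ^ 2 * cF a b c d p r := by
        rw [hB', hC']; simp only [tC, tB, cF]; ring
      rw [this, ha]; ring
    have hdet2 : p * (s + k * r) - (q + k * p) * r = 1 := by linear_combination hdet
    refine ⟨p, q + k * p, r, s + k * r, hdet2, ?_, ?_, Or.inl ⟨ha, ?_⟩⟩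
    · simp only
      rw [tD_eq, hdet2, one_pow, one_mul]; exact hD
    · simp only
      rw [tD_eq, hdet2, one_pow, one_mul]; exact hX
    · simp only
      rw [e1, e2]
      have hr := abs_sub_round (-(C':ℝ) / (2 * B'))
      rw [← hk] at hr
      have hB0R : (B':ℝ) ≠ 0 := by exact_mod_cast hB0
      have : (C':ℝ) + 2 * k * B' = -(-(C':ℝ) / (2 * B') - k) * (2 * B') := by
        field_simp; ring
      have h2 : |(C':ℝ) + 2 * k * B'| ≤ |(B':ℝ)| := by
        rw [this, abs_mul, abs_neg, abs_mul]
        have h3 := abs_nonneg (B':ℝ)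
        have h4 : |(2:ℝ)| = 2 := by norm_num
        rw [h4]; nlinarith
      exact_mod_cast h2
  · -- type two
    refine ⟨p, q, r, s, by linarith, ?_, ?_, Or.inr ?_⟩
    · simp only
      rw [tD_eq]
      have : p * s - q * r = 1 := by linarith
      rw [this, one_pow, one_mul]; exact hD
    · simp only
      rw [tD_eq]
      have : p * s - q * r = 1 := by linarith
      rw [this, one_pow, one_mul]; exact hX
    simp only
    set n1 := P * (p:ℝ) ^ 2 + Q * p * r + R * (r:ℝ) ^ 2 with hn1d
    set n2 := P * (q:ℝ) ^ 2 + Q * q * s + R * (s:ℝ) ^ 2 with hn2d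
    set t := 2 * P * p * q + Q * (p * s + r * q) + 2 * R * r * s with htd
    set a' : ℤ := cF a b c d p r with ha'
    set b' : ℤ := tB a b c d p q r s with hb'
    set c' : ℤ := tC a b c d p q r s with hc'
    set d' : ℤ := cF a b c d q s with hd'
    have hn2 : 0 < n2 := hn1.trans_le hn12
    have hdisc : 4 * n1 * n2 - t ^ 2 = 4 * P * R - Q ^ 2 := by
      have : 4 * n1 * n2 - t ^ 2 = (4 * P * R - Q ^ 2) * ((p:ℝ) * s - q * r)^2 := by
        rw [hn1d, hn2d, htd]; ring
      rw [this, hdetR]; ring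
    have hFc : ∀ u v : ℝ, (a':ℝ) * u ^ 3 + 3 * b' * u ^ 2 * v + 3 * c' * u * v ^ 2 + d' * v ^ 3 =
        cF (a:ℝ) b c d (p * u + q * v) (r * u + s * v) := by
      intro u v
      rw [ha', hb', hc', hd']; simp only [cF, tB, tC]; push_cast; ring
    have hFN : ∀ u v : ℝ, ((a':ℝ) * u ^ 3 + 3 * b' * u ^ 2 * v + 3 * c' * u * v ^ 2 + d' * v ^ 3) ^ 2 ≤
        (n1 * u ^ 2 + t * u * v + n2 * v ^ 2) ^ 3 := by
      intro u v
      rw [hFc]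
      refine (hN _ _).trans (le_of_eq ?_)
      rw [hn1d, hn2d, htd]; ring
    have ha1 : (1:ℝ) ≤ |(a':ℝ)| := by
      have : 1 ≤ |a'| := Int.one_le_abs ha
      exact_mod_cast this
    have := type2_est a' b' c' d' n1 n2 t X hn1 hn12 ht ha1 (by rw [hdisc]; linarith) hFN
    push_cast
    exact this

end Part3

section Part4
theorem card_mul_real {α β : Type*} [DecidableEq β] (S : Finset α) (f : α → β) (n : ℝ)
    (h : ∀ b ∈ S.image f, ((S.filter (fun x => f x = b)).card : ℝ) ≤ n) :
    (S.card : ℝ) ≤ n * (S.image f).card := by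
  have h1 := Finset.card_eq_sum_card_image f S
  rw [h1]; push_cast
  calc ∑ b ∈ S.image f, ((S.filter (fun x => f x = b)).card : ℝ) ≤ ∑ b ∈ S.image f, n :=
        Finset.sum_le_sum h
    _ = n * (S.image f).card := by rw [Finset.sum_const, nsmul_eq_mul, mul_comm]

theorem card_harm {α : Type*} [DecidableEq α] (S : Finset α) (f : α → ℤ) (Y K : ℝ) (hY : 1 ≤ Y)
    (hK : 0 ≤ K) (h1 : ∀ v ∈ S, |(f v:ℝ)| ≤ Y)
    (h2 : ∀ u : ℤ, ((S.filter (fun v => f v = u)).card : ℝ) ≤ K / max 1 |(u:ℝ)|) :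
    (S.card : ℝ) ≤ 4 * K * (1 + Real.log Y) := by
  set n := ⌊Y⌋₊ with hn
  have hmaps : ∀ v ∈ S, (f v).natAbs ∈ Finset.range (n + 1) := by
    intro v hv
    rw [Finset.mem_range, Nat.lt_succ_iff, hn]
    apply Nat.le_floor
    have := h1 v hv
    rw [Nat.cast_natAbs]; push_cast; exact this
  have hc := Finset.card_eq_sum_card_fiberwise (f := fun v => (f v).natAbs) (s := S)
    (t := Finset.range (n + 1)) hmaps
  have hfib : ∀ m : ℕ, ((S.filter (fun v => (f v).natAbs = m)).card : ℝ) ≤ 2 * K / max 1 (m:ℝ) := by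
    intro m
    have hsub : S.filter (fun v => (f v).natAbs = m) ⊆
        S.filter (fun v => f v = (m:ℤ)) ∪ S.filter (fun v => f v = -(m:ℤ)) := by
      intro v hv
      simp only [Finset.mem_union, Finset.mem_filter] at hv ⊢
      rcases Int.natAbs_eq_iff.mp hv.2 with h | h
      · exact Or.inl ⟨hv.1, h⟩
      · exact Or.inr ⟨hv.1, h⟩
    have t1 := (Finset.card_le_card hsub).trans (Finset.card_union_le _ _)
    have t2 := h2 (m:ℤ)
    have t3 := h2 (-(m:ℤ))
    have e1 : |(((m:ℤ)):ℝ)| = (m:ℝ) := by simp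
    have e2 : |(((-(m:ℤ)):ℤ):ℝ)| = (m:ℝ) := by simp
    rw [e1] at t2; rw [e2] at t3
    have t4 : ((S.filter (fun v => (f v).natAbs = m)).card : ℝ) ≤
      ((S.filter (fun v => f v = (m:ℤ))).card : ℝ) + ((S.filter (fun v => f v = -(m:ℤ))).card : ℝ) := by
      exact_mod_cast t1
    have : 2 * K / max 1 (m:ℝ) = K / max 1 (m:ℝ) + K / max 1 (m:ℝ) := by ring
    rw [this]; linarith
  have hn1 : 1 ≤ n := by rw [hn]; exact Nat.le_floor (by exact_mod_cast hY)
  have hlog : Real.log n ≤ Real.log Y :=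
    Real.log_le_log (by exact_mod_cast hn1) (Nat.floor_le (by linarith))
  have hharm := harmonic_le_one_add_log n
  have hsum : ∑ m ∈ Finset.range (n + 1), 2 * K / max 1 (m:ℝ) = 2 * K * ((harmonic n : ℚ) + 1) := by
    rw [Finset.sum_range_succ', harmonic]
    push_cast
    rw [mul_add, Finset.mul_sum]
    congr 1
    · apply Finset.sum_congr rfl
      intro i _
      rw [max_eq_right (by linarith [(Nat.cast_nonneg i : (0:ℝ) ≤ i)])]; rfl
    · simp
  have hl0 : 0 ≤ Real.log Y := Real.log_nonneg hY
  calc (S.card : ℝ) = ∑ m ∈ Finset.range (n + 1), ((S.filter (fun v => (f v).natAbs = m)).card : ℝ) := by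
        rw [hc]; push_cast; rfl
    _ ≤ ∑ m ∈ Finset.range (n + 1), 2 * K / max 1 (m:ℝ) := Finset.sum_le_sum (fun m _ => hfib m)
    _ = 2 * K * ((harmonic n : ℚ) + 1) := hsum
    _ ≤ 2 * K * ((1 + Real.log Y) + 1) := by gcongr; linarith
    _ ≤ 4 * K * (1 + Real.log Y) := by nlinarith

theorem card_P (S : Finset (ℤ × ℤ)) (Y : ℝ) (hY : 1 ≤ Y)
    (h : ∀ v ∈ S, |(v.1:ℝ)| ≤ Y ∧ |(v.2:ℝ)| ≤ Y ∧ |(v.1:ℝ) * v.2| ≤ Y) :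
    (S.card : ℝ) ≤ 12 * Y * (1 + Real.log Y) := by
  have := card_harm S Prod.fst Y (3 * Y) hY (by linarith) (fun v hv => (h v hv).1) (by
    intro u
    by_cases hem : (S.filter (fun v => v.1 = u)) = ∅
    · rw [hem]; simp; positivity
    obtain ⟨v0, hv0⟩ := Finset.nonempty_iff_ne_empty.mpr hem
    rw [Finset.mem_filter] at hv0
    have huY : |(u:ℝ)| ≤ Y := by rw [← hv0.2]; exact (h v0 hv0.1).1
    have hinj : Set.InjOn Prod.snd (S.filter (fun v => v.1 = u) : Set (ℤ × ℤ)) := by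
      intro a ha b hb hab
      simp only [Finset.coe_filter, Set.mem_setOf_eq] at ha hb
      exact Prod.ext (ha.2.trans hb.2.symm) hab
    rw [← Finset.card_image_of_injOn hinj]
    set m := max 1 |(u:ℝ)| with hm
    have hm1 : 1 ≤ m := le_max_left _ _
    have hmY : m ≤ Y := max_le hY huY
    refine (card_int_le _ (-(Y / m)) (2 * (Y / m)) (by positivity) ?_).trans ?_
    · intro z hz
      obtain ⟨v, hv, rfl⟩ := Finset.mem_image.mp hz
      rw [Finset.mem_filter] at hv
      obtain ⟨_, k2, k3⟩ := h v hv.1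
      have : |(v.2:ℝ)| ≤ Y / m := by
        rw [le_div_iff₀ (by linarith)]
        rcases le_total |(u:ℝ)| 1 with g | g
        · rw [hm, max_eq_left g]; linarith
        · rw [hm, max_eq_right g, ← hv.2, mul_comm, ← abs_mul]; exact k3
      rw [abs_le] at this
      constructor <;> linarith
    · have : 1 ≤ Y / m := by rw [le_div_iff₀ (by linarith)]; linarith
      have e : 3 * Y / m = 3 * (Y / m) := by ring
      rw [e]; linarith)
  calc (S.card:ℝ) ≤ 4 * (3 * Y) * (1 + Real.log Y) := this
    _ = _ := by ring

theorem card_type1 (S : Finset (ℤ × ℤ × ℤ × ℤ)) (X : ℝ) (hX : 1 ≤ X)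
    (h : ∀ v ∈ S, cD v.1 v.2.1 v.2.2.1 v.2.2.2 ≠ 0 ∧ |(cD v.1 v.2.1 v.2.2.1 v.2.2.2 : ℤ)| ≤ X ∧
      v.1 = 0 ∧ |v.2.2.1| ≤ |v.2.1|) :
    (S.card : ℝ) ≤ 18 * X * (1 + Real.log X) := by
  have hDv : ∀ v ∈ S, cD v.1 v.2.1 v.2.2.1 v.2.2.2 = v.2.1 ^ 2 * (4 * v.2.1 * v.2.2.2 - 3 * v.2.2.1 ^ 2) := by
    intro v hv
    rw [(h v hv).2.2.1]; simp only [cD, cA, cB]; ring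
  have hb0 : ∀ v ∈ S, v.2.1 ≠ 0 := by
    intro v hv h0
    apply (h v hv).1
    rw [hDv v hv, h0]; ring
  have hineq : ∀ v ∈ S, (v.2.1:ℝ) ^ 2 * |(4 * v.2.1 * v.2.2.2 - 3 * v.2.2.1 ^ 2 : ℝ)| ≤ X := by
    intro v hv
    have := (h v hv).2.1
    rw [hDv v hv] at this
    push_cast at this
    rw [abs_mul, abs_of_nonneg (sq_nonneg _)] at this
    exact this
  have hb2 : ∀ v ∈ S, (v.2.1:ℝ) ^ 2 ≤ X := by
    intro v hv
    have h1 : (1:ℝ) ≤ |(4 * v.2.1 * v.2.2.2 - 3 * v.2.2.1 ^ 2 : ℝ)| := by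
      have : (4 * v.2.1 * v.2.2.2 - 3 * v.2.2.1 ^ 2 : ℤ) ≠ 0 := by
        intro h0
        apply (h v hv).1
        rw [hDv v hv, h0]; ring
      exact_mod_cast Int.one_le_abs this
    have := hineq v hv
    nlinarith [sq_nonneg (v.2.1:ℝ)]
  have := card_harm S (fun v => v.2.1) X (4.5 * X) hX (by linarith) (by
    intro v hv
    have h1 : (1:ℝ) ≤ |(v.2.1:ℝ)| := by exact_mod_cast Int.one_le_abs (hb0 v hv)
    have h2 := hb2 v hv
    rw [← sq_abs] at h2
    show |(v.2.1:ℝ)| ≤ X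
    nlinarith) (by
    intro u
    set S' := S.filter (fun v => v.2.1 = u) with hS'
    by_cases hem : S' = ∅
    · rw [hem]; simp; positivity
    obtain ⟨v0, hv0⟩ := Finset.nonempty_iff_ne_empty.mpr hem
    rw [hS', Finset.mem_filter] at hv0
    have hu0 : u ≠ 0 := by rw [← hv0.2]; exact hb0 v0 hv0.1
    have hu1 : (1:ℝ) ≤ |(u:ℝ)| := by exact_mod_cast Int.one_le_abs hu0
    have huX : |(u:ℝ)| ^ 2 ≤ X := by rw [sq_abs, ← hv0.2]; exact hb2 v0 hv0.1
    rw [max_eq_right hu1]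
    set U := |(u:ℝ)| with hU
    have c1 : ((S'.image (fun v => v.2.2.1)).card : ℝ) ≤ 3 * U := by
      refine (card_int_le _ (-U) (2 * U) (by linarith) ?_).trans (by linarith)
      intro z hz
      obtain ⟨v, hv, rfl⟩ := Finset.mem_image.mp hz
      rw [hS', Finset.mem_filter] at hv
      have := (h v hv.1).2.2.2
      rw [hv.2] at this
      have h2 : |(v.2.2.1:ℝ)| ≤ U := by rw [hU]; exact_mod_cast this
      rw [abs_le] at h2
      constructor <;> linarith
    have c2 := card_mul_real S' (fun v => v.2.2.1) (X / (2 * U ^ 3) + 1) (by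
      intro c _
      have hinj : Set.InjOn (fun v : ℤ × ℤ × ℤ × ℤ => v.2.2.2) (S'.filter (fun v => v.2.2.1 = c) : Set _) := by
        intro a ha b hb hab
        simp only [hS', Finset.coe_filter, Set.mem_setOf_eq, Finset.mem_filter] at ha hb
        refine Prod.ext ?_ (Prod.ext ?_ (Prod.ext ?_ hab))
        · rw [(h a ha.1.1).2.2.1, (h b hb.1.1).2.2.1]
        · rw [ha.1.2, hb.1.2]
        · rw [ha.2, hb.2]
      rw [← Finset.card_image_of_injOn hinj]
      have e : X / (2 * U ^ 3) = 2 * (X / (4 * U ^ 3)) := by field_simp; norm_num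
      rw [e]
      refine card_int_le _ (3 * (c:ℝ) ^ 2 / (4 * u) - X / (4 * U ^ 3)) _ (by positivity) ?_
      intro z hz
      obtain ⟨v, hv, rfl⟩ := Finset.mem_image.mp hz
      simp only [hS', Finset.mem_filter] at hv
      have h1 := hineq v hv.1.1
      rw [hv.1.2, hv.2] at h1
      have hu0R : (u:ℝ) ≠ 0 := by exact_mod_cast hu0
      have e2 : (4 * u * v.2.2.2 - 3 * c ^ 2 : ℝ) = (4 * u) * (v.2.2.2 - 3 * (c:ℝ) ^ 2 / (4 * u)) := by
        field_simp
      rw [e2, abs_mul, abs_mul, ← sq_abs, ← hU] at h1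
      have h4 : |(4:ℝ)| = 4 := by norm_num
      rw [h4] at h1
      have h5 : |((v.2.2.2:ℝ) - 3 * (c:ℝ) ^ 2 / (4 * u))| ≤ X / (4 * U ^ 3) := by
        rw [le_div_iff₀ (by positivity)]
        linarith
      rw [abs_le] at h5
      show _ ≤ (v.2.2.2:ℝ) ∧ (v.2.2.2:ℝ) ≤ _
      constructor <;> linarith)
    calc (S'.card:ℝ) ≤ (X / (2 * U ^ 3) + 1) * (S'.image (fun v => v.2.2.1)).card := c2
      _ ≤ (X / (2 * U ^ 3) + 1) * (3 * U) := by gcongr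
      _ ≤ 4.5 * X / U := by
        rw [le_div_iff₀ (by linarith)]
        have e : (X / (2 * U ^ 3) + 1) * (3 * U) * U = 3 / 2 * (X / U) + 3 * U ^ 2 := by
          field_simp
        rw [e]
        have : X / U ≤ X := div_le_self (by linarith) hu1
        linarith)
  calc (S.card:ℝ) ≤ 4 * (4.5 * X) * (1 + Real.log X) := this
    _ = _ := by ring

theorem card_red : ∃ C : ℝ, 0 < C ∧ ∀ X : ℝ, 1 ≤ X → ∀ S : Finset (ℤ × ℤ × ℤ × ℤ),
    (∀ v ∈ S, IsRed X v) → (S.card : ℝ) ≤ C * X * (1 + Real.log X) ^ 2 := by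
  refine ⟨18 + 480 ^ 2, by norm_num, ?_⟩
  intro X hX S hS
  have hl0 : 0 ≤ Real.log X := Real.log_nonneg hX
  set L := 1 + Real.log X with hL
  have hL1 : 1 ≤ L := by linarith
  classical
  set S1 := S.filter (fun v => v.1 = 0 ∧ |v.2.2.1| ≤ |v.2.1|) with hS1
  set S2 := S.filter (fun v => ¬ (v.1 = 0 ∧ |v.2.2.1| ≤ |v.2.1|)) with hS2
  have hc : S1.card + S2.card = S.card := Finset.card_filter_add_card_filter_not _
  have c1 : (S1.card : ℝ) ≤ 18 * X * L := by
    apply card_type1 S1 X hX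
    intro v hv
    rw [hS1, Finset.mem_filter] at hv
    obtain ⟨h1, h2, _⟩ := hS v hv.1
    exact ⟨h1, h2, hv.2⟩
  have hsX : 1 ≤ √X := Real.one_le_sqrt.mpr hX
  have hlogY : 1 + Real.log (10 * √X) ≤ 4 * L := by
    rw [Real.log_mul (by norm_num) (by positivity), Real.log_sqrt (by linarith)]
    have : Real.log 10 ≤ 3 := by
      rw [Real.log_le_iff_le_exp (by norm_num)]
      have h1 := Real.add_one_le_exp (1:ℝ)
      have h2 : Real.exp 3 = Real.exp 1 ^ 3 := by rw [← Real.exp_nat_mul]; norm_num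
      rw [h2]
      have h3 : (2.7:ℝ) ≤ Real.exp 1 := by linarith [Real.exp_one_gt_d9]
      calc (10:ℝ) ≤ 2.7 ^ 3 := by norm_num
        _ ≤ _ := by gcongr
    rw [hL]; linarith
  have hprop : ∀ v ∈ S2, ((|v.1| ≤ 10 * √X ∧ |v.2.2.2| ≤ 10 * √X ∧ |v.1 * v.2.2.2| ≤ 10 * √X) ∧
    (|v.2.1| ≤ 10 * √X ∧ |v.2.2.1| ≤ 10 * √X ∧ |v.2.1 * v.2.2.1| ≤ 10 * √X)) := by
    intro v hv
    rw [hS2, Finset.mem_filter] at hv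
    obtain ⟨_, _, h3⟩ := hS v hv.1
    exact h3.resolve_left hv.2
  have cP : ∀ f : ℤ × ℤ × ℤ × ℤ → ℤ × ℤ, (∀ v ∈ S2, |((f v).1:ℝ)| ≤ 10 * √X ∧ |((f v).2:ℝ)| ≤ 10 * √X ∧
      |((f v).1:ℝ) * (f v).2| ≤ 10 * √X) → ((S2.image f).card : ℝ) ≤ 480 * √X * L := by
    intro f hf
    have := card_P (S2.image f) (10 * √X) (by linarith) (by
      intro v hv
      obtain ⟨u, hu, rfl⟩ := Finset.mem_image.mp hv
      exact hf u hu)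
    calc ((S2.image f).card : ℝ) ≤ 12 * (10 * √X) * (1 + Real.log (10 * √X)) := this
      _ ≤ 12 * (10 * √X) * (4 * L) := by gcongr
      _ = _ := by ring
  have p1 := cP (fun v => (v.1, v.2.2.2)) (by
    intro v hv
    have := (hprop v hv).1
    push_cast at this
    exact this)
  have p2 := cP (fun v => (v.2.1, v.2.2.1)) (by
    intro v hv
    have := (hprop v hv).2
    push_cast at this
    exact this)
  have c2 : (S2.card : ℝ) ≤ 480 ^ 2 * X * L ^ 2 := by
    have h1 := card_mul_real S2 (fun v => (v.1, v.2.2.2)) (480 * √X * L) (by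
      intro b _
      refine le_trans ?_ p2
      have hinj : Set.InjOn (fun v : ℤ × ℤ × ℤ × ℤ => (v.2.1, v.2.2.1))
          (S2.filter (fun v => (v.1, v.2.2.2) = b) : Set _) := by
        intro x hx y hy hxy
        simp only [Finset.coe_filter, Set.mem_setOf_eq] at hx hy
        have e := hx.2.trans hy.2.symm
        simp only [Prod.mk.injEq] at e hxy
        exact Prod.ext e.1 (Prod.ext hxy.1 (Prod.ext hxy.2 e.2))
      rw [← Finset.card_image_of_injOn hinj]
      exact_mod_cast Finset.card_le_card (Finset.image_subset_image (Finset.filter_subset _ _)))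
    calc (S2.card : ℝ) ≤ (480 * √X * L) * (S2.image (fun v => (v.1, v.2.2.2))).card := h1
      _ ≤ (480 * √X * L) * (480 * √X * L) := by gcongr
      _ = 480 ^ 2 * (√X * √X) * L ^ 2 := by ring
      _ = _ := by rw [Real.mul_self_sqrt (by linarith)]
  have hc' : (S.card : ℝ) = S1.card + S2.card := by exact_mod_cast hc.symm
  rw [hc']
  have : 18 * X * L ≤ 18 * X * L ^ 2 := by
    have : L ≤ L ^ 2 := by nlinarith
    gcongr
  nlinarith

end Part4

section Part5
/-- forms with discriminant in a dyadic range -/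
theorem lemmaK_dyadic (C : ℝ) (hC0 : 0 < C)
    (hC : ∀ X : ℝ, 1 ≤ X → ∀ S : Finset (ℤ × ℤ × ℤ × ℤ),
      (∀ v ∈ S, IsRed X v) → (S.card : ℝ) ≤ C * X * (1 + Real.log X) ^ 2)
    (K Q M Z : ℝ) (hK : 0 ≤ K) (hQ : 0 < Q) (hM : 0 < M) (hZ : 1 ≤ Z)
    (T : Finset (ℤ × ℤ × ℤ × ℤ))
    (hT : ∀ v ∈ T, Q ≤ v.1 ∧ (v.1:ℝ) ≤ 2 * Q ∧ |(v.2.1:ℝ)| ≤ K * v.1 ∧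
      |((cA v.1 v.2.1 v.2.2.1 : ℤ):ℝ)| ≤ M ∧ cD v.1 v.2.1 v.2.2.1 v.2.2.2 ≠ 0 ∧
      Z ^ 2 ≤ |(cD v.1 v.2.1 v.2.2.1 v.2.2.2 : ℤ)| ∧
      |(cD v.1 v.2.1 v.2.2.1 v.2.2.2 : ℤ)| ≤ (2 * Z) ^ 2) :
    (T.card : ℝ) ≤ (2 * K + 2) * (360 * (1 + M / Z)) *
      (C * (2 * Z) ^ 2 * (1 + Real.log ((2 * Z) ^ 2)) ^ 2) := by
  classical
  have hred : ∀ v : ℤ × ℤ × ℤ × ℤ, ∃ u : ℤ × ℤ × ℤ × ℤ, v ∈ T →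
      u.1 * u.2.2.2 - u.2.1 * u.2.2.1 = 1 ∧ IsRed ((2 * Z) ^ 2) (cF v.1 v.2.1 v.2.2.1 v.2.2.2 u.1 u.2.2.1,
        tB v.1 v.2.1 v.2.2.1 v.2.2.2 u.1 u.2.1 u.2.2.1 u.2.2.2,
        tC v.1 v.2.1 v.2.2.1 v.2.2.2 u.1 u.2.1 u.2.2.1 u.2.2.2,
        cF v.1 v.2.1 v.2.2.1 v.2.2.2 u.2.1 u.2.2.2) := by
    intro v
    by_cases hv : v ∈ T
    · obtain ⟨_, _, _, _, h5, _, h7⟩ := hT v hv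
      obtain ⟨p, q, r, s, h1, h2⟩ := reduction v.1 v.2.1 v.2.2.1 v.2.2.2 _ h5 h7
      exact ⟨(p, q, r, s), fun _ => ⟨h1, h2⟩⟩
    · exact ⟨0, fun h => absurd h hv⟩
  choose u hu using hred
  set φ : ℤ × ℤ × ℤ × ℤ → ℤ × ℤ × ℤ × ℤ := fun v =>
    (cF v.1 v.2.1 v.2.2.1 v.2.2.2 (u v).1 (u v).2.2.1,
        tB v.1 v.2.1 v.2.2.1 v.2.2.2 (u v).1 (u v).2.1 (u v).2.2.1 (u v).2.2.2,
        tC v.1 v.2.1 v.2.2.1 v.2.2.2 (u v).1 (u v).2.1 (u v).2.2.1 (u v).2.2.2,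
        cF v.1 v.2.1 v.2.2.1 v.2.2.2 (u v).2.1 (u v).2.2.2) with hφ
  have hZ0 : 0 < Z := by linarith
  have himg : ((T.image φ).card : ℝ) ≤ C * (2 * Z) ^ 2 * (1 + Real.log ((2 * Z) ^ 2)) ^ 2 := by
    apply hC
    · nlinarith
    · intro g hg
      obtain ⟨v, hv, rfl⟩ := Finset.mem_image.mp hg
      exact (hu v hv).2
  -- recover v from φ v
  have rec1 : ∀ v ∈ T, v.1 = cF (φ v).1 (φ v).2.1 (φ v).2.2.1 (φ v).2.2.2 (u v).2.2.2 (-(u v).2.2.1) := by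
    intro v hv
    have h1 := (hu v hv).1
    simp only [hφ]
    rw [tF_eq]
    have e1 : (u v).1 * (u v).2.2.2 + (u v).2.1 * (-(u v).2.2.1) = 1 := by linarith
    have e2 : (u v).2.2.1 * (u v).2.2.2 + (u v).2.2.2 * (-(u v).2.2.1) = 0 := by ring
    rw [e1, e2]; simp [cF]
  have recA : ∀ v ∈ T, cA v.1 v.2.1 v.2.2.1 = cH (φ v).1 (φ v).2.1 (φ v).2.2.1 (φ v).2.2.2 (u v).2.2.2 (-(u v).2.2.1) := by
    intro v hv
    have h1 := (hu v hv).1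
    simp only [hφ]
    rw [tH_eq]
    have e1 : (u v).1 * (u v).2.2.2 + (u v).2.1 * (-(u v).2.2.1) = 1 := by linarith
    have e2 : (u v).2.2.1 * (u v).2.2.2 + (u v).2.2.2 * (-(u v).2.2.1) = 0 := by ring
    rw [e1, e2, h1]; simp [cH]
  have recD : ∀ v ∈ T, cD v.1 v.2.1 v.2.2.1 v.2.2.2 = cD (φ v).1 (φ v).2.1 (φ v).2.2.1 (φ v).2.2.2 := by
    intro v hv
    have h1 := (hu v hv).1
    simp only [hφ]
    rw [tD_eq, h1]; ring
  have recB : ∀ v ∈ T, v.2.1 = tB (φ v).1 (φ v).2.1 (φ v).2.2.1 (φ v).2.2.2 (u v).2.2.2 (-(u v).2.1) (-(u v).2.2.1) (u v).1 := by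
    intro v hv
    have h1 := (hu v hv).1
    have : tB (φ v).1 (φ v).2.1 (φ v).2.2.1 (φ v).2.2.2 (u v).2.2.2 (-(u v).2.1) (-(u v).2.2.1) (u v).1
      = ((u v).1 * (u v).2.2.2 - (u v).2.1 * (u v).2.2.1) ^ 3 * v.2.1 := by
      simp only [hφ, tB, tC, cF]; ring
    rw [this, h1]; ring
  have recC : ∀ v ∈ T, v.2.2.1 = tC (φ v).1 (φ v).2.1 (φ v).2.2.1 (φ v).2.2.2 (u v).2.2.2 (-(u v).2.1) (-(u v).2.2.1) (u v).1 := by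
    intro v hv
    have h1 := (hu v hv).1
    have : tC (φ v).1 (φ v).2.1 (φ v).2.2.1 (φ v).2.2.2 (u v).2.2.2 (-(u v).2.1) (-(u v).2.2.1) (u v).1
      = ((u v).1 * (u v).2.2.2 - (u v).2.1 * (u v).2.2.1) ^ 3 * v.2.2.1 := by
      simp only [hφ, tB, tC, cF]; ring
    rw [this, h1]; ring
  have recE : ∀ v ∈ T, v.2.2.2 = cF (φ v).1 (φ v).2.1 (φ v).2.2.1 (φ v).2.2.2 (-(u v).2.1) (u v).1 := by
    intro v hv
    have h1 := (hu v hv).1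
    have : cF (φ v).1 (φ v).2.1 (φ v).2.2.1 (φ v).2.2.2 (-(u v).2.1) (u v).1
      = ((u v).1 * (u v).2.2.2 - (u v).2.1 * (u v).2.2.1) ^ 3 * v.2.2.2 := by
      simp only [hφ, tB, tC, cF]; ring
    rw [this, h1]; ring
  have hfib : ∀ g ∈ T.image φ, ((T.filter (fun v => φ v = g)).card : ℝ) ≤ (2 * K + 2) * (360 * (1 + M / Z)) := by
    intro g hg
    set T' := T.filter (fun v => φ v = g) with hT'
    have hT'm : ∀ v ∈ T', v ∈ T ∧ φ v = g := fun v hv => by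
      rw [hT', Finset.mem_filter] at hv; exact hv
    obtain ⟨v0, hv0, hv0g⟩ := Finset.mem_image.mp hg
    set w : ℤ × ℤ × ℤ × ℤ → ℤ × ℤ := fun v => ((u v).2.2.2, -(u v).2.2.1) with hw
    have castD : ((cD g.1 g.2.1 g.2.2.1 g.2.2.2 : ℤ) : ℝ) = cD (g.1:ℝ) g.2.1 g.2.2.1 g.2.2.2 := by
      simp only [cD, cA, cB]; push_cast; ring
    have hDg := recD v0 hv0
    rw [hv0g] at hDg
    have hDne : cD (g.1:ℝ) g.2.1 g.2.2.1 g.2.2.2 ≠ 0 := by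
      rw [← castD, ← hDg]; exact_mod_cast (hT v0 hv0).2.2.2.2.1
    have hDZ : Z ≤ √|cD (g.1:ℝ) g.2.1 g.2.2.1 g.2.2.2| := by
      apply Real.le_sqrt_of_sq_le
      rw [← castD, ← hDg]
      have := (hT v0 hv0).2.2.2.2.2.1
      push_cast at this
      exact this
    have cw : ((T'.image w).card : ℝ) ≤ 360 * (1 + M / Z) := by
      have := lemmaW (g.1:ℝ) g.2.1 g.2.2.1 g.2.2.2 Q M hQ hM hDne (T'.image w) (by
        intro x hx
        obtain ⟨v, hv, rfl⟩ := Finset.mem_image.mp hx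
        obtain ⟨hvT, hvg⟩ := hT'm v hv
        obtain ⟨t1, t2, t3, t4, t5, t6, t7⟩ := hT v hvT
        have r1 := rec1 v hvT
        have r2 := recA v hvT
        rw [hvg] at r1 r2
        have r1' : (v.1:ℝ) = cF (g.1:ℝ) g.2.1 g.2.2.1 g.2.2.2 ((w v).1) ((w v).2) := by
          rw [r1]; simp only [cF, hw]; push_cast; ring
        have r2' : ((cA v.1 v.2.1 v.2.2.1 : ℤ):ℝ) = cH (g.1:ℝ) g.2.1 g.2.2.1 g.2.2.2 ((w v).1) ((w v).2) := by
          rw [r2]; simp only [cH, hw, cA, cB]; push_cast; ring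
        refine ⟨?_, ?_, ?_, ?_⟩
        · rw [← Int.isCoprime_iff_gcd_eq_one]
          exact ⟨(u v).1, (u v).2.1, by simp only [hw]; linarith [(hu v hvT).1]⟩
        · rw [← r1']; exact t1
        · rw [← r1']; exact t2
        · rw [← r2']; exact t4)
      calc ((T'.image w).card : ℝ) ≤ _ := this
        _ ≤ 360 * (1 + M / Z) := by gcongr
    have cf := card_mul_real T' w (2 * K + 2) (by
      intro b _
      set T2 := T'.filter (fun v => w v = b) with hT2
      have hT2m : ∀ v ∈ T2, v ∈ T ∧ φ v = g ∧ w v = b := fun v hv => by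
        rw [hT2, Finset.mem_filter] at hv
        exact ⟨(hT'm v hv.1).1, (hT'm v hv.1).2, hv.2⟩
      have hinj : Set.InjOn (fun v : ℤ × ℤ × ℤ × ℤ => ⌊(v.2.1:ℝ) / v.1⌋) (T2 : Set _) := by
        intro v hv v' hv' hfl
        obtain ⟨a1, a2, a3⟩ := hT2m v hv
        obtain ⟨b1, b2, b3⟩ := hT2m v' hv'
        have hww : w v = w v' := a3.trans b3.symm
        simp only [hw, Prod.mk.injEq, neg_inj] at hww
        obtain ⟨hs, hr⟩ := hww
        have d1 := (hu v a1).1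
        have d2 := (hu v' b1).1
        have A0 := rec1 v a1
        have A1 := recB v a1
        have A2 := recC v a1
        have A3 := recE v a1
        have B0 := rec1 v' b1
        have B1 := recB v' b1
        have B2 := recC v' b1
        have B3 := recE v' b1
        rw [a2] at A0 A1 A2 A3
        rw [b2] at B0 B1 B2 B3
        rw [← hs, ← hr] at B0 B1 B2 d2
        rw [← A0] at B0
        generalize (u v).1 = p at *
        generalize (u v).2.1 = q at *
        generalize (u v).2.2.1 = r at *
        generalize (u v).2.2.2 = s at *
        generalize (u v').1 = p' at *
        generalize (u v').2.1 = q' at *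
        obtain ⟨k, hk⟩ : ∃ k, k = p * (q' - q) - q * (p' - p) := ⟨_, rfl⟩
        have hp : p' = p + k * r := by
          rw [hk]; linear_combination (p' - p) * (-d1) + p * (d2 - d1)
        have hq : q' = q + k * s := by
          rw [hk]; linear_combination (q' - q) * (-d1) + q * (d2 - d1)
        have hsh : v'.2.1 = v.2.1 - k * v.1 := by
          rw [B1, A1, A0, hp, hq]; simp only [tB, cF]; ring
        have hv1 : 0 < (v.1:ℝ) := hQ.trans_le (hT v a1).1
        have hk0 : k = 0 := by
          simp only at hfl
          rw [hsh, B0] at hfl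
          have : (((v.2.1 - k * v.1 : ℤ)):ℝ) / (v.1:ℝ) = (v.2.1:ℝ) / v.1 - k := by
            push_cast; field_simp
          rw [this, Int.floor_sub_intCast] at hfl
          linarith
        rw [hk0, zero_mul, add_zero] at hp hq
        rw [hp, hq] at B1 B2 B3
        exact Prod.ext B0.symm (Prod.ext (A1.trans B1.symm) (Prod.ext (A2.trans B2.symm) (A3.trans B3.symm)))
      rw [← Finset.card_image_of_injOn hinj]
      refine (card_int_le _ (-K - 1) (2 * K + 1) (by linarith) ?_).trans (by linarith)
      intro z hz
      obtain ⟨v, hv, rfl⟩ := Finset.mem_image.mp hz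
      obtain ⟨hvT, _⟩ := hT2m v hv
      obtain ⟨t1, t2, t3, _⟩ := hT v hvT
      have hv1 : 0 < (v.1:ℝ) := hQ.trans_le t1
      have h1 : |(v.2.1:ℝ) / v.1| ≤ K := by
        rw [abs_div, abs_of_pos hv1, div_le_iff₀ hv1]; exact t3
      rw [abs_le] at h1
      have f1 := Int.floor_le ((v.2.1:ℝ) / v.1)
      have f2 := Int.lt_floor_add_one ((v.2.1:ℝ) / v.1)
      constructor <;> linarith)
    calc (T'.card : ℝ) ≤ (2 * K + 2) * (T'.image w).card := cf
      _ ≤ _ := by gcongr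
  calc (T.card : ℝ) ≤ ((2 * K + 2) * (360 * (1 + M / Z))) * (T.image φ).card := card_mul_real T φ _ hfib
    _ ≤ _ := by gcongr

theorem lemmaK (K : ℝ) (hK : 0 ≤ K) : ∃ C : ℝ, 0 < C ∧ ∀ Q M : ℝ, 0 < Q → 1 ≤ M →
    ∀ T : Finset (ℤ × ℤ × ℤ × ℤ),
    (∀ v ∈ T, Q ≤ v.1 ∧ (v.1:ℝ) ≤ 2 * Q ∧ |(v.2.1:ℝ)| ≤ K * v.1 ∧
      |((cA v.1 v.2.1 v.2.2.1 : ℤ):ℝ)| ≤ M ∧ cD v.1 v.2.1 v.2.2.1 v.2.2.2 ≠ 0 ∧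
      |((cD v.1 v.2.1 v.2.2.1 v.2.2.2 : ℤ):ℝ)| ≤ 16 * M ^ 2) →
    (T.card : ℝ) ≤ C * M ^ 2 * (1 + Real.log M) ^ 3 := by
  obtain ⟨C, hC0, hC⟩ := card_red
  refine ⟨((2 * K + 2) * (360 * C * 100 * 100)) * 10, by positivity, ?_⟩
  intro Q M hQ hM T hT
  set L := 1 + Real.log M with hL
  have hlogM : 0 ≤ Real.log M := Real.log_nonneg hM
  have hL1 : 1 ≤ L := by linarith
  set f : ℤ × ℤ × ℤ × ℤ → ℕ := fun v => Nat.log 4 (cD v.1 v.2.1 v.2.2.1 v.2.2.2).natAbs with hf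
  have hpw : ∀ v ∈ T, (4:ℝ) ^ f v ≤ |((cD v.1 v.2.1 v.2.2.1 v.2.2.2 : ℤ):ℝ)| ∧
      |((cD v.1 v.2.1 v.2.2.1 v.2.2.2 : ℤ):ℝ)| ≤ 4 ^ (f v + 1) := by
    intro v hv
    have h0 := (hT v hv).2.2.2.2.1
    have h1 : (cD v.1 v.2.1 v.2.2.1 v.2.2.2).natAbs ≠ 0 := Int.natAbs_ne_zero.mpr h0
    have h2 := Nat.pow_log_le_self 4 h1
    have h3 := (Nat.lt_pow_succ_log_self (b := 4) (by norm_num) (cD v.1 v.2.1 v.2.2.1 v.2.2.2).natAbs).le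
    have e : ((cD v.1 v.2.1 v.2.2.1 v.2.2.2).natAbs : ℝ) = |((cD v.1 v.2.1 v.2.2.1 v.2.2.2 : ℤ):ℝ)| := by
      rw [Nat.cast_natAbs]; push_cast; rfl
    rw [← e]
    exact ⟨by exact_mod_cast h2, by exact_mod_cast h3⟩
  have h2i : ∀ v ∈ T, (2:ℝ) ^ f v ≤ 4 * M := by
    intro v hv
    have h1 := (hpw v hv).1.trans (hT v hv).2.2.2.2.2
    have : ((2:ℝ) ^ f v) ^ 2 ≤ (4 * M) ^ 2 := by
      rw [← pow_mul, mul_comm, pow_mul]; norm_num; linarith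
    exact le_of_pow_le_pow_left₀ (by norm_num) (by positivity) this
  have hfle : ∀ v ∈ T, (f v : ℝ) ≤ 4 * L := by
    intro v hv
    have h1 := Real.log_le_log (by positivity) (h2i v hv)
    rw [Real.log_pow, Real.log_mul (by norm_num) (by linarith)] at h1
    have h2 : Real.log 4 = 2 * Real.log 2 := by
      rw [show (4:ℝ) = 2 ^ 2 by norm_num, Real.log_pow]; norm_num
    have h3 := Real.log_two_gt_d9
    have h4 := Real.log_two_lt_d9
    have : (f v : ℝ) * 0.5 ≤ f v * Real.log 2 := by gcongr; linarith
    linarith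
  have himg : ((T.image f).card : ℝ) ≤ 10 * L := by
    have hsub : T.image f ⊆ Finset.range (⌊4 * L⌋₊ + 1) := by
      intro i hi
      obtain ⟨v, hv, rfl⟩ := Finset.mem_image.mp hi
      rw [Finset.mem_range, Nat.lt_succ_iff]
      exact Nat.le_floor (hfle v hv)
    have h1 := Finset.card_le_card hsub
    rw [Finset.card_range] at h1
    have h2 := Nat.floor_le (by positivity : 0 ≤ 4 * L)
    have h3 : ((T.image f).card : ℝ) ≤ (⌊4 * L⌋₊ : ℝ) + 1 := by exact_mod_cast h1
    linarith
  have hfib : ∀ i ∈ T.image f, ((T.filter (fun v => f v = i)).card : ℝ) ≤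
      (2 * K + 2) * (360 * C * 100 * 100) * M ^ 2 * L ^ 2 := by
    intro i hi
    obtain ⟨v0, hv0, hv0i⟩ := Finset.mem_image.mp hi
    have hZ1 : (1:ℝ) ≤ 2 ^ i := one_le_pow₀ (by norm_num)
    have hZ4 : (2:ℝ) ^ i ≤ 4 * M := by rw [← hv0i]; exact h2i v0 hv0
    have e1 : ((2:ℝ) ^ i) ^ 2 = 4 ^ i := by rw [← pow_mul, mul_comm, pow_mul]; norm_num
    have e2 : (2 * (2:ℝ) ^ i) ^ 2 = 4 ^ (i + 1) := by rw [mul_pow, e1, pow_succ]; ring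
    have := lemmaK_dyadic C hC0 hC K Q M (2 ^ i) hK hQ (by linarith) hZ1
      (T.filter (fun v => f v = i)) (by
        intro v hv
        rw [Finset.mem_filter] at hv
        obtain ⟨t1, t2, t3, t4, t5, t6⟩ := hT v hv.1
        obtain ⟨q1, q2⟩ := hpw v hv.1
        rw [hv.2] at q1 q2
        refine ⟨t1, t2, t3, t4, t5, ?_, ?_⟩
        · rw [e1]; push_cast; exact q1
        · rw [e2]; push_cast; exact q2)
    refine this.trans ?_
    generalize (2:ℝ) ^ i = Z at *
    have hZ0 : 0 < Z := by linarith
    have hlog : 1 + Real.log ((2 * Z) ^ 2) ≤ 10 * L := by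
      have h1 : Real.log ((2 * Z) ^ 2) ≤ Real.log ((8 * M) ^ 2) := by
        apply Real.log_le_log (by positivity)
        apply pow_le_pow_left₀ (by positivity); linarith
      rw [Real.log_pow (n := 2) (x := 8 * M), Real.log_mul (by norm_num) (by linarith)] at h1
      have h2 : Real.log 8 = 3 * Real.log 2 := by
        rw [show (8:ℝ) = 2 ^ 3 by norm_num, Real.log_pow]; norm_num
      have h4 := Real.log_two_lt_d9
      push_cast at h1
      linarith
    have hlog0 : 0 ≤ 1 + Real.log ((2 * Z) ^ 2) := by
      have : 0 ≤ Real.log ((2 * Z) ^ 2) := Real.log_nonneg (by nlinarith)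
      linarith
    have hA : (1 + M / Z) * (2 * Z) ^ 2 ≤ 100 * M ^ 2 := by
      have : (1 + M / Z) * (2 * Z) ^ 2 = 4 * Z ^ 2 + 4 * M * Z := by field_simp; ring
      rw [this]; nlinarith
    calc (2 * K + 2) * (360 * (1 + M / Z)) * (C * (2 * Z) ^ 2 * (1 + Real.log ((2 * Z) ^ 2)) ^ 2)
        = (2 * K + 2) * (360 * C) * ((1 + M / Z) * (2 * Z) ^ 2) * (1 + Real.log ((2 * Z) ^ 2)) ^ 2 := by ring
      _ ≤ (2 * K + 2) * (360 * C) * (100 * M ^ 2) * (10 * L) ^ 2 := by gcongr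
      _ = _ := by ring
  calc (T.card : ℝ) ≤ ((2 * K + 2) * (360 * C * 100 * 100) * M ^ 2 * L ^ 2) * (T.image f).card :=
        card_mul_real T f _ hfib
    _ ≤ ((2 * K + 2) * (360 * C * 100 * 100) * M ^ 2 * L ^ 2) * (10 * L) := by gcongr
    _ = _ := by ring

end Part5

section Part6
open MeasureTheory Filter Topology
open scoped ENNReal NNReal

theorem ediam_cb (x r : ℝ) (hr : 0 ≤ r) :
    Metric.ediam (Metric.closedBall x r) ≤ ENNReal.ofReal (2 * r) := by
  rw [Real.closedBall_eq_Icc, Real.ediam_Icc]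
  apply ENNReal.ofReal_le_ofReal; linarith

theorem cover_dyadic (E : Set ℝ) (α β s C C' : ℝ) (hβ : 0 < β) (hs : 0 < s)
    (hC : 0 ≤ C) (hC' : 0 < C') (P : ℕ → Finset ℝ)
    (hαs : α < s * β)
    (hcard : ∀ k, ((P k).card : ℝ) ≤ C * ((k:ℝ) + 1) ^ 3 * 2 ^ (α * k))
    (hcov : ∀ x ∈ E, ∃ᶠ k in atTop, ∃ p ∈ P k, |x - p| ≤ C' * 2 ^ (-β * (k:ℝ))) :
    dimH E ≤ ENNReal.ofReal s := by
  set r : ℕ → ℝ := fun k => C' * 2 ^ (-β * (k:ℝ)) with hr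
  have hr0 : ∀ k, 0 ≤ r k := fun k => by positivity
  have hanti : Antitone r := by
    intro i j hij
    simp only [hr]
    gcongr C' * ?_
    apply Real.rpow_le_rpow_of_exponent_le (by norm_num)
    have : (i:ℝ) ≤ j := by exact_mod_cast hij
    nlinarith
  have hrpow : ∀ k, r k = C' * ((2:ℝ) ^ (-β)) ^ k := by
    intro k
    simp only [hr]
    rw [Real.rpow_mul_natCast (by norm_num)]
  have hb1 : (2:ℝ) ^ (-β) < 1 := Real.rpow_lt_one_of_one_lt_of_neg (by norm_num) (by linarith)
  have hrt : Tendsto r atTop (𝓝 0) := by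
    have : Tendsto (fun k : ℕ => C' * ((2:ℝ) ^ (-β)) ^ k) atTop (𝓝 (C' * 0)) :=
      (tendsto_pow_atTop_nhds_zero_of_lt_one (by positivity) hb1).const_mul C'
    rw [mul_zero] at this
    exact this.congr (fun k => (hrpow k).symm)
  set g : ℕ → ℝ := fun k => ((P k).card : ℝ) * (2 * r k) ^ s with hg
  have hsum : Summable g := by
    set ρ : ℝ := 2 ^ (α - s * β) with hρ
    have hρ0 : 0 < ρ := by positivity
    have hρ1 : ρ < 1 := Real.rpow_lt_one_of_one_lt_of_neg (by norm_num) (by linarith)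
    have hS : Summable (fun k : ℕ => (C * (2 * C') ^ s) / ρ * (((k + 1 : ℕ):ℝ) ^ 3 * ρ ^ (k + 1))) := by
      apply Summable.mul_left
      have := summable_pow_mul_geometric_of_norm_lt_one 3 (r := ρ)
        (by rw [Real.norm_of_nonneg hρ0.le]; exact hρ1)
      exact (summable_nat_add_iff 1).mpr this
    refine Summable.of_nonneg_of_le (fun k => by have := hr0 k; positivity) (fun k => ?_) hS
    simp only [hg]
    have e : (2 * r k) ^ s = (2 * C') ^ s * 2 ^ (-(s * β) * k) := by
      simp only [hr]
      rw [← mul_assoc, Real.mul_rpow (by positivity) (by positivity), ← Real.rpow_mul (by norm_num)]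
      congr 2; ring
    rw [e]
    calc ((P k).card : ℝ) * ((2 * C') ^ s * 2 ^ (-(s * β) * k))
        ≤ (C * ((k:ℝ) + 1) ^ 3 * 2 ^ (α * k)) * ((2 * C') ^ s * 2 ^ (-(s * β) * k)) := by
          gcongr; exact hcard k
      _ = (C * (2 * C') ^ s) * (((k:ℝ) + 1) ^ 3 * (2 ^ (α * k) * 2 ^ (-(s * β) * k))) := by ring
      _ = (C * (2 * C') ^ s) * (((k:ℝ) + 1) ^ 3 * ρ ^ k) := by
          rw [← Real.rpow_add (by norm_num), hρ, ← Real.rpow_mul_natCast (by norm_num)]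
          congr 3; ring_nf
      _ = _ := by push_cast; rw [pow_succ ρ k]; field_simp
      _ ≤ _ := le_refl _
  have hfin : ∑' k, ENNReal.ofReal (g k) ≠ ∞ := by
    rw [← ENNReal.ofReal_tsum_of_nonneg (fun k => by have := hr0 k; positivity) hsum]
    exact ENNReal.ofReal_ne_top
  have key : μH[s] E ≤ ∑' k, ENNReal.ofReal (g k) := by
    refine (Measure.hausdorffMeasure_le_liminf_tsum (ι := fun n : ℕ => Σ k : ℕ, ↥(P (k + n)))
      s E (l := atTop) (fun n : ℕ => ENNReal.ofReal (2 * r n)) ?_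
      (fun n i => Metric.closedBall (i.2 : ℝ) (r (i.1 + n))) ?_ ?_).trans ?_
    · have : Tendsto (fun n => 2 * r n) atTop (𝓝 (2 * 0)) := hrt.const_mul 2
      rw [mul_zero] at this
      have := ENNReal.tendsto_ofReal this
      rwa [ENNReal.ofReal_zero] at this
    · refine Eventually.of_forall (fun n i => ?_)
      refine (ediam_cb _ _ (hr0 _)).trans ?_
      apply ENNReal.ofReal_le_ofReal
      have := hanti (Nat.le_add_left n i.1)
      linarith
    · refine Eventually.of_forall (fun n x hx => ?_)
      obtain ⟨k, hk, p, hp, hxp⟩ := (frequently_atTop.mp (hcov x hx)) n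
      obtain ⟨j, rfl⟩ := Nat.exists_eq_add_of_le' hk
      rw [Set.mem_iUnion]
      refine ⟨⟨j, ⟨p, hp⟩⟩, ?_⟩
      rw [Metric.mem_closedBall, Real.dist_eq]
      exact hxp
    · have hb : ∀ n : ℕ, ∑' i : Σ k : ℕ, ↥(P (k + n)), Metric.ediam (Metric.closedBall (i.2 : ℝ) (r (i.1 + n))) ^ s
          ≤ ∑' k, ENNReal.ofReal (g k) := by
        intro n
        rw [ENNReal.tsum_sigma']
        calc _ ≤ ∑' k : ℕ, ENNReal.ofReal (g (k + n)) := by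
              apply ENNReal.tsum_le_tsum
              intro k
              rw [tsum_fintype]
              calc _ ≤ ∑ b : ↥(P (k + n)), ENNReal.ofReal ((2 * r (k + n)) ^ s) := by
                    apply Finset.sum_le_sum
                    intro b _
                    have h2 := hr0 (k + n)
                    rw [← ENNReal.ofReal_rpow_of_nonneg (by positivity) hs.le]
                    apply ENNReal.rpow_le_rpow _ hs.le
                    exact ediam_cb _ _ (hr0 _)
                _ = ENNReal.ofReal (g (k + n)) := by
                    rw [Finset.sum_const, nsmul_eq_mul]
                    simp only [hg]
                    rw [ENNReal.ofReal_mul (Nat.cast_nonneg _), ENNReal.ofReal_natCast]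
                    simp
          _ ≤ _ := ENNReal.tsum_comp_le_tsum_of_injective (add_left_injective n) _
      calc _ ≤ liminf (fun _ : ℕ => ∑' k, ENNReal.ofReal (g k)) atTop :=
            liminf_le_liminf (Eventually.of_forall hb)
        _ = _ := liminf_const _
  have : dimH E ≤ ((Real.toNNReal s : ℝ≥0) : ℝ≥0∞) := by
    apply dimH_le_of_hausdorffMeasure_ne_top
    rw [Real.coe_toNNReal s hs.le]
    exact ne_top_of_le_ne_top hfin key
  exact this

end Part6

section Part7
open MeasureTheory Filter Topology
open scoped ENNReal NNReal

theorem int_hess (A B C : ℤ) (hA : A ≠ 0) (h : B ^ 2 = 4 * A * C) :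
    ∃ s r : ℤ, 0 < r ∧ r ^ 2 ∣ A ∧ B * r = 2 * A * s := by
  have hev : Even B := by
    have : Even (B ^ 2) := by rw [h]; exact ⟨2 * A * C, by ring⟩
    exact (Int.even_pow.mp this).1
  obtain ⟨b, hb⟩ := hev
  have hb2 : b * b = A * C := by subst hb; nlinarith
  have hg : 0 < Int.gcd A b := Int.gcd_pos_of_ne_zero_left _ hA
  obtain ⟨A', b', hco, hA', hb'⟩ := Int.exists_gcd_one hg
  set g : ℤ := (Int.gcd A b : ℤ) with hgdef
  have hg0 : g ≠ 0 := by simp only [hgdef]; exact_mod_cast hg.ne'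
  have hA0 : A' ≠ 0 := by rintro rfl; simp at hA'; exact hA hA'
  have h3 : g * (b' * b') = A' * C := by
    have : g * (g * (b' * b')) = g * (A' * C) := by
      calc g * (g * (b' * b')) = (b' * g) * (b' * g) := by ring
        _ = b * b := by rw [← hb']
        _ = A * C := hb2
        _ = (A' * g) * C := by rw [← hA']
        _ = _ := by ring
    exact mul_left_cancel₀ hg0 this
  have hcop : IsCoprime A' b' := Int.isCoprime_iff_gcd_eq_one.mpr hco
  have hdvd : A' ∣ g := by
    have h4 : A' ∣ g * (b' * b') := ⟨C, h3⟩
    exact (hcop.mul_right hcop).dvd_of_dvd_mul_right h4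
  obtain ⟨m, hm⟩ := hdvd
  refine ⟨A'.sign * b', |A'|, abs_pos.mpr hA0, ?_, ?_⟩
  · rw [sq_abs]; exact ⟨m, by rw [hA', hm]; ring⟩
  · have : |A'| = A'.sign * A' := (Int.sign_mul_self_eq_abs A').symm
    rw [this, hb, hb', hA']; ring

theorem int_cube (a0 a1 a2 a3 : ℤ) (h0 : 0 < a0) (hA : a0 * a2 = a1 ^ 2) (hB : a0 * a3 = a1 * a2) :
    ∃ s r : ℤ, 0 < r ∧ r ^ 3 ∣ a0 ∧ a1 * r = a0 * s := by
  have hg : 0 < Int.gcd a0 a1 := Int.gcd_pos_of_ne_zero_left _ h0.ne'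
  obtain ⟨r, s, hco, hr, hs⟩ := Int.exists_gcd_one hg
  set g : ℤ := (Int.gcd a0 a1 : ℤ) with hgdef
  have hg0 : 0 < g := by simp only [hgdef]; exact_mod_cast hg
  have hr0 : 0 < r := by
    rw [hr] at h0; exact pos_of_mul_pos_left h0 hg0.le
  have hcop : IsCoprime r s := Int.isCoprime_iff_gcd_eq_one.mpr hco
  have e1 : r * a2 = g * (s * s) := by
    apply mul_left_cancel₀ hg0.ne'
    calc g * (r * a2) = (r * g) * a2 := by ring
      _ = a0 * a2 := by rw [← hr]
      _ = a1 ^ 2 := hA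
      _ = (s * g) ^ 2 := by rw [← hs]
      _ = _ := by ring
  have d1 : r ∣ g := (hcop.mul_right hcop).dvd_of_dvd_mul_right ⟨a2, e1.symm⟩
  obtain ⟨h, hh⟩ := d1
  have e2 : a2 = h * (s * s) := by
    apply mul_left_cancel₀ hr0.ne'
    rw [e1, hh]; ring
  have hh0 : h ≠ 0 := by rintro rfl; simp at hh; omega
  have e3 : r * a3 = h * (s * (s * s)) := by
    apply mul_left_cancel₀ (mul_ne_zero hr0.ne' hh0)
    calc r * h * (r * a3) = (r * (r * h)) * a3 := by ring
      _ = a0 * a3 := by rw [← hh, ← hr]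
      _ = a1 * a2 := hB
      _ = (s * (r * h)) * (h * (s * s)) := by rw [← hh, ← hs, ← e2]
      _ = _ := by ring
  have d2 : r ∣ h := (hcop.mul_right (hcop.mul_right hcop)).dvd_of_dvd_mul_right ⟨a3, e3.symm⟩
  obtain ⟨m, hm⟩ := d2
  refine ⟨s, r, hr0, ⟨m, ?_⟩, ?_⟩
  · rw [hr, hh, hm]; ring
  · rw [hr, hs]; ring

theorem boxP (R K : ℝ) (hR : 1 ≤ R) (hK : 1 ≤ K) : ∃ P : Finset ℝ, (P.card : ℝ) ≤ 3 * K * R ^ 2 ∧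
    ∀ s r : ℤ, 0 < r → (r:ℝ) ≤ R → |(s:ℝ)| ≤ K * r → (s:ℝ) / r ∈ P := by
  classical
  refine ⟨((Finset.Icc (1:ℤ) ⌊R⌋) ×ˢ (Finset.Icc (-⌊K * R⌋) ⌊K * R⌋)).image
    (fun v => (v.2 : ℝ) / v.1), ?_, ?_⟩
  · have h1 : (((Finset.Icc (1:ℤ) ⌊R⌋).card : ℕ):ℝ) ≤ R := by
      rw [Int.card_Icc]
      have : (0:ℤ) ≤ ⌊R⌋ := by positivity
      have h2 : ((⌊R⌋ + 1 - 1).toNat : ℤ) = ⌊R⌋ := by rw [Int.toNat_of_nonneg (by omega)]; ring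
      have h3 : (((⌊R⌋ + 1 - 1).toNat : ℕ):ℝ) = ⌊R⌋ := by exact_mod_cast h2
      rw [h3]; exact Int.floor_le R
    have h2 : (((Finset.Icc (-⌊K * R⌋) ⌊K * R⌋).card : ℕ):ℝ) ≤ 3 * K * R := by
      have hKR : 1 ≤ K * R := by nlinarith
      have : (0:ℤ) ≤ ⌊K * R⌋ := by positivity
      rw [Int.card_Icc]
      have h2 : ((⌊K * R⌋ + 1 - -⌊K * R⌋).toNat : ℤ) = 2 * ⌊K * R⌋ + 1 := by
        rw [Int.toNat_of_nonneg (by omega)]; ring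
      have h3 : (((⌊K * R⌋ + 1 - -⌊K * R⌋).toNat : ℕ):ℝ) = 2 * ⌊K * R⌋ + 1 := by exact_mod_cast h2
      rw [h3]
      have := Int.floor_le (K * R)
      linarith
    calc _ ≤ ((((Finset.Icc (1:ℤ) ⌊R⌋) ×ˢ (Finset.Icc (-⌊K * R⌋) ⌊K * R⌋)).card : ℕ) : ℝ) := by
          exact_mod_cast Finset.card_image_le
      _ ≤ R * (3 * K * R) := by
          rw [Finset.card_product]; push_cast
          gcongr
      _ = _ := by ring
  · intro s r hr hrR hs
    rw [Finset.mem_image]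
    refine ⟨(r, s), ?_, rfl⟩
    have h1 : |(s:ℝ)| ≤ K * R := hs.trans (by gcongr)
    rw [abs_le] at h1
    rw [Finset.mem_product, Finset.mem_Icc, Finset.mem_Icc]
    refine ⟨⟨by simpa using (by omega : 1 ≤ r), Int.le_floor.mpr hrR⟩, ?_, Int.le_floor.mpr h1.2⟩
    have : -s ≤ ⌊K * R⌋ := by apply Int.le_floor.mpr; push_cast; linarith [h1.1]
    simp only; omega

theorem finite_of_card_bound {α : Type*} (S : Set α) (C : ℝ)
    (h : ∀ T : Finset α, (∀ v ∈ T, v ∈ S) → (T.card : ℝ) ≤ C) : S.Finite := by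
  by_contra hinf
  obtain ⟨t, ht, hc⟩ := Set.Infinite.exists_subset_card_eq hinf (⌊C⌋₊ + 1)
  have h1 := h t (fun v hv => ht hv)
  rw [hc] at h1
  have := Nat.lt_floor_add_one C
  push_cast at h1
  linarith

/-- the data attached to a good approximation -/
def UP (K lam x : ℝ) (k : ℕ) (v : ℤ × ℤ × ℤ × ℤ) : Prop :=
  (2:ℝ) ^ (k:ℝ) ≤ v.1 ∧ (v.1:ℝ) ≤ 2 * 2 ^ (k:ℝ) ∧ |(v.2.1:ℝ)| ≤ (K + 1) * v.1 ∧
  |(v.2.1:ℝ) - x * v.1| ≤ 2 ^ (-lam * (k:ℝ)) ∧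
  |((cA v.1 v.2.1 v.2.2.1 : ℤ) : ℝ)| ≤ 32 * K ^ 2 * 2 ^ ((1 - lam) * k) ∧
  |((cD v.1 v.2.1 v.2.2.1 v.2.2.2 : ℤ) : ℝ)| ≤ 16 * (32 * K ^ 2 * 2 ^ ((1 - lam) * k)) ^ 2

theorem err_bounds (x K ε a0 a1 a2 a3 M : ℝ) (hK : 1 ≤ K) (hx : |x| ≤ K) (hε : 0 ≤ ε) (hε1 : ε ≤ 1)
    (h0 : 1 ≤ a0) (h1 : |a1 - x * a0| ≤ ε) (h2 : |a2 - x ^ 2 * a0| ≤ ε)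
    (h3 : |a3 - x ^ 3 * a0| ≤ ε) (hM : 16 * K ^ 2 * (a0 * ε) ≤ M) :
    |cA a0 a1 a2| ≤ M ∧ |cD a0 a1 a2 a3| ≤ 16 * M ^ 2 := by
  set d1 := a1 - x * a0 with hd1
  set d2 := a2 - x ^ 2 * a0 with hd2
  set d3 := a3 - x ^ 3 * a0 with hd3
  have hK0 : 0 ≤ K := by linarith
  have hx2 : |x ^ 2| ≤ K ^ 2 := by rw [abs_pow]; gcongr
  have he2 : |d2 - 2 * x * d1| ≤ 3 * K * ε := by
    calc |d2 - 2 * x * d1| ≤ |d2| + |2 * x * d1| := abs_sub _ _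
      _ = |d2| + 2 * |x| * |d1| := by rw [abs_mul, abs_mul]; norm_num
      _ ≤ ε + 2 * K * ε := by gcongr
      _ ≤ 3 * K * ε := by nlinarith
  have he3 : |d3 - 3 * x * d2 + 3 * x ^ 2 * d1| ≤ 7 * K ^ 2 * ε := by
    calc |d3 - 3 * x * d2 + 3 * x ^ 2 * d1| ≤ |d3| + |3 * x * d2| + |3 * x ^ 2 * d1| :=
          (abs_add_le _ _).trans (by gcongr; exact abs_sub _ _)
      _ = |d3| + 3 * |x| * |d2| + 3 * |x ^ 2| * |d1| := by simp only [abs_mul]; norm_num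
      _ ≤ ε + 3 * K * ε + 3 * K ^ 2 * ε := by gcongr
      _ ≤ 7 * K ^ 2 * ε := by
          have : K ≤ K ^ 2 := by nlinarith
          have h4 : K * ε ≤ K ^ 2 * ε := by gcongr
          have h5 : 1 * ε ≤ K ^ 2 * ε := by gcongr; nlinarith
          nlinarith
  set e2 := d2 - 2 * x * d1 with hee2
  set e3 := d3 - 3 * x * d2 + 3 * x ^ 2 * d1 with hee3
  have hεa : ε * ε ≤ a0 * ε := by gcongr; linarith
  have hae : 0 ≤ a0 * ε := by positivity
  have hKK : K ≤ K ^ 2 := by nlinarith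
  have hA : |cA a0 a1 a2| ≤ M := by
    have : cA a0 a1 a2 = a0 * e2 - d1 * d1 := by
      simp only [cA, hee2, hd1, hd2]; ring
    rw [this]
    calc |a0 * e2 - d1 * d1| ≤ |a0 * e2| + |d1 * d1| := abs_sub _ _
      _ = a0 * |e2| + |d1| * |d1| := by rw [abs_mul, abs_mul, abs_of_pos (by linarith : 0 < a0)]
      _ ≤ a0 * (3 * K * ε) + ε * ε := by gcongr
      _ ≤ 16 * K ^ 2 * (a0 * ε) := by nlinarith
      _ ≤ M := hM
  have hB : |a0 * e3 - d1 * e2| ≤ M := by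
    calc |a0 * e3 - d1 * e2| ≤ |a0 * e3| + |d1 * e2| := abs_sub _ _
      _ = a0 * |e3| + |d1| * |e2| := by rw [abs_mul, abs_mul, abs_of_pos (by linarith : 0 < a0)]
      _ ≤ a0 * (7 * K ^ 2 * ε) + ε * (3 * K * ε) := by gcongr
      _ ≤ 16 * K ^ 2 * (a0 * ε) := by nlinarith
      _ ≤ M := hM
  have hC : |d1 * e3 - e2 * e2| ≤ M := by
    calc |d1 * e3 - e2 * e2| ≤ |d1 * e3| + |e2 * e2| := abs_sub _ _
      _ = |d1| * |e3| + |e2| * |e2| := by rw [abs_mul, abs_mul]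
      _ ≤ ε * (7 * K ^ 2 * ε) + (3 * K * ε) * (3 * K * ε) := by gcongr
      _ = 16 * K ^ 2 * (ε * ε) := by ring
      _ ≤ 16 * K ^ 2 * (a0 * ε) := by gcongr
      _ ≤ M := hM
  refine ⟨hA, ?_⟩
  have hM0 : 0 ≤ M := (abs_nonneg _).trans hA
  have hD : cD a0 a1 a2 a3 = (a0 * e3 - d1 * e2) ^ 2 - 4 * (cA a0 a1 a2) * (d1 * e3 - e2 * e2) := by
    simp only [cA, cD, cB, hee2, hee3, hd1, hd2, hd3]; ring
  rw [hD]
  calc _ ≤ |(a0 * e3 - d1 * e2) ^ 2| + |4 * (cA a0 a1 a2) * (d1 * e3 - e2 * e2)| := abs_sub _ _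
    _ = |a0 * e3 - d1 * e2| ^ 2 + 4 * |cA a0 a1 a2| * |d1 * e3 - e2 * e2| := by
        rw [abs_pow, abs_mul, abs_mul]; norm_num
    _ ≤ M ^ 2 + 4 * M * M := by gcongr
    _ ≤ 16 * M ^ 2 := by nlinarith

end Part7

section Part8
open MeasureTheory Filter Topology
open scoped ENNReal NNReal

theorem case1 (K lam s : ℝ) (hK : 1 ≤ K) (h1 : 1/3 ≤ lam) (h2 : lam ≤ 1/2)
    (hs : (2 - 2 * lam) / (1 + lam) < s) :
    dimH {x : ℝ | |x| ≤ K ∧ ∃ᶠ k in atTop, ∃ v, UP K lam x k v ∧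
      cD v.1 v.2.1 v.2.2.1 v.2.2.2 ≠ 0} ≤ ENNReal.ofReal s := by
  classical
  obtain ⟨C, hC, hL⟩ := lemmaK (K + 1) (by linarith)
  set M : ℕ → ℝ := fun k => 32 * K ^ 2 * 2 ^ ((1 - lam) * k) with hM
  have hM1 : ∀ k, 1 ≤ M k := by
    intro k
    simp only [hM]
    have : (1:ℝ) ≤ 2 ^ ((1 - lam) * k) :=
      Real.one_le_rpow (by norm_num) (mul_nonneg (by linarith) (Nat.cast_nonneg _))
    nlinarith [sq_nonneg K]
  have hs' : (2 - 2 * lam) < s * (1 + lam) := by rwa [div_lt_iff₀ (by linarith)] at hs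
  have hs0 : 0 < s := lt_trans (div_pos (by linarith) (by linarith)) hs
  set S : ℕ → Set (ℤ × ℤ × ℤ × ℤ) := fun k => {v | (2:ℝ) ^ (k:ℝ) ≤ v.1 ∧ (v.1:ℝ) ≤ 2 * 2 ^ (k:ℝ) ∧
    |(v.2.1:ℝ)| ≤ (K + 1) * v.1 ∧ |((cA v.1 v.2.1 v.2.2.1 : ℤ) : ℝ)| ≤ M k ∧
    cD v.1 v.2.1 v.2.2.1 v.2.2.2 ≠ 0 ∧
    |((cD v.1 v.2.1 v.2.2.1 v.2.2.2 : ℤ) : ℝ)| ≤ 16 * M k ^ 2} with hS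
  have hb : ∀ k, ∀ T : Finset (ℤ × ℤ × ℤ × ℤ), (∀ v ∈ T, v ∈ S k) →
      (T.card:ℝ) ≤ C * M k ^ 2 * (1 + Real.log (M k)) ^ 3 := by
    intro k T hT
    exact hL _ (M k) (by positivity) (hM1 k) T (fun v hv => hT v hv)
  have hfin : ∀ k, (S k).Finite := fun k => finite_of_card_bound _ _ (hb k)
  set L : ℝ := 2 + Real.log (32 * K ^ 2) with hLdef
  have hlogK : 0 ≤ Real.log (32 * K ^ 2) := Real.log_nonneg (by nlinarith)
  refine cover_dyadic _ (2 - 2 * lam) (1 + lam) s (C * (32 * K ^ 2) ^ 2 * L ^ 3) 1 (by linarith) hs0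
    (by positivity) one_pos (fun k => (hfin k).toFinset.image (fun v => (v.2.1 : ℝ) / v.1)) hs' ?_ ?_
  · intro k
    have hlog : 1 + Real.log (M k) ≤ L * (k + 1) := by
      simp only [hM]
      rw [Real.log_mul (by positivity) (by positivity), Real.log_rpow (by norm_num)]
      have : Real.log 2 ≤ 1 := by linarith [Real.log_two_lt_d9]
      have h5 : 0 ≤ Real.log 2 := Real.log_nonneg (by norm_num)
      have hk : (0:ℝ) ≤ k := Nat.cast_nonneg _
      have h3 : (1 - lam) * k * Real.log 2 ≤ 1 * k * 1 := by gcongr; linarith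
      nlinarith
    have hlog0 : 0 ≤ 1 + Real.log (M k) := by have := Real.log_nonneg (hM1 k); linarith
    calc _ ≤ (((hfin k).toFinset.card : ℕ):ℝ) := by exact_mod_cast Finset.card_image_le
      _ ≤ C * M k ^ 2 * (1 + Real.log (M k)) ^ 3 := hb k _ (fun v hv => by simpa using hv)
      _ ≤ C * M k ^ 2 * (L * (k + 1)) ^ 3 := by gcongr
      _ = _ := by
        have : (2:ℝ) ^ ((2 - 2 * lam) * (k:ℝ)) = (2 ^ ((1 - lam) * (k:ℝ))) ^ 2 := by
          rw [← Real.rpow_mul_natCast (by norm_num)]; congr 1; push_cast; ring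
        rw [this]; simp only [hM]; ring
  · rintro x ⟨-, hx⟩
    refine hx.mono ?_
    rintro k ⟨v, ⟨u1, u2, u3, u4, u5, u6⟩, hD⟩
    refine ⟨(v.2.1 : ℝ) / v.1, ?_, ?_⟩
    · rw [Finset.mem_image]
      exact ⟨v, by simp only [Set.Finite.mem_toFinset, hS]; exact ⟨u1, u2, u3, u5, hD, u6⟩, rfl⟩
    · have hv : (0:ℝ) < v.1 := lt_of_lt_of_le (by positivity) u1
      have : x - (v.2.1:ℝ) / v.1 = -(((v.2.1:ℝ) - x * v.1) / v.1) := by field_simp; ring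
      rw [this, abs_neg, abs_div, abs_of_pos hv, one_mul]
      calc _ ≤ (2:ℝ) ^ (-lam * (k:ℝ)) / 2 ^ (k:ℝ) := by gcongr
        _ = _ := by rw [← Real.rpow_sub (by norm_num)]; congr 1; ring

theorem case2 (K lam s : ℝ) (hK : 1 ≤ K) (h1 : 1/3 ≤ lam) (h2 : lam ≤ 1/2)
    (hs : (2 - 2 * lam) / (1 + lam) < s) :
    dimH {x : ℝ | |x| ≤ K ∧ ∃ᶠ k in atTop, ∃ v, UP K lam x k v ∧
      (cD v.1 v.2.1 v.2.2.1 v.2.2.2 = 0 ∧ cA v.1 v.2.1 v.2.2.1 ≠ 0)} ≤ ENNReal.ofReal s := by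
  have hs' : (2 - 2 * lam) < s * (1 + lam) := by rwa [div_lt_iff₀ (by linarith)] at hs
  have hs0 : 0 < s := lt_trans (div_pos (by linarith) (by linarith)) hs
  have hR : ∀ k : ℕ, 1 ≤ 6 * K * (2:ℝ) ^ ((1 - lam) / 2 * (k:ℝ)) := by
    intro k
    have : (1:ℝ) ≤ 2 ^ ((1 - lam) / 2 * (k:ℝ)) :=
      Real.one_le_rpow (by norm_num) (mul_nonneg (by linarith) (Nat.cast_nonneg _))
    nlinarith
  choose P hP hPm using fun k : ℕ => boxP (6 * K * (2:ℝ) ^ ((1 - lam) / 2 * (k:ℝ))) (8 * K)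
    (hR k) (by linarith)
  refine cover_dyadic _ (1 - lam) ((1 + lam) / 2) s (3 * (8 * K) * (6 * K) ^ 2) (7 * K)
    (by linarith) hs0 (by positivity) (by positivity) P (by linarith) ?_ ?_
  · intro k
    refine (hP k).trans ?_
    have : (2:ℝ) ^ ((1 - lam) * (k:ℝ)) = (2 ^ ((1 - lam) / 2 * (k:ℝ))) ^ 2 := by
      rw [← Real.rpow_mul_natCast (by norm_num)]; congr 1; push_cast; ring
    rw [this]
    have hk : (1:ℝ) ≤ ((k:ℝ) + 1) ^ 3 := one_le_pow₀ (by linarith [(Nat.cast_nonneg k : (0:ℝ) ≤ k)])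
    calc _ = 3 * (8 * K) * (6 * K) ^ 2 * 1 * (2 ^ ((1 - lam) / 2 * (k:ℝ))) ^ 2 := by ring
      _ ≤ _ := by gcongr
  · rintro x ⟨hxK, hx⟩
    refine hx.mono ?_
    rintro k ⟨⟨a, b, c, d⟩, ⟨u1, u2, u3, u4, u5, u6⟩, hD, hA⟩
    simp only at u1 u2 u3 u4 u5 u6 hD hA
    obtain ⟨t, r, hr, ⟨m, hm⟩, hB⟩ := int_hess (cA a b c) (cB a b c d) (cA b c d) hA
      (by simp only [cD] at hD; linarith)
    have hk0 : (0:ℝ) ≤ k := Nat.cast_nonneg _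
    have ha : (0:ℝ) < a := lt_of_lt_of_le (by positivity) u1
    have hr' : (0:ℝ) < r := by exact_mod_cast hr
    have key : (r * b - t * a) ^ 2 = - (cA a b c) * r ^ 2 := by
      have h4 : 4 * cA a b c ^ 2 * ((r * b - t * a) ^ 2) = 4 * cA a b c ^ 2 * (- (cA a b c) * r ^ 2) := by
        have e1 : cB a b c d ^ 2 = 4 * cA a b c * cA b c d := by simp only [cD] at hD; linarith
        have e2 : cA a b c * b ^ 2 - cB a b c d * b * a + cA b c d * a ^ 2 = - cA a b c ^ 2 := by
          simp only [cA, cB]; ring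
        have e3 : 4 * cA a b c ^ 2 * ((r * b - t * a) ^ 2)
            = 4 * cA a b c ^ 2 * (r * b) ^ 2 - 4 * cA a b c * (2 * cA a b c * t) * r * b * a
              + (2 * cA a b c * t) ^ 2 * a ^ 2 := by ring
        rw [e3, ← hB]
        linear_combination (4 * cA a b c * r ^ 2) * e2 + r ^ 2 * a ^ 2 * e1
      exact mul_left_cancel₀ (by positivity) h4
    have keyR : ((b:ℝ) / a - t / r) ^ 2 = - ((cA a b c : ℤ):ℝ) / a ^ 2 := by
      have : ((r:ℝ) * b - t * a) ^ 2 = - ((cA a b c : ℤ):ℝ) * r ^ 2 := by exact_mod_cast key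
      field_simp
      linarith
    have hw : (2:ℝ) ^ ((1 - lam) * (k:ℝ)) = (2 ^ ((1 - lam) / 2 * (k:ℝ))) ^ 2 := by
      rw [← Real.rpow_mul_natCast (by norm_num)]; congr 1; push_cast; ring
    have hbd : |(b:ℝ) / a - t / r| ≤ 6 * K * 2 ^ (-((1 + lam) / 2) * (k:ℝ)) := by
      apply abs_le_of_sq_le_sq _ (by positivity)
      rw [keyR]
      calc - ((cA a b c : ℤ):ℝ) / a ^ 2 ≤ (32 * K ^ 2 * 2 ^ ((1 - lam) * (k:ℝ))) / (2 ^ (k:ℝ)) ^ 2 := by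
            gcongr
            exact (neg_le_abs _).trans u5
        _ = 32 * K ^ 2 * (2 ^ (-((1 + lam) / 2) * (k:ℝ))) ^ 2 := by
            rw [mul_div_assoc]; congr 1
            rw [← Real.rpow_mul_natCast (by norm_num), ← Real.rpow_mul_natCast (by norm_num),
              ← Real.rpow_sub (by norm_num)]
            congr 1; push_cast; ring
        _ ≤ _ := by
            rw [mul_pow]; gcongr; nlinarith
    have hxb : |x - (b:ℝ) / a| ≤ 2 ^ (-((1 + lam) / 2) * (k:ℝ)) := by
      have : x - (b:ℝ) / a = -(((b:ℝ) - x * a) / a) := by field_simp; ring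
      rw [this, abs_neg, abs_div, abs_of_pos ha]
      calc _ ≤ (2:ℝ) ^ (-lam * (k:ℝ)) / 2 ^ (k:ℝ) := by gcongr
        _ = 2 ^ (-(1 + lam) * (k:ℝ)) := by rw [← Real.rpow_sub (by norm_num)]; congr 1; ring
        _ ≤ _ := by apply Real.rpow_le_rpow_of_exponent_le (by norm_num); nlinarith
    have hxt : |x - (t:ℝ) / r| ≤ 7 * K * 2 ^ (-((1 + lam) / 2) * (k:ℝ)) := by
      have h0 : (0:ℝ) < 2 ^ (-((1 + lam) / 2) * (k:ℝ)) := by positivity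
      calc _ = |(x - (b:ℝ) / a) + ((b:ℝ) / a - t / r)| := by congr 1; ring
        _ ≤ _ := abs_add_le _ _
        _ ≤ _ := by nlinarith
    refine ⟨(t:ℝ) / r, hPm k t r hr ?_ ?_, hxt⟩
    · apply le_of_sq_le_sq _ (by positivity)
      have hm0 : 0 < |m| := by
        apply abs_pos.mpr; rintro rfl; simp at hm; exact hA hm
      have h5 : (r:ℤ) ^ 2 ≤ |cA a b c| := by
        rw [hm, abs_mul, abs_of_pos (by positivity)]; nlinarith [sq_nonneg r]
      have h6 : (r:ℝ) ^ 2 ≤ |((cA a b c : ℤ):ℝ)| := by exact_mod_cast h5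
      calc (r:ℝ) ^ 2 ≤ 32 * K ^ 2 * 2 ^ ((1 - lam) * (k:ℝ)) := h6.trans u5
        _ ≤ _ := by rw [hw, mul_pow]; gcongr; nlinarith
    · have h0 : (2:ℝ) ^ (-((1 + lam) / 2) * (k:ℝ)) ≤ 1 :=
        Real.rpow_le_one_of_one_le_of_nonpos (by norm_num) (by nlinarith)
      have h8 : |(t:ℝ) / r| ≤ 8 * K := by
        calc |(t:ℝ) / r| = |x - (x - (t:ℝ) / r)| := by congr 1; ring
          _ ≤ |x| + |x - (t:ℝ) / r| := abs_sub _ _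
          _ ≤ _ := by nlinarith
      rwa [abs_div, abs_of_pos hr', div_le_iff₀ hr'] at h8

theorem case3 (K lam s : ℝ) (hK : 1 ≤ K) (h1 : 1/3 ≤ lam) (h2 : lam ≤ 1/2)
    (hs : (2 - 2 * lam) / (1 + lam) < s) :
    dimH {x : ℝ | |x| ≤ K ∧ ∃ᶠ k in atTop, ∃ v, UP K lam x k v ∧
      (cD v.1 v.2.1 v.2.2.1 v.2.2.2 = 0 ∧ cA v.1 v.2.1 v.2.2.1 = 0)} ≤ ENNReal.ofReal s := by
  have hs' : (2 - 2 * lam) < s * (1 + lam) := by rwa [div_lt_iff₀ (by linarith)] at hs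
  have hs0 : 0 < s := lt_trans (div_pos (by linarith) (by linarith)) hs
  have hR : ∀ k : ℕ, 1 ≤ 2 * (2:ℝ) ^ (1 / 3 * (k:ℝ)) := by
    intro k
    have : (1:ℝ) ≤ 2 ^ (1 / 3 * (k:ℝ)) :=
      Real.one_le_rpow (by norm_num) (by positivity)
    nlinarith
  choose P hP hPm using fun k : ℕ => boxP (2 * (2:ℝ) ^ (1 / 3 * (k:ℝ))) (K + 1)
    (hR k) (by linarith)
  refine cover_dyadic _ (2 / 3) (1 + lam) s (3 * (K + 1) * 2 ^ 2) 1
    (by linarith) hs0 (by positivity) (by positivity) P (by linarith) ?_ ?_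
  · intro k
    refine (hP k).trans ?_
    have : (2:ℝ) ^ (2 / 3 * (k:ℝ)) = (2 ^ (1 / 3 * (k:ℝ))) ^ 2 := by
      rw [← Real.rpow_mul_natCast (by norm_num)]; congr 1; push_cast; ring
    rw [this]
    have hk : (1:ℝ) ≤ ((k:ℝ) + 1) ^ 3 := one_le_pow₀ (by linarith [(Nat.cast_nonneg k : (0:ℝ) ≤ k)])
    calc _ = 3 * (K + 1) * 2 ^ 2 * 1 * (2 ^ (1 / 3 * (k:ℝ))) ^ 2 := by ring
      _ ≤ _ := by gcongr
  · rintro x ⟨hxK, hx⟩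
    refine hx.mono ?_
    rintro k ⟨⟨a, b, c, d⟩, ⟨u1, u2, u3, u4, u5, u6⟩, hD, hA⟩
    simp only at u1 u2 u3 u4 u5 u6 hD hA
    have ha : (0:ℝ) < a := lt_of_lt_of_le (by positivity) u1
    have haZ : 0 < a := by exact_mod_cast ha
    have hB : cB a b c d = 0 := by
      simp only [cD, hA] at hD; simpa using hD
    obtain ⟨t, r, hr, ⟨m, hm⟩, hrt⟩ := int_cube a b c d haZ (by simp only [cA] at hA; linarith)
      (by simp only [cB] at hB; linarith)
    have hr' : (0:ℝ) < r := by exact_mod_cast hr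
    have heq : (t:ℝ) / r = b / a := by
      rw [div_eq_div_iff hr'.ne' ha.ne']
      have : (b:ℝ) * r = a * t := by exact_mod_cast hrt
      linarith
    refine ⟨(t:ℝ) / r, hPm k t r hr ?_ ?_, ?_⟩
    · have hm0 : 0 < m := by
        have : 0 < r ^ 3 * m := hm ▸ haZ
        exact pos_of_mul_pos_right this (by positivity)
      have h3 : (r:ℤ) ^ 3 ≤ a := by
        rw [hm]; have : 0 < r ^ 3 := by positivity
        nlinarith
      have h3' : (r:ℝ) ^ 3 ≤ a := by exact_mod_cast h3
      by_contra hcon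
      push Not at hcon
      have : (2 * (2:ℝ) ^ (1 / 3 * (k:ℝ))) ^ 3 < (r:ℝ) ^ 3 := by gcongr
      have e : (2 * (2:ℝ) ^ (1 / 3 * (k:ℝ))) ^ 3 = 8 * 2 ^ (k:ℝ) := by
        rw [mul_pow, ← Real.rpow_mul_natCast (by norm_num) (1 / 3 * (k:ℝ))]
        have e0 : 1 / 3 * (k:ℝ) * ((3:ℕ):ℝ) = k := by push_cast; ring
        rw [e0]; norm_num
      have : (0:ℝ) < 2 ^ (k:ℝ) := by positivity
      linarith
    · have h8 : |(t:ℝ) / r| ≤ K + 1 := by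
        rw [heq, abs_div, abs_of_pos ha, div_le_iff₀ ha]; exact u3
      rwa [abs_div, abs_of_pos hr', div_le_iff₀ hr'] at h8
    · rw [heq]
      have : x - (b:ℝ) / a = -(((b:ℝ) - x * a) / a) := by field_simp; ring
      rw [this, abs_neg, abs_div, abs_of_pos ha, one_mul]
      calc _ ≤ (2:ℝ) ^ (-lam * (k:ℝ)) / 2 ^ (k:ℝ) := by gcongr
        _ = _ := by rw [← Real.rpow_sub (by norm_num)]; congr 1; ring

end Part8

section Part9
open MeasureTheory Filter Topology
open scoped ENNReal NNReal

theorem mem_UP (K lam x : ℝ) (hK : 1 ≤ K) (hxK : |x| ≤ K) (hlam : 0 < lam)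
    (h : ENNReal.ofReal lam < simExponent 3 x) : ∃ᶠ k in atTop, ∃ v, UP K lam x k v := by
  unfold simExponent at h
  rw [lt_sSup_iff] at h
  obtain ⟨_, ⟨l, ⟨hl0, hinf⟩, rfl⟩, hl⟩ := h
  rw [ENNReal.ofReal_lt_ofReal_iff hl0] at hl
  rw [frequently_atTop]
  intro k0
  obtain ⟨q, ⟨hq0, hq⟩, hqk⟩ := hinf.exists_gt (2 ^ k0)
  have hk0 : k0 ≤ Nat.log 2 q := Nat.le_log_of_pow_le (by norm_num) hqk.le
  refine ⟨Nat.log 2 q, hk0, ((q:ℤ), round ((q:ℝ) * x), round ((q:ℝ) * x ^ 2), round ((q:ℝ) * x ^ 3)), ?_⟩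
  set k := Nat.log 2 q with hk
  have hlo : (2:ℝ) ^ (k:ℝ) ≤ q := by
    rw [Real.rpow_natCast]; exact_mod_cast Nat.pow_log_le_self 2 hq0.ne'
  have hhi : (q:ℝ) ≤ 2 * 2 ^ (k:ℝ) := by
    rw [Real.rpow_natCast]
    have := (Nat.lt_pow_succ_log_self (b := 2) (by norm_num) q).le
    rw [Nat.succ_eq_add_one, pow_succ] at this
    have h' : (q:ℝ) ≤ 2 ^ k * 2 := by exact_mod_cast this
    linarith
  have hq1 : (1:ℝ) ≤ q := by exact_mod_cast hq0
  set ε : ℝ := 2 ^ (-lam * (k:ℝ)) with hε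
  have hqε : (q:ℝ) ^ (-l) ≤ ε := by
    calc (q:ℝ) ^ (-l) ≤ (q:ℝ) ^ (-lam) := Real.rpow_le_rpow_of_exponent_le hq1 (by linarith)
      _ ≤ ((2:ℝ) ^ (k:ℝ)) ^ (-lam) := Real.rpow_le_rpow_of_nonpos (by positivity) hlo (by linarith)
      _ = ε := by rw [← Real.rpow_mul (by norm_num), hε]; congr 1; ring
  have hε1 : ε ≤ 1 := Real.rpow_le_one_of_one_le_of_nonpos (by norm_num)
    (by have : (0:ℝ) ≤ k := Nat.cast_nonneg _
        nlinarith)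
  have hdd : ∀ i ∈ Finset.Icc 1 3, |((round ((q:ℝ) * x ^ i) : ℤ) : ℝ) - x ^ i * q| ≤ ε := by
    intro i hi
    have := (hq i hi).trans hqε
    rw [distNearestInt, abs_sub_comm] at this
    rwa [mul_comm (x ^ i)]
  have d1 := hdd 1 (by simp)
  have d2 := hdd 2 (by simp)
  have d3 := hdd 3 (by simp)
  rw [pow_one] at d1
  have hMM : 16 * K ^ 2 * ((q:ℝ) * ε) ≤ 32 * K ^ 2 * 2 ^ ((1 - lam) * (k:ℝ)) := by
    have : (2:ℝ) ^ ((1 - lam) * (k:ℝ)) = 2 ^ (k:ℝ) * ε := by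
      rw [hε, ← Real.rpow_add (by norm_num)]; congr 1; ring
    rw [this]
    calc 16 * K ^ 2 * ((q:ℝ) * ε) ≤ 16 * K ^ 2 * ((2 * 2 ^ (k:ℝ)) * ε) := by gcongr
      _ = _ := by ring
  obtain ⟨e1, e2⟩ := err_bounds x K ε q _ _ _ _ hK hxK (by positivity) hε1 hq1 d1 d2 d3 hMM
  refine ⟨by simpa using hlo, by simpa using hhi, ?_, by simp only [Int.cast_natCast]; exact d1, ?_, ?_⟩
  · simp only [Int.cast_natCast]
    calc |((round ((q:ℝ) * x) : ℤ):ℝ)| = |(((round ((q:ℝ) * x) : ℤ):ℝ) - x * q) + x * q| := by congr 1; ring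
      _ ≤ |((round ((q:ℝ) * x) : ℤ):ℝ) - x * q| + |x * q| := abs_add_le _ _
      _ ≤ ε + K * q := by
          rw [abs_mul, abs_of_pos (by linarith : (0:ℝ) < q)]; gcongr
      _ ≤ _ := by linarith
  · simp only [cA] at e1 ⊢
    push_cast; exact e1
  · simp only [cA, cB, cD] at e2 ⊢
    push_cast; exact e2

theorem upper (a b : ℝ) (lam : ℝ) (h1 : 1 / 3 ≤ lam) (h2 : lam ≤ 1 / 2) :
    dimH (SimSet 3 (Set.Ioo a b) lam) ≤ ENNReal.ofReal ((2 - 2 * lam) / (1 + lam)) := by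
  set K : ℝ := 1 + |a| + |b| with hKd
  have hK : 1 ≤ K := by have := abs_nonneg a; have := abs_nonneg b; linarith
  have hs : ∀ s : ℝ, (2 - 2 * lam) / (1 + lam) < s →
      dimH (SimSet 3 (Set.Ioo a b) lam) ≤ ENNReal.ofReal s := by
    intro s hs
    refine (dimH_mono (t := {x : ℝ | |x| ≤ K ∧ ∃ᶠ k in atTop, ∃ v, UP K lam x k v ∧
        cD v.1 v.2.1 v.2.2.1 v.2.2.2 ≠ 0} ∪ ({x : ℝ | |x| ≤ K ∧ ∃ᶠ k in atTop, ∃ v, UP K lam x k v ∧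
        (cD v.1 v.2.1 v.2.2.1 v.2.2.2 = 0 ∧ cA v.1 v.2.1 v.2.2.1 ≠ 0)} ∪
        {x : ℝ | |x| ≤ K ∧ ∃ᶠ k in atTop, ∃ v, UP K lam x k v ∧
        (cD v.1 v.2.1 v.2.2.1 v.2.2.2 = 0 ∧ cA v.1 v.2.1 v.2.2.1 = 0)}) ) ?_).trans ?_
    · rintro x ⟨hx, hx2⟩
      have hxK : |x| ≤ K := by
        rw [abs_le]
        constructor
        · have := neg_abs_le a; have := abs_nonneg b; linarith [hx.1]
        · have := le_abs_self b; have := abs_nonneg a; linarith [hx.2]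
      have h := mem_UP K lam x hK hxK (by linarith) hx2
      have h3 : ∃ᶠ k in atTop, (∃ v, UP K lam x k v ∧ cD v.1 v.2.1 v.2.2.1 v.2.2.2 ≠ 0) ∨
          ((∃ v, UP K lam x k v ∧ (cD v.1 v.2.1 v.2.2.1 v.2.2.2 = 0 ∧ cA v.1 v.2.1 v.2.2.1 ≠ 0)) ∨
          (∃ v, UP K lam x k v ∧ (cD v.1 v.2.1 v.2.2.1 v.2.2.2 = 0 ∧ cA v.1 v.2.1 v.2.2.1 = 0))) := by
        refine h.mono ?_
        rintro k ⟨v, hv⟩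
        by_cases hD : cD v.1 v.2.1 v.2.2.1 v.2.2.2 = 0
        · by_cases hA : cA v.1 v.2.1 v.2.2.1 = 0
          · exact Or.inr (Or.inr ⟨v, hv, hD, hA⟩)
          · exact Or.inr (Or.inl ⟨v, hv, hD, hA⟩)
        · exact Or.inl ⟨v, hv, hD⟩
      rw [Filter.frequently_or_distrib, Filter.frequently_or_distrib] at h3
      rcases h3 with h3 | h3 | h3
      · exact Or.inl ⟨hxK, h3⟩
      · exact Or.inr (Or.inl ⟨hxK, h3⟩)
      · exact Or.inr (Or.inr ⟨hxK, h3⟩)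
    · rw [dimH_union, dimH_union]
      exact max_le (case1 K lam s hK h1 h2 hs) (max_le (case2 K lam s hK h1 h2 hs)
        (case3 K lam s hK h1 h2 hs))
  have hcont : Tendsto (fun s : ℝ => ENNReal.ofReal s) (𝓝[>] ((2 - 2 * lam) / (1 + lam)))
      (𝓝 (ENNReal.ofReal ((2 - 2 * lam) / (1 + lam)))) :=
    (ENNReal.continuous_ofReal.tendsto _).mono_left nhdsWithin_le_nhds
  refine ge_of_tendsto hcont ?_
  filter_upwards [self_mem_nhdsWithin] with s hs'
  exact hs s hs'

end Part9

section Part10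
open MeasureTheory Filter Topology
open scoped ENNReal NNReal

theorem cantor_dim (A B κ s : ℝ) (hAB : A < B) (hκ : 0 < κ) (hs : 0 < s) (hs1 : s ≤ 1)
    (P : ℕ → Set ℝ)
    (H : ∀ (n : ℕ) (a b : ℝ), a < b → Set.Icc a b ⊆ Set.Ioo A B → b - a ≤ 1 →
      ∃ (N : ℕ) (r : ℝ) (f : ℕ → ℝ), 2 ≤ N ∧ 0 < r ∧
        (∀ i < N, Set.Icc (f i - r) (f i + r) ⊆ Set.Icc a b ∩ P n) ∧
        (∀ i j, i < j → j < N → κ * ((j:ℝ) - i) * (b - a) / N ≤ f j - f i) ∧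
        r ≤ κ * (b - a) / (4 * N) ∧ 1 ≤ N * (2 * r) ^ s) :
    ENNReal.ofReal s ≤ dimH {x | x ∈ Set.Ioo A B ∧ ∀ n, x ∈ P n} := by
  have H' : ∀ (n : ℕ) (a b : ℝ), ∃ (N : ℕ) (r : ℝ) (f : ℕ → ℝ),
      (a < b ∧ Set.Icc a b ⊆ Set.Ioo A B ∧ b - a ≤ 1) → 2 ≤ N ∧ 0 < r ∧
        (∀ i < N, Set.Icc (f i - r) (f i + r) ⊆ Set.Icc a b ∩ P n) ∧
        (∀ i j, i < j → j < N → κ * ((j:ℝ) - i) * (b - a) / N ≤ f j - f i) ∧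
        r ≤ κ * (b - a) / (4 * N) ∧ 1 ≤ N * (2 * r) ^ s := by
    intro n a b
    by_cases h : a < b ∧ Set.Icc a b ⊆ Set.Ioo A B ∧ b - a ≤ 1
    · obtain ⟨N, r, f, hh⟩ := H n a b h.1 h.2.1 h.2.2
      exact ⟨N, r, f, fun _ => hh⟩
    · exact ⟨0, 0, fun _ => 0, fun h' => absurd h' h⟩
  choose N r f hNf using H'
  -- the state space
  let valid : ℕ × ℝ × ℝ × ℝ → Prop := fun σ =>
    (σ.2.1 < σ.2.2.1 ∧ Set.Icc σ.2.1 σ.2.2.1 ⊆ Set.Ioo A B ∧ σ.2.2.1 - σ.2.1 ≤ 1) ∧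
      0 ≤ σ.2.2.2 ∧ σ.2.2.2 < 1
  let dig : ℕ × ℝ × ℝ × ℝ → ℕ := fun σ => ⌊(N σ.1 σ.2.1 σ.2.2.1 : ℝ) * σ.2.2.2⌋₊
  let T : ℕ × ℝ × ℝ × ℝ → ℕ × ℝ × ℝ × ℝ := fun σ =>
    (σ.1 + 1, f σ.1 σ.2.1 σ.2.2.1 (dig σ) - r σ.1 σ.2.1 σ.2.2.1,
      f σ.1 σ.2.1 σ.2.2.1 (dig σ) + r σ.1 σ.2.1 σ.2.2.1,
      (N σ.1 σ.2.1 σ.2.2.1 : ℝ) * σ.2.2.2 - dig σ)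
  let J : ℕ × ℝ × ℝ × ℝ → Set ℝ := fun σ => Set.Icc σ.2.1 σ.2.2.1
  have hdig : ∀ σ, valid σ → dig σ < N σ.1 σ.2.1 σ.2.2.1 := by
    rintro ⟨k, a, b, t⟩ ⟨h, ht0, ht1⟩
    obtain ⟨hN, -⟩ := hNf k a b h
    simp only at ht0 ht1
    show ⌊(N k a b : ℝ) * t⌋₊ < N k a b
    rw [Nat.floor_lt (by positivity)]
    have : (2:ℝ) ≤ N k a b := by exact_mod_cast hN
    nlinarith
  have hsub : ∀ σ, valid σ → J (T σ) ⊆ J σ ∩ P σ.1 := by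
    rintro ⟨k, a, b, t⟩ hv
    have hd := hdig _ hv
    obtain ⟨-, -, h3, -⟩ := hNf k a b hv.1
    exact h3 _ hd
  have hval : ∀ σ, valid σ → valid (T σ) := by
    rintro ⟨k, a, b, t⟩ hv
    have hd := hdig _ hv
    have hs := (hsub _ hv).trans Set.inter_subset_left
    obtain ⟨hN, hr, -, -, -, -⟩ := hNf k a b hv.1
    obtain ⟨⟨h1, h2, h3⟩, h4, h5⟩ := hv
    simp only at h1 h2 h3 h4 h5
    have hlt : f k a b (dig (k, a, b, t)) - r k a b < f k a b (dig (k, a, b, t)) + r k a b := by linarith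
    refine ⟨⟨hlt, hs.trans h2, ?_⟩, ?_, ?_⟩
    · have := (Set.Icc_subset_Icc_iff hlt.le).mp hs
      show f k a b (dig (k, a, b, t)) + r k a b - (f k a b (dig (k, a, b, t)) - r k a b) ≤ 1
      linarith [this.1, this.2]
    · show 0 ≤ (N k a b : ℝ) * t - dig (k, a, b, t)
      have := Nat.floor_le (a := (N k a b : ℝ) * t) (by positivity)
      linarith
    · show (N k a b : ℝ) * t - dig (k, a, b, t) < 1
      have := Nat.lt_floor_add_one ((N k a b : ℝ) * t)
      linarith
  have hvaln : ∀ σ, valid σ → ∀ n, valid (T^[n] σ) := by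
    intro σ hv n
    induction n with
    | zero => exact hv
    | succ n ih => rw [Function.iterate_succ_apply']; exact hval _ ih
  let G : ℕ × ℝ × ℝ × ℝ → ℝ → Prop := fun σ x => ∀ n, x ∈ J (T^[n] σ)
  have hGT : ∀ σ x, G σ x → G (T σ) x := by
    intro σ x h n
    have := h (n + 1)
    rwa [Function.iterate_succ_apply] at this
  have hGex : ∀ σ, valid σ → ∃ x, G σ x := by
    intro σ hv
    have := IsCompact.nonempty_iInter_of_sequence_nonempty_isCompact_isClosed
      (fun n => J (T^[n] σ)) (fun n => by
        rw [Function.iterate_succ_apply']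
        exact (hsub _ (hvaln σ hv n)).trans Set.inter_subset_left)
      (fun n => Set.nonempty_Icc.mpr (hvaln σ hv n).1.1.le) isCompact_Icc (fun n => isClosed_Icc)
    obtain ⟨x, hx⟩ := this
    exact ⟨x, fun n => Set.mem_iInter.mp hx n⟩
  have hfst : ∀ σ n, (T^[n] σ).1 = σ.1 + n := by
    intro σ n
    induction n with
    | zero => rfl
    | succ n ih => rw [Function.iterate_succ_apply']; show (T^[n] σ).1 + 1 = _; rw [ih]; ring
  set C : ℝ := 2 * (2 / κ) ^ s with hC
  have hC0 : 0 < C := by positivity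
  have main : ∀ m : ℕ, ∀ k a b t t' x x', valid (k, a, b, t) → valid (k, a, b, t') →
      G (k, a, b, t) x → G (k, a, b, t') x' → 1 ≤ 2 ^ m * |t - t'| →
      |t - t'| ≤ C * (|x - x'| / (b - a)) ^ s := by
    intro m
    induction m with
    | zero =>
      rintro k a b t t' x x' ⟨-, h1, h2⟩ ⟨-, h3, h4⟩ - - h
      simp only at h1 h2 h3 h4
      exfalso
      have : |t - t'| < 1 := by rw [abs_lt]; constructor <;> linarith
      simp at h; linarith
    | succ m ih =>
      intro k a b t t' x x' hv hv' hx hx' hm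
      obtain ⟨hN, hr, h3, h4, h5, h6⟩ := hNf k a b hv.1
      have hba : 0 < b - a := sub_pos.mpr hv.1.1
      have hba1 : b - a ≤ 1 := hv.1.2.2
      have ht0 : 0 ≤ t := hv.2.1
      have ht0' : 0 ≤ t' := hv'.2.1
      have hN2 : (2:ℝ) ≤ N k a b := by exact_mod_cast hN
      have hN0 : (0:ℝ) < N k a b := by linarith
      have hd := hdig _ hv
      have hd' := hdig _ hv'
      set i := dig (k, a, b, t) with hi
      set i' := dig (k, a, b, t') with hi'
      have f1 : (i:ℝ) ≤ N k a b * t := Nat.floor_le (by positivity)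
      have f2 : N k a b * t < i + 1 := Nat.lt_floor_add_one _
      have f3 : (i':ℝ) ≤ N k a b * t' := Nat.floor_le (by positivity)
      have f4 : N k a b * t' < i' + 1 := Nat.lt_floor_add_one _
      by_cases hii : i = i'
      · -- same digit
        have hx1 := hGT _ _ hx
        have hx1' := hGT _ _ hx'
        have hv1 := hval _ hv
        have hv1' := hval _ hv'
        have e1 : T (k, a, b, t) = (k + 1, f k a b i - r k a b, f k a b i + r k a b, N k a b * t - i) := rfl
        have e2 : T (k, a, b, t') = (k + 1, f k a b i - r k a b, f k a b i + r k a b, N k a b * t' - i) := by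
          rw [hii]
        rw [e1] at hx1 hv1
        rw [e2] at hx1' hv1'
        have hdiff : |(N k a b * t - i) - (N k a b * t' - i)| = N k a b * |t - t'| := by
          rw [show (N k a b * t - i) - (N k a b * t' - i) = N k a b * (t - t') by ring, abs_mul,
            abs_of_pos hN0]
        have := ih _ _ _ _ _ _ _ hv1 hv1' hx1 hx1' (by
          rw [hdiff]
          calc 1 ≤ 2 ^ (m + 1) * |t - t'| := hm
            _ = 2 ^ m * (2 * |t - t'|) := by ring
            _ ≤ _ := by gcongr)
        rw [hdiff, show f k a b i + r k a b - (f k a b i - r k a b) = 2 * r k a b by ring,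
          Real.div_rpow (abs_nonneg _) (by positivity)] at this
        rw [Real.div_rpow (abs_nonneg _) hba.le]
        have hrs : 0 < (2 * r k a b) ^ s := by positivity
        have hbs : (b - a) ^ s ≤ 1 := Real.rpow_le_one hba.le hba1 hs.le
        have hbs0 : 0 < (b - a) ^ s := by positivity
        have hz : 0 ≤ |x - x'| ^ s := by positivity
        have q1 : |t - t'| ≤ C * |x - x'| ^ s := by
          have h7 : N k a b * |t - t'| * (2 * r k a b) ^ s ≤ C * |x - x'| ^ s := by
            calc _ ≤ (C * (|x - x'| ^ s / (2 * r k a b) ^ s)) * (2 * r k a b) ^ s := by gcongr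
              _ = _ := by field_simp
          calc |t - t'| = 1 * |t - t'| := by ring
            _ ≤ (N k a b * (2 * r k a b) ^ s) * |t - t'| := by gcongr
            _ = N k a b * |t - t'| * (2 * r k a b) ^ s := by ring
            _ ≤ _ := h7
        refine q1.trans ?_
        gcongr
        rw [le_div_iff₀ hbs0]
        nlinarith
      · -- different digits
        have hxm : x ∈ Set.Icc (f k a b i - r k a b) (f k a b i + r k a b) := hx 1
        have hxm' : x' ∈ Set.Icc (f k a b i' - r k a b) (f k a b i' + r k a b) := hx' 1
        set D : ℝ := |(i:ℝ) - i'| with hD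
        have hD1 : 1 ≤ D := by
          have : (1:ℤ) ≤ |(i:ℤ) - i'| := Int.one_le_abs (sub_ne_zero.mpr (by exact_mod_cast hii))
          simp only [hD]; exact_mod_cast this
        have hDN : D ≤ N k a b := by
          have a1 : (i:ℝ) ≤ N k a b := by exact_mod_cast hd.le
          have a2 : (i':ℝ) ≤ N k a b := by exact_mod_cast hd'.le
          have a3 : (0:ℝ) ≤ i := Nat.cast_nonneg _
          have a4 : (0:ℝ) ≤ i' := Nat.cast_nonneg _
          rw [hD, abs_le]; constructor <;> linarith
        have htD : |t - t'| ≤ 2 * (D / N k a b) := by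
          have : N k a b * |t - t'| ≤ D + 1 := by
            have hab : N k a b * |t - t'| = |N k a b * (t - t')| := by
              rw [abs_mul, abs_of_pos hN0]
            rw [hab, abs_le]
            have b1 := le_abs_self ((i:ℝ) - i')
            have b2 := neg_abs_le ((i:ℝ) - i')
            constructor <;> nlinarith
          rw [mul_div_assoc', le_div_iff₀ hN0]
          linarith
        have hsep : κ * D * (b - a) / N k a b ≤ |f k a b i - f k a b i'| := by
          rcases lt_or_gt_of_ne hii with hlt | hgt
          · have := h4 i i' hlt hd'
            have hlt' : (i:ℝ) < i' := by exact_mod_cast hlt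
            rw [hD, abs_of_neg (by linarith), abs_sub_comm, neg_sub]
            exact this.trans (le_abs_self _)
          · have := h4 i' i hgt hd
            have hlt' : (i':ℝ) < i := by exact_mod_cast hgt
            rw [hD, abs_of_pos (by linarith)]
            exact this.trans (le_abs_self _)
        have hxx : κ * D * (b - a) / (2 * N k a b) ≤ |x - x'| := by
          have c1 : |f k a b i - f k a b i'| ≤ |x - x'| + 2 * r k a b := by
            have d1 : |f k a b i - x| ≤ r k a b := by
              rw [abs_le]; constructor <;> linarith [hxm.1, hxm.2]
            have d2 : |x' - f k a b i'| ≤ r k a b := by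
              rw [abs_le]; constructor <;> linarith [hxm'.1, hxm'.2]
            calc _ = |(f k a b i - x) + (x - x') + (x' - f k a b i')| := by congr 1; ring
              _ ≤ |f k a b i - x| + |x - x'| + |x' - f k a b i'| := abs_add_three _ _ _
              _ ≤ _ := by linarith
          have c2 : r k a b ≤ κ * D * (b - a) / (4 * N k a b) := by
            refine h5.trans ?_
            gcongr
            nlinarith
          have c3 : κ * D * (b - a) / N k a b = κ * D * (b - a) / (2 * N k a b) + 2 * (κ * D * (b - a) / (4 * N k a b)) := by
            field_simp; ring
          linarith
        set u : ℝ := D / N k a b with hu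
        have hu0 : 0 < u := by positivity
        have hu1 : u ≤ 1 := by rw [hu, div_le_one hN0]; exact hDN
        have hux : u ≤ (2 / κ) * (|x - x'| / (b - a)) := by
          have : κ * D * (b - a) / (2 * N k a b) = u * (κ * (b - a) / 2) := by rw [hu]; field_simp
          rw [this] at hxx
          have h9 : (2 / κ) * (|x - x'| / (b - a)) = |x - x'| / (κ * (b - a) / 2) := by field_simp
          rw [h9, le_div_iff₀ (by positivity)]
          exact hxx
        calc |t - t'| ≤ 2 * u := htD
          _ ≤ 2 * u ^ s := by
              gcongr
              calc u = u ^ (1:ℝ) := (Real.rpow_one u).symm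
                _ ≤ u ^ s := Real.rpow_le_rpow_of_exponent_ge hu0 hu1 hs1
          _ ≤ 2 * ((2 / κ) * (|x - x'| / (b - a))) ^ s := by gcongr
          _ = C * (|x - x'| / (b - a)) ^ s := by
              rw [Real.mul_rpow (by positivity) (by positivity), hC]; ring
  -- initial interval
  obtain ⟨a0, b0, hab0, hsub0, hlen0⟩ : ∃ a0 b0, a0 < b0 ∧ Set.Icc a0 b0 ⊆ Set.Ioo A B ∧ b0 - a0 ≤ 1 := by
    refine ⟨(A + B) / 2, (A + B) / 2 + min 1 ((B - A) / 4), ?_, ?_, ?_⟩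
    · have : 0 < min 1 ((B - A) / 4) := lt_min one_pos (by linarith)
      linarith
    · intro x hx
      have := min_le_right 1 ((B - A) / 4)
      exact ⟨by linarith [hx.1], by linarith [hx.2]⟩
    · have := min_le_left 1 ((B - A) / 4); linarith
  have hv0 : ∀ t ∈ Set.Ico (0:ℝ) 1, valid (0, a0, b0, t) := fun t ht =>
    ⟨⟨hab0, hsub0, hlen0⟩, ht.1, ht.2⟩
  have hbd : ∀ t ∈ Set.Ico (0:ℝ) 1, ∀ t' ∈ Set.Ico (0:ℝ) 1, ∀ x x', G (0, a0, b0, t) x →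
      G (0, a0, b0, t') x' → |t - t'| ≤ C * (|x - x'| / (b0 - a0)) ^ s := by
    intro t ht t' ht' x x' hx hx'
    have hb : 0 < b0 - a0 := sub_pos.mpr hab0
    rcases eq_or_ne t t' with rfl | hne
    · simp only [sub_self, abs_zero]; positivity
    · have hpos : 0 < |t - t'| := abs_pos.mpr (sub_ne_zero.mpr hne)
      obtain ⟨m, hm⟩ := pow_unbounded_of_one_lt (1 / |t - t'|) (by norm_num : (1:ℝ) < 2)
      refine main m 0 a0 b0 t t' x x' (hv0 t ht) (hv0 t' ht') hx hx' ?_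
      rw [div_lt_iff₀ hpos] at hm
      exact hm.le
  set E : Set ℝ := {x | ∃ t ∈ Set.Ico (0:ℝ) 1, G (0, a0, b0, t) x} with hE
  have hch : ∀ x, ∃ t, x ∈ E → (t ∈ Set.Ico (0:ℝ) 1 ∧ G (0, a0, b0, t) x) := by
    intro x
    by_cases h : x ∈ E
    · obtain ⟨t, ht, hg⟩ := h; exact ⟨t, fun _ => ⟨ht, hg⟩⟩
    · exact ⟨0, fun h' => absurd h' h⟩
  choose φ hφ using hch
  have hsurj : Set.Ico (0:ℝ) 1 ⊆ φ '' E := by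
    intro t ht
    obtain ⟨x, hx⟩ := hGex _ (hv0 t ht)
    have hxE : x ∈ E := ⟨t, ht, hx⟩
    refine ⟨x, hxE, ?_⟩
    have := hbd _ (hφ x hxE).1 t ht x x (hφ x hxE).2 hx
    rw [sub_self, abs_zero, zero_div, Real.zero_rpow hs.ne', mul_zero] at this
    have := abs_nonpos_iff.mp this
    linarith
  have hhold : HolderOnWith (Real.toNNReal (C / (b0 - a0) ^ s)) (Real.toNNReal s) φ E := by
    have hb : 0 < b0 - a0 := sub_pos.mpr hab0
    intro x hx y hy
    have h := hbd _ (hφ x hx).1 _ (hφ y hy).1 x y (hφ x hx).2 (hφ y hy).2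
    rw [edist_dist, edist_dist, Real.coe_toNNReal s hs.le, Real.dist_eq, Real.dist_eq,
      ENNReal.ofReal_rpow_of_nonneg (abs_nonneg _) hs.le]
    have : ((Real.toNNReal (C / (b0 - a0) ^ s) : ℝ≥0) : ℝ≥0∞) = ENNReal.ofReal (C / (b0 - a0) ^ s) := rfl
    rw [this, ← ENNReal.ofReal_mul (by positivity)]
    apply ENNReal.ofReal_le_ofReal
    refine h.trans (le_of_eq ?_)
    rw [Real.div_rpow (abs_nonneg _) hb.le]; ring
  have hs0' : 0 < Real.toNNReal s := Real.toNNReal_pos.mpr hs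
  have hd := hhold.dimH_image_le hs0'
  have h1 : (1:ℝ≥0∞) ≤ dimH (φ '' E) := by
    calc (1:ℝ≥0∞) = dimH (Set.Ico (0:ℝ) 1) := by
          symm
          rw [Real.dimH_of_nonempty_interior (by
            rw [interior_Ico]; exact ⟨1/2, by norm_num, by norm_num⟩)]
          simp
      _ ≤ _ := dimH_mono hsurj
  have h2 : ENNReal.ofReal s ≤ dimH E := by
    have := h1.trans hd
    rw [ENNReal.le_div_iff_mul_le (Or.inl (by exact_mod_cast hs0'.ne')) (Or.inl ENNReal.coe_ne_top), one_mul] at this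
    exact this
  refine h2.trans (dimH_mono ?_)
  rintro x ⟨t, ht, hg⟩
  refine ⟨hsub0 (hg 0), fun n => ?_⟩
  have h3 := hg (n + 1)
  rw [Function.iterate_succ_apply'] at h3
  have h4 := (hsub _ (hvaln _ (hv0 t ht) n) h3).2
  rwa [hfst, zero_add] at h4

end Part10

section Part11
open MeasureTheory Filter Topology
open scoped ENNReal NNReal

theorem cells (a b l : ℝ) (G Bad : Set ℝ) (hab : a < b) (hl : 0 < l) (hlb : l ≤ (b - a) / 8)
    (hvol : volume Bad ≤ ENNReal.ofReal ((b - a) / 16))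
    (hG : ∀ x ∈ Set.Icc a b, x ∉ Bad → ∃ y ∈ G, |x - y| ≤ l / 8) :
    ∃ (N : ℕ) (f : ℕ → ℝ), (b - a) / (4 * l) ≤ N ∧ (N:ℝ) ≤ (b - a) / (2 * l) ∧
      (∀ i < N, f i ∈ G ∧ a + (b - a) / 8 ≤ f i ∧ f i ≤ b - (b - a) / 8) ∧
      (∀ i j, i < j → j < N → ((j:ℝ) - i) * l / 4 ≤ f j - f i) := by
  classical
  have hba : 0 < b - a := by linarith
  set M : ℕ := ⌊(b - a) / (2 * l)⌋₊ with hM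
  have hM1 : (M:ℝ) ≤ (b - a) / (2 * l) := Nat.floor_le (by positivity)
  have hM2 : (b - a) / (2 * l) < M + 1 := Nat.lt_floor_add_one _
  have hMl : (M:ℝ) * l ≤ (b - a) / 2 := by
    rw [le_div_iff₀ (by positivity)] at hM1; linarith
  set u : ℝ := a + (b - a) / 4 with hu
  let cell : ℕ → Set ℝ := fun m => Set.Icc (u + m * l) (u + m * l + l / 2)
  set S := (Finset.range M).filter (fun m => ¬ cell m ⊆ Bad) with hS
  set S' := (Finset.range M).filter (fun m => cell m ⊆ Bad) with hS'
  have hcard : S'.card + S.card = M := by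
    rw [hS, hS', Finset.card_filter_add_card_filter_not, Finset.card_range]
  have hbad : (S'.card : ℝ) * (l / 2) ≤ (b - a) / 16 := by
    have h1 : volume (⋃ m ∈ S', cell m) = ∑ m ∈ S', volume (cell m) := by
      apply measure_biUnion_finset
      · intro i _ j _ hij
        rw [Function.onFun, Set.disjoint_left]
        intro x hx hx'
        have hx1 := hx.1
        have hx2 := hx.2
        have hx3 := hx'.1
        have hx4 := hx'.2
        rcases lt_or_gt_of_ne hij with h | h
        · have : (i:ℝ) + 1 ≤ j := by exact_mod_cast h
          nlinarith
        · have : (j:ℝ) + 1 ≤ i := by exact_mod_cast h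
          nlinarith
      · intro i _; exact measurableSet_Icc
    have h2 : ∀ m, volume (cell m) = ENNReal.ofReal (l / 2) := by
      intro m; simp only [cell]; rw [Real.volume_Icc]; congr 1; ring
    have h3 : volume (⋃ m ∈ S', cell m) ≤ volume Bad := by
      apply measure_mono
      intro x hx
      simp only [Set.mem_iUnion] at hx
      obtain ⟨m, hm, hx⟩ := hx
      exact (Finset.mem_filter.mp hm).2 hx
    rw [h1, Finset.sum_congr rfl (fun m _ => h2 m), Finset.sum_const, nsmul_eq_mul,
      ← ENNReal.ofReal_natCast, ← ENNReal.ofReal_mul (Nat.cast_nonneg _)] at h3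
    exact (ENNReal.ofReal_le_ofReal_iff (by positivity)).mp (h3.trans hvol)
  have hy : ∀ m, ∃ y, m ∈ S → y ∈ G ∧ u + m * l - l / 8 ≤ y ∧ y ≤ u + m * l + 5 * l / 8 := by
    intro m
    by_cases hm : m ∈ S
    · obtain ⟨hm1, hm2⟩ := Finset.mem_filter.mp hm
      rw [Set.not_subset] at hm2
      obtain ⟨x, hx, hxB⟩ := hm2
      have hm3 : (m:ℝ) + 1 ≤ M := by exact_mod_cast Finset.mem_range.mp hm1
      have hx1 := hx.1
      have hx2 := hx.2
      have hml : 0 ≤ (m:ℝ) * l := by positivity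
      have hml2 : ((m:ℝ) + 1) * l ≤ M * l := by gcongr
      obtain ⟨y, hyG, hxy⟩ := hG x ⟨by linarith, by linarith⟩ hxB
      rw [abs_le] at hxy
      exact ⟨y, fun _ => ⟨hyG, by linarith [hxy.2], by linarith [hxy.1]⟩⟩
    · exact ⟨0, fun h => absurd h hm⟩
  choose y hy using hy
  set N := S.card with hN
  let e := S.orderEmbOfFin rfl
  have heS : ∀ i, e i ∈ S := fun i => Finset.orderEmbOfFin_mem S rfl i
  have hemono : ∀ d i, (h : i + d < N) → e ⟨i, by omega⟩ + d ≤ e ⟨i + d, h⟩ := by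
    intro d
    induction d with
    | zero => intro i h; simp
    | succ d ih =>
      intro i h
      have h1 := ih i (by omega)
      have h2 : e ⟨i + d, by omega⟩ < e ⟨i + (d + 1), h⟩ := by
        apply e.strictMono; simp [Fin.lt_def]
      omega
  refine ⟨N, fun i => if h : i < N then y (e ⟨i, h⟩) else 0, ?_, ?_, ?_, ?_⟩
  · have h1 : (S'.card : ℝ) + N = M := by exact_mod_cast hcard
    have h2 : (S'.card : ℝ) ≤ (b - a) / (8 * l) := by
      rw [le_div_iff₀ (by positivity)]; linarith
    have h3 : 1 ≤ (b - a) / (8 * l) := by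
      rw [le_div_iff₀ (by positivity)]; linarith
    have h4 : (b - a) / (2 * l) = 4 * ((b - a) / (8 * l)) := by field_simp; ring
    have h5 : (b - a) / (4 * l) = 2 * ((b - a) / (8 * l)) := by field_simp; ring
    linarith
  · have : N ≤ M := by omega
    have : (N:ℝ) ≤ M := by exact_mod_cast this
    linarith
  · intro i hi
    simp only [hi, dif_pos]
    have hm := heS ⟨i, hi⟩
    obtain ⟨h1, h2, h3⟩ := hy _ hm
    have hm3 : ((e ⟨i, hi⟩ : ℕ):ℝ) + 1 ≤ M := by
      exact_mod_cast Finset.mem_range.mp (Finset.mem_filter.mp hm).1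
    have hml : 0 ≤ ((e ⟨i, hi⟩ : ℕ):ℝ) * l := by positivity
    have hml2 : (((e ⟨i, hi⟩ : ℕ):ℝ) + 1) * l ≤ M * l := by gcongr
    exact ⟨h1, by linarith, by linarith⟩
  · intro i j hij hj
    have hi : i < N := by omega
    simp only [hi, hj, dif_pos]
    obtain ⟨d, rfl⟩ := Nat.exists_eq_add_of_lt hij
    have h0 := hemono (d + 1) i (by omega)
    obtain ⟨h1, h2, h3⟩ := hy _ (heS ⟨i, hi⟩)
    obtain ⟨h1', h2', h3'⟩ := hy _ (heS ⟨i + d + 1, hj⟩)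
    have h4 : ((e ⟨i, hi⟩ : ℕ):ℝ) + (d + 1) ≤ (e ⟨i + d + 1, hj⟩ : ℕ) := by exact_mod_cast h0
    have h5 : (((e ⟨i, hi⟩ : ℕ):ℝ) + (d + 1)) * l ≤ (e ⟨i + d + 1, hj⟩ : ℕ) * l := by gcongr
    have h6 : 0 ≤ (d:ℝ) * l := by positivity
    push_cast
    nlinarith

theorem minkowski4 (x Q E ε : ℝ) (hQ : 0 < Q) (hE : 0 < E) (hε : 0 < ε) (h : 1 < Q * E * ε ^ 2) :
    ∃ a0 a1 a2 a3 : ℤ, ¬ (a0 = 0 ∧ a1 = 0 ∧ a2 = 0 ∧ a3 = 0) ∧ |(a0:ℝ)| ≤ Q ∧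
      |(a1:ℝ) - x * a0| ≤ E ∧ |(a2:ℝ) - 2 * x * a1 + x ^ 2 * a0| ≤ ε ∧
      |(a3:ℝ) - 3 * x * a2 + 3 * x ^ 2 * a1 - x ^ 3 * a0| ≤ ε := by
  set A : Matrix (Fin 4) (Fin 4) ℝ := !![1, 0, 0, 0; -x, 1, 0, 0; x ^ 2, -2 * x, 1, 0;
    -x ^ 3, 3 * x ^ 2, -3 * x, 1] with hA
  have hdet : A.det = 1 := by
    rw [hA]; simp [Matrix.det_succ_row_zero, Fin.sum_univ_succ, Fin.succAbove]
  set L : (Fin 4 → ℝ) →ₗ[ℝ] (Fin 4 → ℝ) := Matrix.toLin' A with hL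
  have hLdet : LinearMap.det L = 1 := by rw [hL, LinearMap.det_toLin', hdet]
  set R : Fin 4 → ℝ := ![Q, E, ε, ε] with hR
  have hR0 : ∀ i, 0 < R i := by intro i; fin_cases i <;> simp [hR, hQ, hE, hε]
  set box : Set (Fin 4 → ℝ) := Set.Icc (-R) R with hbox
  set S : Set (Fin 4 → ℝ) := L ⁻¹' box with hS
  have hvol : volume S = ENNReal.ofReal (16 * (Q * E * ε ^ 2)) := by
    rw [hS, Measure.addHaar_preimage_linearMap _ (by rw [hLdet]; norm_num), hLdet, hbox, Real.volume_Icc_pi]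
    simp only [inv_one, abs_one, ENNReal.ofReal_one, one_mul]
    rw [← ENNReal.ofReal_prod_of_nonneg (by intro i _; have := hR0 i; simp only [Pi.neg_apply]; linarith)]
    congr 1
    simp [Fin.prod_univ_succ, hR]; ring
  set b := Pi.basisFun ℝ (Fin 4) with hb
  have hF := ZSpan.isAddFundamentalDomain b (volume : Measure (Fin 4 → ℝ))
  have hFv : volume (ZSpan.fundamentalDomain b) = 1 := by
    rw [hb, ZSpan.fundamentalDomain_pi_basisFun, Real.volume_pi_Ico]; simp
  have hsymm : ∀ v ∈ S, -v ∈ S := by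
    intro v hv
    simp only [hS, hbox, Set.mem_preimage, map_neg, Set.mem_Icc] at hv ⊢
    exact ⟨neg_le_neg hv.2, neg_le.mp (by simpa using hv.1)⟩
  have hconv : Convex ℝ S := (convex_Icc _ _).linear_preimage L
  have : Countable (Submodule.span ℤ (Set.range b)).toAddSubgroup := by
    have : Countable (Submodule.span ℤ (Set.range b)) := inferInstance
    exact this
  obtain ⟨v, hv0, hvS⟩ := exists_ne_zero_mem_lattice_of_measure_mul_two_pow_lt_measure
    (μ := (volume : Measure (Fin 4 → ℝ))) (L := (Submodule.span ℤ (Set.range b)).toAddSubgroup) (s := S)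
    hF hsymm hconv (by
      rw [hFv, hvol, Module.finrank_fin_fun, one_mul]
      have : ((2:ℝ≥0∞) ^ 4) = ENNReal.ofReal 16 := by norm_num
      rw [this]
      apply (ENNReal.ofReal_lt_ofReal_iff (by linarith)).mpr; linarith)
  have h_intg : ∀ i, ∃ z : ℤ, (v : Fin 4 → ℝ) i = z := by
    intro i
    have hm : (v : Fin 4 → ℝ) ∈ Submodule.span ℤ (Set.range b) := v.2
    rw [b.mem_span_iff_repr_mem ℤ] at hm
    obtain ⟨z, hz⟩ := hm i
    refine ⟨z, ?_⟩
    simpa [hb] using hz.symm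
  choose z hz using h_intg
  refine ⟨z 0, z 1, z 2, z 3, ?_, ?_⟩
  · rintro ⟨h0, h1, h2, h3⟩
    apply hv0
    ext i
    rw [hz i]
    fin_cases i <;> simp [h0, h1, h2, h3]
  · simp only [hS, hbox, Set.mem_preimage, Set.mem_Icc, Pi.le_def] at hvS
    obtain ⟨hl, hu⟩ := hvS
    have key : ∀ i, |L v i| ≤ R i := fun i => abs_le.mpr ⟨hl i, hu i⟩
    have k0 := key 0
    have k1 := key 1
    have k2 := key 2
    have k3 := key 3
    simp [hL, hA, Matrix.toLin'_apply, Matrix.mulVec, dotProduct, Fin.sum_univ_succ, hz, hR] at k0 k1 k2 k3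
    refine ⟨k0, ?_, ?_, ?_⟩
    · convert k1 using 2; ring
    · convert k2 using 2; ring
    · convert k3 using 2; ring

end Part11

section Part12
open MeasureTheory Filter Topology
open scoped ENNReal NNReal

theorem vol_fin_cover (P : Finset ℝ) (ρ : ℝ) (hρ : 0 ≤ ρ) :
    volume {x : ℝ | ∃ p ∈ P, |x - p| ≤ ρ} ≤ ENNReal.ofReal (P.card * (2 * ρ)) := by
  have h1 : {x : ℝ | ∃ p ∈ P, |x - p| ≤ ρ} ⊆ ⋃ p ∈ P, Metric.closedBall p ρ := by
    rintro x ⟨p, hp, hx⟩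
    simp only [Set.mem_iUnion]
    exact ⟨p, hp, by rwa [Metric.mem_closedBall, Real.dist_eq]⟩
  refine (measure_mono h1).trans ((measure_biUnion_finset_le _ _).trans ?_)
  simp only [Real.volume_closedBall]
  rw [Finset.sum_const, nsmul_eq_mul, ENNReal.ofReal_mul (Nat.cast_nonneg _), ENNReal.ofReal_natCast]

theorem rat_cover (K : ℝ) (hK : 1 ≤ K) (R : ℕ) (g : ℕ → ℝ) (hg0 : ∀ r, 0 ≤ g r)
    (hg1 : ∀ r, 1 ≤ r → g r ≤ 1) :
    volume {x : ℝ | |x| ≤ K ∧ ∃ (s : ℤ) (r : ℕ), 1 ≤ r ∧ r ≤ R ∧ |x - s / r| ≤ g r} ≤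
      ENNReal.ofReal (∑ r ∈ Finset.Icc 1 R, 10 * K * (r * g r)) := by
  classical
  let P : ℕ → Finset ℝ := fun r =>
    (Finset.Icc (-⌊2 * K * r⌋) ⌊2 * K * r⌋).image (fun s : ℤ => (s:ℝ) / r)
  have hsub : {x : ℝ | |x| ≤ K ∧ ∃ (s : ℤ) (r : ℕ), 1 ≤ r ∧ r ≤ R ∧ |x - s / r| ≤ g r} ⊆
      ⋃ r ∈ Finset.Icc 1 R, {x : ℝ | ∃ p ∈ P r, |x - p| ≤ g r} := by
    rintro x ⟨hx, s, r, hr1, hrR, hxs⟩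
    simp only [Set.mem_iUnion]
    refine ⟨r, Finset.mem_Icc.mpr ⟨hr1, hrR⟩, (s:ℝ) / r, ?_, hxs⟩
    have hr0 : (0:ℝ) < r := by exact_mod_cast hr1
    have h1 : |(s:ℝ) / r| ≤ 2 * K := by
      calc |(s:ℝ) / r| = |x - (x - (s:ℝ) / r)| := by congr 1; ring
        _ ≤ |x| + |x - (s:ℝ) / r| := abs_sub _ _
        _ ≤ _ := by linarith [hg1 r hr1]
    rw [abs_div, abs_of_pos hr0, div_le_iff₀ hr0, abs_le] at h1
    refine Finset.mem_image.mpr ⟨s, ?_, rfl⟩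
    rw [Finset.mem_Icc]
    refine ⟨?_, Int.le_floor.mpr h1.2⟩
    have : -s ≤ ⌊2 * K * r⌋ := by apply Int.le_floor.mpr; push_cast; linarith [h1.1]
    omega
  refine (measure_mono hsub).trans ((measure_biUnion_finset_le _ _).trans ?_)
  rw [ENNReal.ofReal_sum_of_nonneg (fun r _ => by have := hg0 r; positivity)]
  apply Finset.sum_le_sum
  intro r hr
  have hr1 := (Finset.mem_Icc.mp hr).1
  have hr0 : (1:ℝ) ≤ r := by exact_mod_cast hr1
  refine (vol_fin_cover (P r) (g r) (hg0 r)).trans (ENNReal.ofReal_le_ofReal ?_)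
  have hc : ((P r).card : ℝ) ≤ 5 * K * r := by
    have hKR : 1 ≤ K * r := by nlinarith
    have : (0:ℤ) ≤ ⌊2 * K * r⌋ := by positivity
    calc ((P r).card : ℝ) ≤ ((Finset.Icc (-⌊2 * K * r⌋) ⌊2 * K * r⌋).card : ℝ) := by
          exact_mod_cast Finset.card_image_le
      _ = 2 * ⌊2 * K * r⌋ + 1 := by
          rw [Int.card_Icc]
          have h2 : ((⌊2 * K * r⌋ + 1 - -⌊2 * K * r⌋).toNat : ℤ) = 2 * ⌊2 * K * r⌋ + 1 := by
            rw [Int.toNat_of_nonneg (by omega)]; ring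
          exact_mod_cast h2
      _ ≤ _ := by have := Int.floor_le (2 * K * r); linarith
  calc ((P r).card : ℝ) * (2 * g r) ≤ (5 * K * r) * (2 * g r) := by
        have := hg0 r; gcongr
    _ = _ := by ring

theorem sum_inv_sqrt (R : ℕ) : ∑ r ∈ Finset.Icc 1 R, (1 / Real.sqrt r) ≤ 2 * Real.sqrt R := by
  induction R with
  | zero => simp
  | succ n ih =>
    rw [Finset.sum_Icc_succ_top (by omega)]
    push_cast
    have h1 : 0 < Real.sqrt ((n:ℝ) + 1) := Real.sqrt_pos.mpr (by positivity)
    have h2 : Real.sqrt ((n:ℝ) + 1) ^ 2 = n + 1 := Real.sq_sqrt (by positivity)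
    have h3 : Real.sqrt n ^ 2 = n := Real.sq_sqrt (by positivity)
    have h4 : 0 ≤ Real.sqrt (n:ℝ) := Real.sqrt_nonneg _
    have h5 : 1 / Real.sqrt ((n:ℝ) + 1) ≤ 2 * (Real.sqrt ((n:ℝ) + 1) - Real.sqrt n) := by
      rw [div_le_iff₀ h1]
      nlinarith [sq_nonneg (Real.sqrt ((n:ℝ) + 1) - Real.sqrt n)]
    push_cast at ih
    linarith

/-- small lattice point at `x` -/
def SP (Z E ε x : ℝ) (a0 a1 a2 a3 : ℤ) : Prop :=
  0 ≤ a0 ∧ (a0:ℝ) ≤ Z ∧ ¬ (a0 = 0 ∧ a1 = 0 ∧ a2 = 0 ∧ a3 = 0) ∧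
  |(a1:ℝ) - x * a0| ≤ E ∧ |(a2:ℝ) - 2 * x * a1 + x ^ 2 * a0| ≤ ε ∧
  |(a3:ℝ) - 3 * x * a2 + 3 * x ^ 2 * a1 - x ^ 3 * a0| ≤ ε

theorem SP_bounds (Z E ε x : ℝ) (a0 a1 a2 a3 : ℤ) (hεE : ε ≤ E) (h : SP Z E ε x a0 a1 a2 a3) :
    |((cA a0 a1 a2 : ℤ):ℝ)| ≤ a0 * ε + E ^ 2 ∧
    |((cB a0 a1 a2 a3 : ℤ):ℝ) - 2 * x * (cA a0 a1 a2 : ℤ)| ≤ a0 * ε + E * ε ∧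
    |((cA a0 a1 a2 : ℤ):ℝ) * x ^ 2 - (cB a0 a1 a2 a3 : ℤ) * x + (cA a1 a2 a3 : ℤ)| ≤ 2 * E * ε := by
  obtain ⟨h0, -, -, h1, h2, h3⟩ := h
  have h0' : (0:ℝ) ≤ a0 := by exact_mod_cast h0
  have hε : 0 ≤ ε := (abs_nonneg _).trans h2
  have hE : 0 ≤ E := hε.trans hεE
  set e1 := (a1:ℝ) - x * a0 with he1
  set e2 := (a2:ℝ) - 2 * x * a1 + x ^ 2 * a0 with he2
  set e3 := (a3:ℝ) - 3 * x * a2 + 3 * x ^ 2 * a1 - x ^ 3 * a0 with he3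
  refine ⟨?_, ?_, ?_⟩
  · have : ((cA a0 a1 a2 : ℤ):ℝ) = a0 * e2 - e1 * e1 := by
      simp only [cA, he1, he2]; push_cast; ring
    rw [this]
    calc _ ≤ |(a0:ℝ) * e2| + |e1 * e1| := abs_sub _ _
      _ = a0 * |e2| + |e1| * |e1| := by rw [abs_mul, abs_mul, abs_of_nonneg h0']
      _ ≤ a0 * ε + E * E := by gcongr
      _ = _ := by ring
  · have : ((cB a0 a1 a2 a3 : ℤ):ℝ) - 2 * x * (cA a0 a1 a2 : ℤ) = a0 * e3 - e1 * e2 := by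
      simp only [cA, cB, he1, he2, he3]; push_cast; ring
    rw [this]
    calc _ ≤ |(a0:ℝ) * e3| + |e1 * e2| := abs_sub _ _
      _ = a0 * |e3| + |e1| * |e2| := by rw [abs_mul, abs_mul, abs_of_nonneg h0']
      _ ≤ a0 * ε + E * ε := by gcongr
  · have : ((cA a0 a1 a2 : ℤ):ℝ) * x ^ 2 - (cB a0 a1 a2 a3 : ℤ) * x + (cA a1 a2 a3 : ℤ) = e1 * e3 - e2 * e2 := by
      simp only [cA, cB, he1, he2, he3]; push_cast; ring
    rw [this]
    calc _ ≤ |e1 * e3| + |e2 * e2| := abs_sub _ _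
      _ = |e1| * |e3| + |e2| * |e2| := by rw [abs_mul, abs_mul]
      _ ≤ E * ε + E * ε := by gcongr; exact h2.trans hεE
      _ = _ := by ring

theorem bad1 (K Z E ε : ℝ) (hK : 1 ≤ K) (hε : 0 < ε) (hε1 : ε < 1) (hZ : 1 ≤ Z) :
    volume {x : ℝ | |x| ≤ K ∧ ∃ a0 a1 a2 a3, SP Z E ε x a0 a1 a2 a3 ∧ cA a0 a1 a2 = 0 ∧
      cB a0 a1 a2 a3 = 0 ∧ cA a1 a2 a3 = 0} ≤
    ENNReal.ofReal (20 * K * (Real.sqrt ε * Real.sqrt (Z ^ (1/3:ℝ)))) := by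
  set R : ℕ := ⌊Z ^ (1/3:ℝ)⌋₊ with hR
  set g : ℕ → ℝ := fun r => Real.sqrt ε * (1 / (r * Real.sqrt r)) with hg
  have hsub : {x : ℝ | |x| ≤ K ∧ ∃ a0 a1 a2 a3, SP Z E ε x a0 a1 a2 a3 ∧ cA a0 a1 a2 = 0 ∧
      cB a0 a1 a2 a3 = 0 ∧ cA a1 a2 a3 = 0} ⊆
      {x : ℝ | |x| ≤ K ∧ ∃ (s : ℤ) (r : ℕ), 1 ≤ r ∧ r ≤ R ∧ |x - s / r| ≤ g r} := by
    rintro x ⟨hxK, a0, a1, a2, a3, ⟨h0, hZ0, hne, h1, h2, h3⟩, hA, hB, hC⟩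
    refine ⟨hxK, ?_⟩
    simp only [cA, cB] at hA hB hC
    rcases h0.eq_or_lt with h00 | hpos
    · exfalso
      subst h00
      have b1 : a1 = 0 := by
        have : a1 ^ 2 = 0 := by linarith
        exact pow_eq_zero_iff (two_ne_zero) |>.mp this
      subst b1
      have b2 : a2 = 0 := by
        have : a2 ^ 2 = 0 := by linarith
        exact pow_eq_zero_iff (two_ne_zero) |>.mp this
      subst b2
      have b3 : a3 = 0 := by
        simp at h3
        have : |(a3:ℝ)| < 1 := by linarith
        have : |a3| < 1 := by exact_mod_cast this
        exact Int.abs_lt_one_iff.mp this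
      exact hne ⟨rfl, rfl, rfl, b3⟩
    · obtain ⟨s, r, hr, ⟨m, hm⟩, hrs⟩ := int_cube a0 a1 a2 a3 hpos (by linarith) (by linarith)
      obtain ⟨r', rfl⟩ := Int.eq_ofNat_of_zero_le hr.le
      have hr1 : 1 ≤ r' := by omega
      have hr0 : (0:ℝ) < r' := by exact_mod_cast hr1
      have ha0 : (0:ℝ) < a0 := by exact_mod_cast hpos
      have hm0 : 0 < m := by
        have : 0 < ((r':ℤ)) ^ 3 * m := hm ▸ hpos
        exact pos_of_mul_pos_right this (by positivity)
      have h3r : ((r':ℤ)) ^ 3 ≤ a0 := by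
        rw [hm]; have : 0 < ((r':ℤ)) ^ 3 := by positivity
        nlinarith
      have h3r' : (r':ℝ) ^ 3 ≤ a0 := by exact_mod_cast h3r
      refine ⟨s, r', hr1, ?_, ?_⟩
      · apply Nat.le_floor
        have : (r':ℝ) = ((r':ℝ) ^ 3) ^ (1/3:ℝ) := by
          rw [← Real.rpow_natCast, ← Real.rpow_mul hr0.le]; norm_num
        rw [this]
        apply Real.rpow_le_rpow (by positivity) (by linarith) (by norm_num)
      · have hrs' : (a1:ℝ) * r' = a0 * s := by exact_mod_cast hrs
        have hA' : (a0:ℝ) * a2 - a1 ^ 2 = 0 := by exact_mod_cast hA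
        have heq : (a0:ℝ) * (x - s / r') ^ 2 = (a2:ℝ) - 2 * x * a1 + x ^ 2 * a0 := by
          have : (s:ℝ) / r' = a1 / a0 := by
            rw [div_eq_div_iff hr0.ne' ha0.ne']; linarith
          rw [this]; field_simp; linear_combination (-1) * hA'
        apply abs_le_of_sq_le_sq _ (by positivity)
        simp only [hg]
        rw [mul_pow, Real.sq_sqrt hε.le, div_pow, mul_pow, Real.sq_sqrt hr0.le, one_pow, mul_one_div,
          le_div_iff₀ (by positivity)]
        calc (x - s / r') ^ 2 * ((r':ℝ) ^ 2 * r') = (x - s / r') ^ 2 * ((r':ℝ) ^ 3) := by ring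
          _ ≤ (x - s / r') ^ 2 * a0 := by gcongr
          _ = (a2:ℝ) - 2 * x * a1 + x ^ 2 * a0 := by rw [← heq]; ring
          _ ≤ _ := (le_abs_self _).trans h2
  refine (measure_mono hsub).trans ((rat_cover K hK R g (fun r => by positivity) ?_).trans ?_)
  · intro r hr
    have hr' : (1:ℝ) ≤ r := by exact_mod_cast hr
    have h1 : (1:ℝ) ≤ Real.sqrt r := Real.one_le_sqrt.mpr hr'
    have h2 : Real.sqrt ε ≤ 1 := Real.sqrt_le_one.mpr hε1.le
    have h3 : 1 / ((r:ℝ) * Real.sqrt r) ≤ 1 := by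
      rw [div_le_one (by positivity)]; nlinarith
    calc g r ≤ 1 * 1 := by simp only [hg]; gcongr
      _ = 1 := by norm_num
  · apply ENNReal.ofReal_le_ofReal
    have : ∀ r ∈ Finset.Icc 1 R, 10 * K * ((r:ℝ) * g r) = 10 * K * Real.sqrt ε * (1 / Real.sqrt r) := by
      intro r hr
      have hr' : (0:ℝ) < r := by exact_mod_cast (Finset.mem_Icc.mp hr).1
      have := Real.sqrt_pos.mpr hr'
      simp only [hg]; field_simp
    rw [Finset.sum_congr rfl this, ← Finset.mul_sum]
    have hRZ : (R:ℝ) ≤ Z ^ (1/3:ℝ) := Nat.floor_le (by positivity)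
    calc _ ≤ 10 * K * Real.sqrt ε * (2 * Real.sqrt R) := by gcongr; exact sum_inv_sqrt R
      _ ≤ 10 * K * Real.sqrt ε * (2 * Real.sqrt (Z ^ (1/3:ℝ))) := by gcongr
      _ = _ := by ring

theorem bad2 (K Z E ε : ℝ) (hK : 1 ≤ K) (hε : 0 < ε) (hεE : ε ≤ E) (hEε : 2 * E * ε < 1) (hZ : 1 ≤ Z) :
    volume {x : ℝ | |x| ≤ K ∧ ∃ a0 a1 a2 a3, SP Z E ε x a0 a1 a2 a3 ∧ cD a0 a1 a2 a3 = 0 ∧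
      ¬ (cA a0 a1 a2 = 0 ∧ cB a0 a1 a2 a3 = 0 ∧ cA a1 a2 a3 = 0)} ≤
    ENNReal.ofReal (10 * K * (Real.sqrt (2 * E * ε) * Real.sqrt (Z * ε + E ^ 2))) := by
  have hE : 0 < E := by linarith
  set R : ℕ := ⌊Real.sqrt (Z * ε + E ^ 2)⌋₊ with hR
  set g : ℕ → ℝ := fun r => Real.sqrt (2 * E * ε) * (1 / r) with hg
  have hsub : {x : ℝ | |x| ≤ K ∧ ∃ a0 a1 a2 a3, SP Z E ε x a0 a1 a2 a3 ∧ cD a0 a1 a2 a3 = 0 ∧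
      ¬ (cA a0 a1 a2 = 0 ∧ cB a0 a1 a2 a3 = 0 ∧ cA a1 a2 a3 = 0)} ⊆
      {x : ℝ | |x| ≤ K ∧ ∃ (s : ℤ) (r : ℕ), 1 ≤ r ∧ r ≤ R ∧ |x - s / r| ≤ g r} := by
    rintro x ⟨hxK, a0, a1, a2, a3, hSP, hD, hH⟩
    refine ⟨hxK, ?_⟩
    obtain ⟨q1, q2, q3⟩ := SP_bounds _ _ _ _ _ _ _ _ hεE hSP
    have hZ0 := hSP.2.1
    simp only [cD] at hD
    set A := cA a0 a1 a2
    set B := cB a0 a1 a2 a3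
    set C := cA a1 a2 a3
    have hA : A ≠ 0 := by
      intro hA
      rw [hA] at hD
      have hB : B = 0 := by simpa using hD
      rw [hA, hB] at q3
      simp only [Int.cast_zero, zero_mul, sub_zero, zero_add] at q3
      have h1 : |(C:ℝ)| < 1 := by linarith
      have h2 : |C| < 1 := by exact_mod_cast h1
      exact hH ⟨hA, hB, Int.abs_lt_one_iff.mp h2⟩
    obtain ⟨s, r, hr, ⟨m, hm⟩, hrs⟩ := int_hess A B C hA (by linarith)
    obtain ⟨r', rfl⟩ := Int.eq_ofNat_of_zero_le hr.le
    have hr1 : 1 ≤ r' := by omega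
    have hr0 : (0:ℝ) < r' := by exact_mod_cast hr1
    have hm0 : 0 < |m| := by
      apply abs_pos.mpr; rintro rfl; simp at hm; exact hA hm
    have h5 : ((r':ℤ)) ^ 2 ≤ |A| := by
      rw [hm, abs_mul, abs_of_pos (by positivity)]; nlinarith [sq_nonneg (r':ℤ)]
    have h6 : (r':ℝ) ^ 2 ≤ |(A:ℝ)| := by exact_mod_cast h5
    refine ⟨s, r', hr1, ?_, ?_⟩
    · apply Nat.le_floor
      apply Real.le_sqrt_of_sq_le
      refine h6.trans (q1.trans ?_)
      gcongr
    · have hrs' : (B:ℝ) * r' = 2 * A * s := by exact_mod_cast hrs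
      have hD' : (B:ℝ) ^ 2 - 4 * A * C = 0 := by exact_mod_cast hD
      have hA' : (A:ℝ) ≠ 0 := by exact_mod_cast hA
      have heq : (A:ℝ) * (x - s / r') ^ 2 = A * x ^ 2 - B * x + C := by
        have : (s:ℝ) / r' = B / (2 * A) := by
          rw [div_eq_div_iff hr0.ne' (by positivity)]; linarith
        rw [this]; field_simp; linear_combination hD'
      rw [← heq, abs_mul, abs_of_nonneg (sq_nonneg (x - (s:ℝ) / r'))] at q3
      apply abs_le_of_sq_le_sq _ (by positivity)
      simp only [hg]
      rw [mul_pow, Real.sq_sqrt (by positivity), div_pow, one_pow, mul_one_div,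
        le_div_iff₀ (by positivity)]
      calc (x - s / r') ^ 2 * (r':ℝ) ^ 2 ≤ (x - s / r') ^ 2 * |(A:ℝ)| := by gcongr
        _ = |(A:ℝ)| * (x - s / r') ^ 2 := by ring
        _ ≤ _ := q3
  refine (measure_mono hsub).trans ((rat_cover K hK R g (fun r => by positivity) ?_).trans ?_)
  · intro r hr
    have hr' : (1:ℝ) ≤ r := by exact_mod_cast hr
    have h2 : Real.sqrt (2 * E * ε) ≤ 1 := Real.sqrt_le_one.mpr hEε.le
    have h3 : 1 / (r:ℝ) ≤ 1 := by
      rw [div_le_one (by positivity)]; exact hr'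
    calc g r ≤ 1 * 1 := by simp only [hg]; gcongr
      _ = 1 := by norm_num
  · apply ENNReal.ofReal_le_ofReal
    have : ∀ r ∈ Finset.Icc 1 R, 10 * K * ((r:ℝ) * g r) = 10 * K * Real.sqrt (2 * E * ε) := by
      intro r hr
      have hr' : (0:ℝ) < r := by exact_mod_cast (Finset.mem_Icc.mp hr).1
      simp only [hg]; field_simp
    rw [Finset.sum_congr rfl this, Finset.sum_const, nsmul_eq_mul, Nat.card_Icc]
    have hRZ : (R:ℝ) ≤ Real.sqrt (Z * ε + E ^ 2) := Nat.floor_le (by positivity)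
    simp only [Nat.add_sub_cancel]
    calc _ ≤ Real.sqrt (Z * ε + E ^ 2) * (10 * K * Real.sqrt (2 * E * ε)) := by gcongr
      _ = _ := by ring

end Part12

section Part13
open MeasureTheory Filter Topology
open scoped ENNReal NNReal

theorem SP_disc (Z E ε W x : ℝ) (a0 a1 a2 a3 : ℤ) (hε : 0 < ε) (hεE : ε ≤ E) (hW : 1 ≤ W)
    (h1 : E * ε ≤ 1 / 4) (h2 : (Z * ε) * (E * ε) ≤ 1 / 64) (h3 : E ^ 3 * ε ≤ 1 / 64)
    (h4 : E ^ 2 ≤ 4 * W) (hSP : SP Z E ε x a0 a1 a2 a3) (hD : cD a0 a1 a2 a3 ≠ 0) :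
    1 / 2 ≤ a0 * ε ∧ |((cA a0 a1 a2 : ℤ):ℝ)| ≤ 9 * (a0 * ε) * W ∧
    |((cD a0 a1 a2 a3 : ℤ):ℝ)| ≤ 16 * (9 * (a0 * ε) * W) ^ 2 := by
  obtain ⟨q1, q2, q3⟩ := SP_bounds _ _ _ _ _ _ _ _ hεE hSP
  have hE : 0 < E := by linarith
  have hZ0 := hSP.2.1
  have ha0 : (0:ℝ) ≤ a0 := by exact_mod_cast hSP.1
  have hDeq : ((cD a0 a1 a2 a3 : ℤ):ℝ) =
      (((cB a0 a1 a2 a3 : ℤ):ℝ) - 2 * x * (cA a0 a1 a2 : ℤ)) ^ 2 - 4 * (cA a0 a1 a2 : ℤ) *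
      (((cA a0 a1 a2 : ℤ):ℝ) * x ^ 2 - (cB a0 a1 a2 a3 : ℤ) * x + (cA a1 a2 a3 : ℤ)) := by
    simp only [cD]; push_cast; ring
  have hD1 : 1 ≤ |((cD a0 a1 a2 a3 : ℤ):ℝ)| := by
    have : 1 ≤ |cD a0 a1 a2 a3| := Int.one_le_abs hD
    exact_mod_cast this
  set A : ℝ := ((cA a0 a1 a2 : ℤ):ℝ)
  set B' : ℝ := ((cB a0 a1 a2 a3 : ℤ):ℝ) - 2 * x * A
  set C' : ℝ := A * x ^ 2 - ((cB a0 a1 a2 a3 : ℤ):ℝ) * x + ((cA a1 a2 a3 : ℤ):ℝ)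
  have hDle : |((cD a0 a1 a2 a3 : ℤ):ℝ)| ≤ |B'| ^ 2 + 4 * |A| * |C'| := by
    rw [hDeq]
    calc _ ≤ |B' ^ 2| + |4 * A * C'| := abs_sub _ _
      _ = _ := by rw [abs_pow, abs_mul, abs_mul]; norm_num
  have hu : 0 ≤ (a0:ℝ) * ε := by positivity
  have hhalf : 1 / 2 ≤ (a0:ℝ) * ε := by
    by_contra hcon
    push Not at hcon
    have k1 : |B'| ^ 2 ≤ (3 / 4) ^ 2 := by
      gcongr; linarith
    have k2 : 4 * |A| * |C'| ≤ 1 / 4 := by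
      calc 4 * |A| * |C'| ≤ 4 * (a0 * ε + E ^ 2) * (2 * E * ε) := by gcongr
        _ = 8 * ((a0 * ε) * (E * ε)) + 8 * (E ^ 3 * ε) := by ring
        _ ≤ 8 * ((Z * ε) * (E * ε)) + 8 * (E ^ 3 * ε) := by gcongr
        _ ≤ _ := by linarith
    have := hD1.trans (hDle.trans (add_le_add k1 k2))
    norm_num at this
  set u : ℝ := (a0:ℝ) * ε with hudef
  have huW : u ≤ u * W := by nlinarith
  have huW2 : W ≤ 2 * (u * W) := by nlinarith
  have hA9 : |A| ≤ 9 * u * W := by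
    refine q1.trans ?_
    nlinarith
  have hB9 : |B'| ≤ 9 * u * W := by
    refine q2.trans ?_
    nlinarith
  have hC9 : |C'| ≤ 9 * u * W := by
    refine q3.trans ?_
    nlinarith
  refine ⟨hhalf, hA9, hDle.trans ?_⟩
  calc |B'| ^ 2 + 4 * |A| * |C'| ≤ (9 * u * W) ^ 2 + 4 * (9 * u * W) * (9 * u * W) := by gcongr
    _ ≤ _ := by nlinarith [sq_nonneg (9 * u * W)]

theorem bad3 (K : ℝ) (hK : 1 ≤ K) : ∃ C, 0 < C ∧ ∀ Z E ε W : ℝ, 0 < ε → ε ≤ E → 1 ≤ W → 1 ≤ Z →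
    1 ≤ Z * ε →
    E * ε ≤ 1 / 4 → (Z * ε) * (E * ε) ≤ 1 / 64 → E ^ 3 * ε ≤ 1 / 64 → E ^ 2 ≤ 4 * W →
    volume {x : ℝ | |x| ≤ K ∧ ∃ a0 a1 a2 a3, SP Z E ε x a0 a1 a2 a3 ∧ cD a0 a1 a2 a3 ≠ 0} ≤
    ENNReal.ofReal (C * (Z * ε ^ 2 * E * W ^ 2 * (1 + Real.log (18 * (Z * ε) * W)) ^ 3)) := by
  classical
  obtain ⟨C0, hC0, hL⟩ := lemmaK (K + 1) (by linarith)
  refine ⟨1296 * C0, by positivity, ?_⟩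
  intro Z E ε W hε hεE hW hZ hZε h1 h2 h3 h4
  have hE : 0 < E := by linarith
  set Lg := 1 + Real.log (18 * (Z * ε) * W) with hLg
  have hLg0 : 1 ≤ Lg := by
    have : 0 ≤ Real.log (18 * (Z * ε) * W) := Real.log_nonneg (by nlinarith)
    linarith
  let M : ℕ → ℝ := fun k => 18 * (2 ^ k * ε) * W
  have hM0 : ∀ k, 0 < M k := fun k => by positivity
  let S : ℕ → Set (ℤ × ℤ × ℤ × ℤ) := fun k => {v | 1 ≤ M k ∧ (2:ℝ) ^ k ≤ v.1 ∧ (v.1:ℝ) ≤ 2 * 2 ^ k ∧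
    |(v.2.1:ℝ)| ≤ (K + 1) * v.1 ∧ |((cA v.1 v.2.1 v.2.2.1 : ℤ) : ℝ)| ≤ M k ∧
    cD v.1 v.2.1 v.2.2.1 v.2.2.2 ≠ 0 ∧
    |((cD v.1 v.2.1 v.2.2.1 v.2.2.2 : ℤ) : ℝ)| ≤ 16 * M k ^ 2}
  set m := Nat.log 2 ⌊Z⌋₊ + 1 with hm
  have hZfl : ⌊Z⌋₊ ≠ 0 := by
    have : 1 ≤ ⌊Z⌋₊ := Nat.le_floor (by simpa using hZ)
    omega
  have hkZ : ∀ k < m, (2:ℝ) ^ k ≤ Z := by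
    intro k hk
    have h5 : 2 ^ k ≤ ⌊Z⌋₊ := Nat.pow_le_of_le_log hZfl (by omega)
    calc (2:ℝ) ^ k ≤ (⌊Z⌋₊ : ℝ) := by exact_mod_cast h5
      _ ≤ Z := Nat.floor_le (by linarith)
  have hb : ∀ k < m, ∀ T : Finset (ℤ × ℤ × ℤ × ℤ), (∀ v ∈ T, v ∈ S k) →
      (T.card:ℝ) ≤ C0 * M k ^ 2 * Lg ^ 3 := by
    intro k hk T hT
    by_cases hMk : 1 ≤ M k
    · refine (hL _ (M k) (by positivity) hMk T (fun v hv => (hT v hv).2)).trans ?_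
      have : Real.log (M k) ≤ Real.log (18 * (Z * ε) * W) := by
        apply Real.log_le_log (hM0 k)
        simp only [M]
        have := hkZ k hk
        gcongr
      have h0 : 0 ≤ Real.log (M k) := Real.log_nonneg hMk
      gcongr
      linarith
    · have : T = ∅ := by
        rw [Finset.eq_empty_iff_forall_notMem]
        intro v hv; exact hMk (hT v hv).1
      rw [this]; simp only [Finset.card_empty, Nat.cast_zero]
      have := hM0 k
      positivity
  have hfin : ∀ k < m, (S k).Finite := fun k hk => finite_of_card_bound _ _ (hb k hk)
  have hex : ∀ k, ∃ T : Finset (ℤ × ℤ × ℤ × ℤ), k < m → ∀ v, v ∈ T ↔ v ∈ S k := by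
    intro k
    by_cases hk : k < m
    · exact ⟨(hfin k hk).toFinset, fun _ v => by simp⟩
    · exact ⟨∅, fun h => absurd h hk⟩
  choose T hT using hex
  let P : ℕ → Finset ℝ := fun k => (T k).image (fun v => (v.2.1 : ℝ) / v.1)
  have hsub : {x : ℝ | |x| ≤ K ∧ ∃ a0 a1 a2 a3, SP Z E ε x a0 a1 a2 a3 ∧ cD a0 a1 a2 a3 ≠ 0} ⊆
      ⋃ k ∈ Finset.range m, {x : ℝ | ∃ p ∈ P k, |x - p| ≤ E / 2 ^ k} := by
    rintro x ⟨hxK, a0, a1, a2, a3, hSP, hD⟩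
    obtain ⟨u1, u2, u3⟩ := SP_disc Z E ε W x a0 a1 a2 a3 hε hεE hW h1 h2 h3 h4 hSP hD
    obtain ⟨g0, gZ, -, g1, -, -⟩ := hSP
    obtain ⟨q, rfl⟩ := Int.eq_ofNat_of_zero_le g0
    simp only [Int.cast_natCast] at u1 u2 u3 gZ g1
    have hq0 : (0:ℝ) < q := by
      by_contra hc
      have : (q:ℝ) * ε ≤ 0 := mul_nonpos_of_nonpos_of_nonneg (not_lt.mp hc) hε.le
      linarith
    have hqn : q ≠ 0 := by rintro rfl; simp at hq0
    have hlo : (2:ℝ) ^ (Nat.log 2 q) ≤ q := by exact_mod_cast Nat.pow_log_le_self 2 hqn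
    have hhi : (q:ℝ) ≤ 2 * 2 ^ (Nat.log 2 q) := by
      have := (Nat.lt_pow_succ_log_self (b := 2) (by norm_num) q).le
      rw [Nat.succ_eq_add_one, pow_succ] at this
      have h' : (q:ℝ) ≤ 2 ^ (Nat.log 2 q) * 2 := by exact_mod_cast this
      linarith
    have hkm : Nat.log 2 q < m := by
      rw [hm]
      have : q ≤ ⌊Z⌋₊ := Nat.le_floor gZ
      have := Nat.log_mono_right (b := 2) this
      omega
    have hEq : E ≤ q := by
      have : E * ε ≤ q * ε := by linarith
      exact le_of_mul_le_mul_right this hε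
    have hMle : 9 * ((q:ℝ) * ε) * W ≤ M (Nat.log 2 q) := by
      simp only [M]
      calc 9 * ((q:ℝ) * ε) * W ≤ 9 * ((2 * 2 ^ (Nat.log 2 q)) * ε) * W := by gcongr
        _ = _ := by ring
    simp only [Set.mem_iUnion]
    refine ⟨Nat.log 2 q, Finset.mem_range.mpr hkm, (a1:ℝ) / q, ?_, ?_⟩
    · refine Finset.mem_image.mpr ⟨((q:ℤ), a1, a2, a3), ?_, by simp⟩
      rw [hT _ hkm]
      refine ⟨?_, by simpa using hlo, by simpa using hhi, ?_, u2.trans hMle, hD, ?_⟩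
      · nlinarith
      · simp only [Int.cast_natCast]
        calc |(a1:ℝ)| = |((a1:ℝ) - x * q) + x * q| := by congr 1; ring
          _ ≤ |(a1:ℝ) - x * q| + |x * q| := abs_add_le _ _
          _ ≤ E + K * q := by
              rw [abs_mul, abs_of_pos hq0]; gcongr
          _ ≤ _ := by linarith
      · refine u3.trans ?_
        gcongr
    · have : x - (a1:ℝ) / q = -(((a1:ℝ) - x * q) / q) := by field_simp; ring
      rw [this, abs_neg, abs_div, abs_of_pos hq0]
      gcongr
  refine (measure_mono hsub).trans ((measure_biUnion_finset_le _ _).trans ?_)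
  have hterm : ∀ k ∈ Finset.range m, volume {x : ℝ | ∃ p ∈ P k, |x - p| ≤ E / 2 ^ k} ≤
      ENNReal.ofReal ((648 * C0 * ε ^ 2 * W ^ 2 * E * Lg ^ 3) * 2 ^ k) := by
    intro k hk
    have hk := Finset.mem_range.mp hk
    refine (vol_fin_cover (P k) (E / 2 ^ k) (by positivity)).trans (ENNReal.ofReal_le_ofReal ?_)
    have hc : ((P k).card : ℝ) ≤ C0 * M k ^ 2 * Lg ^ 3 := by
      calc ((P k).card : ℝ) ≤ (T k).card := by exact_mod_cast Finset.card_image_le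
        _ ≤ _ := hb k hk _ (fun v hv => (hT k hk v).mp hv)
    calc ((P k).card : ℝ) * (2 * (E / 2 ^ k)) ≤ (C0 * M k ^ 2 * Lg ^ 3) * (2 * (E / 2 ^ k)) := by gcongr
      _ = _ := by simp only [M]; field_simp; ring
  refine (Finset.sum_le_sum hterm).trans ?_
  rw [← ENNReal.ofReal_sum_of_nonneg (fun k _ => by positivity), ← Finset.mul_sum]
  apply ENNReal.ofReal_le_ofReal
  have hgeo : ∑ k ∈ Finset.range m, (2:ℝ) ^ k ≤ 2 * Z := by
    rw [geom_sum_eq (by norm_num)]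
    have := hkZ (Nat.log 2 ⌊Z⌋₊) (by omega)
    rw [hm, pow_succ]
    linarith
  calc _ ≤ (648 * C0 * ε ^ 2 * W ^ 2 * E * Lg ^ 3) * (2 * Z) := by gcongr
    _ = _ := by ring

end Part13

section Part14
open MeasureTheory Filter Topology
open scoped ENNReal NNReal

theorem ev_small (c e δ : ℝ) (he : e < 0) (hδ : 0 < δ) : ∀ᶠ Q : ℝ in atTop, c * Q ^ e ≤ δ := by
  have h := (tendsto_rpow_neg_atTop (y := -e) (by linarith)).const_mul c
  rw [neg_neg, mul_zero] at h
  exact (h.eventually (gt_mem_nhds hδ)).mono fun Q hQ => hQ.le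

/-- the exceptional set for the parameter `Q` -/
def BadQ (K m η Q : ℝ) : Set ℝ := {x | |x| ≤ K ∧ ∃ a0 a1 a2 a3 : ℤ,
  SP (Q ^ (1 - 9 * η)) (2 * Q ^ (2 * m - 1)) (Q ^ (-m)) x a0 a1 a2 a3}

theorem bad_small (K m η δ : ℝ) (hK : 1 ≤ K) (hη : 0 < η) (hη2 : η < 1 / 100) (hm : 1 / 3 < m)
    (hm2 : m ≤ 1 / 2 + η) (hδ : 0 < δ) :
    ∀ᶠ Q : ℝ in atTop, volume (BadQ K m η Q) ≤ ENNReal.ofReal δ := by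
  obtain ⟨C, hC, hb3⟩ := bad3 K hK
  have e1 := ev_small 2 (m - 1) (1 / 4 / 4) (by linarith) (by norm_num)
  have e2 := ev_small 2 (-9 * η) (1 / 64) (by linarith) (by norm_num)
  have e3 := ev_small 8 (5 * m - 3) (1 / 64) (by linarith) (by norm_num)
  have e4 := ev_small 1 (-m) (1 / 2) (by linarith) (by norm_num)
  have e5 := ev_small 1 (1 / 3 - m) ((δ / 3 / (20 * K)) ^ 2) (by linarith) (by positivity)
  have e6 := ev_small 4 (-9 * η) ((δ / 3 / (10 * K)) ^ 2 / 2) (by linarith) (by positivity)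
  have e7 := ev_small 16 (5 * m - 3) ((δ / 3 / (10 * K)) ^ 2 / 2) (by linarith) (by positivity)
  have e8 := ev_small (C * (2 * (5 + 6 / η) ^ 3)) (-(η / 2)) (δ / 3) (by linarith) (by positivity)
  filter_upwards [e1, e2, e3, e4, e5, e6, e7, e8, eventually_ge_atTop 1] with Q e1 e2 e3 e4 e5 e6 e7
    e8 hQ
  have hQ0 : 0 < Q := by linarith
  have hm' : ∀ u v : ℝ, Q ^ u * Q ^ v = Q ^ (u + v) := fun u v => (Real.rpow_add hQ0 u v).symm
  have hle : ∀ u v : ℝ, u ≤ v → Q ^ u ≤ Q ^ v := fun u v h =>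
    Real.rpow_le_rpow_of_exponent_le hQ h
  have hone : ∀ u : ℝ, 0 ≤ u → 1 ≤ Q ^ u := fun u h => Real.one_le_rpow hQ h
  set Z := Q ^ (1 - 9 * η) with hZ
  set E := 2 * Q ^ (2 * m - 1) with hE
  set ε := Q ^ (-m) with hε
  set W := Q ^ (4 * η) with hW
  have hε0 : 0 < ε := Real.rpow_pos_of_pos hQ0 _
  have hE0 : 0 < E := mul_pos two_pos (Real.rpow_pos_of_pos hQ0 _)
  have hZ1 : 1 ≤ Z := hone _ (by linarith)
  have hW1 : 1 ≤ W := hone _ (by linarith)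
  have hεE : ε ≤ E := by
    have := hle (-m) (2 * m - 1) (by linarith)
    have h0 : 0 < Q ^ (2 * m - 1) := Real.rpow_pos_of_pos hQ0 _
    simp only [hε, hE]; linarith
  have q1 : E * ε = 2 * Q ^ (m - 1) := by
    rw [hE, hε, mul_assoc, hm']; ring_nf
  have q2 : Z * ε = Q ^ (1 - 9 * η - m) := by
    rw [hZ, hε, hm']; ring_nf
  have q3 : (Z * ε) * (E * ε) = 2 * Q ^ (-9 * η) := by
    rw [q1, q2, mul_left_comm, hm']; ring_nf
  have q4 : E ^ 2 = 4 * Q ^ (4 * m - 2) := by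
    rw [hE, mul_pow, pow_two (Q ^ _), hm']; ring_nf
  have q5 : E ^ 3 * ε = 8 * Q ^ (5 * m - 3) := by
    have : E ^ 3 * ε = E ^ 2 * (E * ε) := by ring
    rw [this, q4, q1, mul_mul_mul_comm, hm']; ring_nf
  have q6 : E ^ 2 ≤ 4 * W := by
    rw [q4, hW]; have := hle (4 * m - 2) (4 * η) (by linarith); linarith
  have q7 : 1 ≤ Z * ε := by rw [q2]; exact hone _ (by linarith)
  have b1 := bad1 K Z E ε hK hε0 (by linarith) hZ1
  have b2 := bad2 K Z E ε hK hε0 hεE (by rw [mul_assoc, q1]; linarith) hZ1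
  have b3 := hb3 Z E ε W hε0 hεE hW1 hZ1 q7 (by rw [q1]; linarith) (by rw [q3]; linarith)
    (by rw [q5]; linarith) q6
  have c1 : 20 * K * (√ε * √(Z ^ (1 / 3 : ℝ))) ≤ δ / 3 := by
    rw [← Real.sqrt_mul hε0.le]
    have h1 : ε * Z ^ (1 / 3 : ℝ) ≤ (δ / 3 / (20 * K)) ^ 2 := by
      refine le_trans ?_ (le_trans e5 le_rfl)
      rw [hε, hZ, ← Real.rpow_mul hQ0.le, hm', one_mul]
      exact hle _ _ (by linarith)
    have h2 := (Real.sqrt_le_sqrt h1).trans_eq (Real.sqrt_sq (by positivity))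
    calc _ ≤ 20 * K * (δ / 3 / (20 * K)) := by gcongr
      _ = δ / 3 := by field_simp
  have c2 : 10 * K * (√(2 * E * ε) * √(Z * ε + E ^ 2)) ≤ δ / 3 := by
    rw [← Real.sqrt_mul (by positivity)]
    have h1 : 2 * E * ε * (Z * ε + E ^ 2) ≤ (δ / 3 / (10 * K)) ^ 2 := by
      have : 2 * E * ε * (Z * ε + E ^ 2) = 2 * ((Z * ε) * (E * ε)) + 2 * (E ^ 3 * ε) := by ring
      rw [this, q3, q5]; linarith
    have h2 := (Real.sqrt_le_sqrt h1).trans_eq (Real.sqrt_sq (by positivity))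
    calc _ ≤ 10 * K * (δ / 3 / (10 * K)) := by gcongr
      _ = δ / 3 := by field_simp
  have c3 : C * (Z * ε ^ 2 * E * W ^ 2 * (1 + Real.log (18 * (Z * ε) * W)) ^ 3) ≤ δ / 3 := by
    have h1 : Z * ε ^ 2 * E * W ^ 2 = 2 * Q ^ (-η) := by
      have : Z * ε ^ 2 * E * W ^ 2 = ((Z * ε) * (E * ε)) * (W * W) := by ring
      rw [this, q3, hW, hm', mul_assoc, hm']; ring_nf
    have h2 : 1 ≤ 18 * (Z * ε) * W := by nlinarith
    have h3 : 18 * (Z * ε) * W ≤ 18 * Q := by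
      rw [q2, hW, mul_assoc, hm']
      have := hle (1 - 9 * η - m + 4 * η) 1 (by linarith)
      rw [Real.rpow_one] at this; linarith
    have h4 : Real.log (18 * (Z * ε) * W) ≤ 4 + Real.log Q := by
      refine (Real.log_le_log (by linarith) h3).trans ?_
      rw [Real.log_mul (by norm_num) hQ0.ne']
      have : Real.log 18 ≤ 4 := by
        rw [Real.log_le_iff_le_exp (by norm_num)]
        have h := Real.exp_one_gt_d9
        have h' : Real.exp 4 = Real.exp 1 ^ 4 := by rw [← Real.exp_nat_mul]; norm_num
        rw [h']
        have : (2.7:ℝ) ^ 4 ≤ Real.exp 1 ^ 4 := by gcongr; linarith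
        norm_num at this; linarith
      linarith
    have h5 := Real.log_le_rpow_div hQ0.le (ε := η / 6) (by linarith)
    have h6 := hone (η / 6) (by linarith)
    have h7 : 0 ≤ Real.log (18 * (Z * ε) * W) := Real.log_nonneg h2
    have h8 : 1 + Real.log (18 * (Z * ε) * W) ≤ (5 + 6 / η) * Q ^ (η / 6) := by
      have : Q ^ (η / 6) / (η / 6) = 6 / η * Q ^ (η / 6) := by field_simp
      rw [this] at h5; linarith
    have h9 : (Q ^ (η / 6)) ^ 3 = Q ^ (η / 2) := by
      rw [← Real.rpow_natCast, ← Real.rpow_mul hQ0.le]; congr 1; push_cast; ring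
    rw [h1]
    calc _ ≤ C * (2 * Q ^ (-η) * ((5 + 6 / η) * Q ^ (η / 6)) ^ 3) := by
          have : 0 ≤ Q ^ (-η) := (Real.rpow_pos_of_pos hQ0 _).le
          gcongr
      _ = C * (2 * (5 + 6 / η) ^ 3) * (Q ^ (-η) * Q ^ (η / 2)) := by rw [mul_pow, h9]; ring
      _ = C * (2 * (5 + 6 / η) ^ 3) * Q ^ (-(η / 2)) := by rw [hm']; ring_nf
      _ ≤ _ := e8
  have hsub : BadQ K m η Q ⊆ ({x | |x| ≤ K ∧ ∃ a0 a1 a2 a3 : ℤ, SP Z E ε x a0 a1 a2 a3 ∧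
      cA a0 a1 a2 = 0 ∧ cB a0 a1 a2 a3 = 0 ∧ cA a1 a2 a3 = 0} ∪
      {x | |x| ≤ K ∧ ∃ a0 a1 a2 a3 : ℤ, SP Z E ε x a0 a1 a2 a3 ∧ cD a0 a1 a2 a3 = 0 ∧
      ¬ (cA a0 a1 a2 = 0 ∧ cB a0 a1 a2 a3 = 0 ∧ cA a1 a2 a3 = 0)}) ∪
      {x | |x| ≤ K ∧ ∃ a0 a1 a2 a3 : ℤ, SP Z E ε x a0 a1 a2 a3 ∧ cD a0 a1 a2 a3 ≠ 0} := by
    rintro x ⟨hx, a0, a1, a2, a3, h⟩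
    by_cases hD : cD a0 a1 a2 a3 = 0
    · left
      by_cases hH : cA a0 a1 a2 = 0 ∧ cB a0 a1 a2 a3 = 0 ∧ cA a1 a2 a3 = 0
      · left; exact ⟨hx, a0, a1, a2, a3, h, hH⟩
      · right; exact ⟨hx, a0, a1, a2, a3, h, hD, hH⟩
    · right; exact ⟨hx, a0, a1, a2, a3, h, hD⟩
  calc volume (BadQ K m η Q) ≤ _ := measure_mono hsub
    _ ≤ _ := measure_union_le _ _
    _ ≤ (ENNReal.ofReal (δ / 3) + ENNReal.ofReal (δ / 3)) + ENNReal.ofReal (δ / 3) := by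
        refine add_le_add ((measure_union_le _ _).trans (add_le_add ?_ ?_)) ?_
        · exact b1.trans (ENNReal.ofReal_le_ofReal c1)
        · exact b2.trans (ENNReal.ofReal_le_ofReal c2)
        · exact b3.trans (ENNReal.ofReal_le_ofReal c3)
    _ = ENNReal.ofReal δ := by
        rw [← ENNReal.ofReal_add (by positivity) (by positivity),
          ← ENNReal.ofReal_add (by positivity) (by positivity)]
        congr 1; ring

end Part14

section Part15
open MeasureTheory Filter Topology
open scoped ENNReal NNReal

/-- points with a good simultaneous approximation with denominator larger than `n` -/
def PP (l : ℝ) (n : ℕ) : Set ℝ := {z | ∃ q : ℕ, n < q ∧ ∀ i ∈ Finset.Icc 1 3,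
  distNearestInt ((q : ℝ) * z ^ i) ≤ (q : ℝ) ^ (-l)}

theorem dni_le (y : ℝ) (k : ℤ) : distNearestInt y ≤ |y - k| := round_le y k

set_option maxHeartbeats 1000000 in
theorem good_point (K m η l : ℝ) (n : ℕ) (hK : 1 ≤ K) (hη : 0 < η) (hη2 : η < 1 / 100)
    (hm : 1 / 3 < m) (hm2 : m ≤ 1 / 2 + η) (hl : 0 < l) (hlm : l < m) :
    ∀ᶠ Q : ℝ in atTop, ∀ x, |x| ≤ K → x ∉ BadQ K m η Q →
      ∃ y, |x - y| ≤ 2 * Q ^ (2 * m - 2 + 9 * η) ∧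
        ∀ z ∈ Set.Icc (y - Q ^ (-m - 1)) (y + Q ^ (-m - 1)), z ∈ PP l n := by
  have e1 := ev_small (3 * (K + 2) ^ 2 + 4 + 6 * K) (l - m) 1 (by linarith) (by norm_num)
  have e2 := ev_small 2 (2 * m - 2 + 9 * η) 1 (by linarith) (by norm_num)
  have e3 := ev_small 4 (5 * m - 3 + 9 * η) 1 (by linarith) (by norm_num)
  have e4 := ev_small (n + 1) (-(1 - 9 * η)) 1 (by linarith) (by norm_num)
  filter_upwards [e1, e2, e3, e4, eventually_ge_atTop 1] with Q e1 e2 e3 e4 hQ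
  intro x hx hbad
  have hQ0 : 0 < Q := by linarith
  have hm' : ∀ u v : ℝ, Q ^ u * Q ^ v = Q ^ (u + v) := fun u v => (Real.rpow_add hQ0 u v).symm
  have hle : ∀ u v : ℝ, u ≤ v → Q ^ u ≤ Q ^ v := fun u v h =>
    Real.rpow_le_rpow_of_exponent_le hQ h
  have hpos : ∀ u : ℝ, 0 < Q ^ u := fun u => Real.rpow_pos_of_pos hQ0 _
  set Z := Q ^ (1 - 9 * η) with hZ
  set E := 2 * Q ^ (2 * m - 1) with hE
  set ε := Q ^ (-m) with hε
  have hε0 : 0 < ε := hpos _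
  have hE0 : 0 < E := mul_pos two_pos (hpos _)
  have hZ0 : 0 < Z := hpos _
  have hεE : ε ≤ E := by
    have := hle (-m) (2 * m - 1) (by linarith)
    have h0 := hpos (2 * m - 1)
    simp only [hε, hE]; linarith
  have hnZ : (n:ℝ) + 1 ≤ Z := by
    have h := mul_le_mul_of_nonneg_right e4 hZ0.le
    rw [mul_assoc, hZ, hm', neg_add_cancel, Real.rpow_zero] at h
    rw [hZ]; linarith
  have hE2 : E ^ 2 ≤ Z * ε := by
    have q4 : E ^ 2 = 4 * Q ^ (4 * m - 2) := by
      rw [hE, mul_pow, pow_two (Q ^ _), hm']; ring_nf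
    have h := mul_le_mul_of_nonneg_right e3 (hpos (1 - 9 * η - m)).le
    rw [mul_assoc, hm'] at h
    rw [q4, hZ, hε, hm']
    ring_nf at h ⊢; linarith
  have hEZ : E = Z * (2 * Q ^ (2 * m - 2 + 9 * η)) := by
    rw [hE, hZ, mul_left_comm, hm']; ring_nf
  have hCl : (3 * (K + 2) ^ 2 + 4 + 6 * K) * ε ≤ Q ^ (-l) := by
    have h := mul_le_mul_of_nonneg_right e1 (hpos (-l)).le
    rw [mul_assoc, hm'] at h
    rw [hε]; ring_nf at h ⊢; linarith
  have hmk : ∃ a0 a1 a2 a3 : ℤ, SP Q E ε x a0 a1 a2 a3 := by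
    have hprod : Q * E * ε ^ 2 = 2 := by
      have : Q * E * ε ^ 2 = 2 * (Q ^ (1:ℝ) * Q ^ (2 * m - 1) * (ε * ε)) := by
        rw [Real.rpow_one, hE]; ring
      rw [this, hε, hm', hm', hm']
      have : 1 + (2 * m - 1) + (-m + -m) = 0 := by ring
      rw [this, Real.rpow_zero]; norm_num
    obtain ⟨a0, a1, a2, a3, h0, h1, h2, h3, h4⟩ := minkowski4 x Q E ε hQ0 hE0 hε0
      (by rw [hprod]; norm_num)
    rcases le_total 0 a0 with ha | ha
    · exact ⟨a0, a1, a2, a3, ha, (le_abs_self _).trans h1, h0, h2, h3, h4⟩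
    · refine ⟨-a0, -a1, -a2, -a3, by omega, ?_, by omega, ?_, ?_, ?_⟩
      · push_cast; exact (neg_le_abs _).trans h1
      · push_cast; rw [← abs_neg]; convert h2 using 2; ring
      · push_cast; rw [← abs_neg]; convert h3 using 2; ring
      · push_cast; rw [← abs_neg]; convert h4 using 2; ring
  obtain ⟨a0, a1, a2, a3, hSP⟩ := hmk
  obtain ⟨q1, q2, -⟩ := SP_bounds _ _ _ _ _ _ _ _ hεE hSP
  obtain ⟨ha0, haQ, hne, hu, hv, hw⟩ := hSP
  have haZ : Z < a0 := by
    by_contra hcon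
    exact hbad ⟨hx, a0, a1, a2, a3, ha0, not_lt.mp hcon, hne, hu, hv, hw⟩
  have hA0 : (0:ℝ) < a0 := by linarith
  set c : ℝ := ((a0 : ℤ) : ℝ) with hc
  set y : ℝ := ((a1 : ℤ) : ℝ) / c with hy
  have hcy : c * y = a1 := by rw [hy]; field_simp
  have hxy : |x - y| ≤ 2 * Q ^ (2 * m - 2 + 9 * η) := by
    have h1 : c * |x - y| ≤ E := by
      rw [← abs_of_pos hA0, ← abs_mul, mul_sub, hcy, abs_sub_comm, mul_comm c x]
      exact hu
    have h2 : c * |x - y| ≤ c * (2 * Q ^ (2 * m - 2 + 9 * η)) := by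
      refine h1.trans (hEZ.le.trans ?_)
      have := hpos (2 * m - 2 + 9 * η)
      gcongr
    exact le_of_mul_le_mul_left h2 hA0
  refine ⟨y, hxy, ?_⟩
  intro z hz
  have hyK : |y| ≤ K + 1 := by
    have := abs_sub_abs_le_abs_sub y x
    rw [abs_sub_comm] at this; linarith
  have hcr : c * Q ^ (-m - 1) ≤ ε := by
    have h1 : Q * Q ^ (-m - 1) = ε := by
      nth_rw 1 [← Real.rpow_one Q]; rw [hm', hε]; ring_nf
    rw [← h1]; have := hpos (-m - 1); gcongr
  have hr1 : Q ^ (-m - 1) ≤ 1 := Real.rpow_le_one_of_one_le_of_nonpos hQ (by linarith)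
  have hzy : |z - y| ≤ Q ^ (-m - 1) := by
    rw [abs_le]; constructor <;> linarith [hz.1, hz.2]
  have hzK : |z| ≤ K + 2 := by
    have := abs_sub_abs_le_abs_sub z y; linarith
  have hczy : c * |z - y| ≤ ε := le_trans (by gcongr) hcr
  set C := 3 * (K + 2) ^ 2 + 4 + 6 * K with hC
  have hcε : E ^ 2 ≤ c * ε := hE2.trans (by gcongr)
  have hEε : E * ε ≤ c * ε := le_trans (by rw [pow_two]; gcongr) hcε
  set A : ℝ := ((cA a0 a1 a2 : ℤ):ℝ) with hA
  set B : ℝ := ((cB a0 a1 a2 a3 : ℤ):ℝ) with hB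
  have hA1 : |A| ≤ c * (2 * ε) := by linarith
  have hB1 : |B| ≤ c * ((2 + 4 * K) * ε) := by
    have h1 : |B| ≤ |B - 2 * x * A| + |2 * x * A| := by
      have := abs_add_le (B - 2 * x * A) (2 * x * A); rwa [sub_add_cancel] at this
    have h2 : |2 * x * A| ≤ 2 * K * (c * (2 * ε)) := by
      rw [abs_mul, abs_mul, abs_two]; gcongr
    linarith
  have hAe : A = c * a2 - a1 ^ 2 := by simp only [hA, cA, hc]; push_cast; ring
  have hBe : B = c * a3 - a1 * a2 := by simp only [hB, cB, hc]; push_cast; ring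
  have hA2 : |A / c| ≤ 2 * ε := by
    rw [abs_div, abs_of_pos hA0, div_le_iff₀ hA0]; linarith
  have hB2 : |B / c| ≤ (2 + 4 * K) * ε := by
    rw [abs_div, abs_of_pos hA0, div_le_iff₀ hA0]; linarith
  have hK1 : 0 ≤ K * ε := by positivity
  have hK2 : 0 ≤ K ^ 2 * ε := by positivity
  have hCe : C * ε = 3 * (K ^ 2 * ε) + 18 * (K * ε) + 16 * ε := by rw [hC]; ring
  have f1 : |c * z ^ 1 - a1| ≤ C * ε := by
    have : c * z ^ 1 - a1 = c * (z - y) := by rw [← hcy]; ring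
    rw [this, abs_mul, abs_of_pos hA0]
    linarith
  have f2 : |c * z ^ 2 - a2| ≤ C * ε := by
    have h1 : c * z ^ 2 - a2 = c * (z - y) * (z + y) - A / c := by
      rw [hAe, ← hcy]; field_simp; ring
    have h2 : |c * (z - y) * (z + y)| ≤ ε * ((K + 2) + (K + 1)) := by
      rw [abs_mul, abs_mul, abs_of_pos hA0]
      have := abs_add_le z y
      gcongr; linarith
    have h3 := abs_sub (c * (z - y) * (z + y)) (A / c)
    rw [h1]
    linarith
  have f3 : |c * z ^ 3 - a3| ≤ C * ε := by
    have h1 : c * z ^ 3 - a3 = c * (z - y) * (z ^ 2 + z * y + y ^ 2) - (B / c + y * (A / c)) := by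
      rw [hAe, hBe, ← hcy]; field_simp; ring
    have h2 : |c * (z - y) * (z ^ 2 + z * y + y ^ 2)| ≤ ε * (3 * (K + 2) ^ 2) := by
      rw [abs_mul, abs_mul, abs_of_pos hA0]
      have i1 := abs_add_le (z ^ 2 + z * y) (y ^ 2)
      have i2 := abs_add_le (z ^ 2) (z * y)
      have i3 : |z ^ 2| ≤ (K + 2) ^ 2 := by rw [abs_pow]; gcongr
      have i4 : |y ^ 2| ≤ (K + 2) ^ 2 := by rw [abs_pow]; gcongr; linarith
      have i5 : |z * y| ≤ (K + 2) ^ 2 := by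
        rw [abs_mul, pow_two]; gcongr; linarith
      gcongr; linarith
    have h3 := abs_sub (c * (z - y) * (z ^ 2 + z * y + y ^ 2)) (B / c + y * (A / c))
    have h4 := abs_add_le (B / c) (y * (A / c))
    have h5 : |y * (A / c)| ≤ (K + 1) * (2 * ε) := by rw [abs_mul]; gcongr
    rw [h1]
    linarith
  have hqc : ((a0.toNat : ℕ) : ℝ) = c := by
    rw [hc, ← Int.cast_natCast, Int.toNat_of_nonneg ha0]
  have hfin : C * ε ≤ c ^ (-l) := by
    refine hCl.trans ?_
    exact Real.rpow_le_rpow_of_nonpos hA0 haQ (by linarith)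
  refine ⟨a0.toNat, ?_, ?_⟩
  · have : (n:ℝ) < ((a0.toNat : ℕ) : ℝ) := by rw [hqc]; linarith
    exact_mod_cast this
  · intro i hi
    rw [hqc]
    rw [Finset.mem_Icc] at hi
    obtain ⟨hi1, hi2⟩ := hi
    interval_cases i
    · exact (dni_le _ a1).trans (f1.trans hfin)
    · exact (dni_le _ a2).trans (f2.trans hfin)
    · exact (dni_le _ a3).trans (f3.trans hfin)

theorem lower_aux (A B lam s : ℝ) (hAB : A < B) (h1 : 1 / 3 ≤ lam) (h2 : lam ≤ 1 / 2)
    (hs : 0 < s) (hs1 : s < (2 - 2 * lam) / (1 + lam)) :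
    ENNReal.ofReal s ≤ dimH (SimSet 3 (Set.Ioo A B) lam) := by
  have hgap : 0 < 2 - 2 * lam - s * (1 + lam) := by
    rw [lt_div_iff₀ (by linarith)] at hs1; linarith
  have hsle : s ≤ 1 := by nlinarith
  obtain ⟨η, hη, hη2, hη3⟩ : ∃ η : ℝ, 0 < η ∧ η < 1 / 100 ∧
      η * 24 ≤ 2 - 2 * lam - s * (1 + lam) := by
    refine ⟨min (1 / 200) ((2 - 2 * lam - s * (1 + lam)) / 24), by positivity, ?_, ?_⟩
    · exact (min_le_left _ _).trans_lt (by norm_num)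
    · have := min_le_right (1 / 200 : ℝ) ((2 - 2 * lam - s * (1 + lam)) / 24)
      linarith
  set m := lam + η with hm
  set l' := lam + η / 2 with hl'
  have hexp : 0 < 2 - 2 * m - 9 * η - (m + 1) * s := by
    rw [hm]; nlinarith
  have key := cantor_dim A B (1 / 16) s hAB (by norm_num) hs hsle (fun n => PP l' n) ?_
  · refine key.trans (dimH_mono ?_)
    rintro x ⟨hx, hxP⟩
    refine ⟨hx, ?_⟩
    have hlt : ENNReal.ofReal lam < ENNReal.ofReal l' :=
      (ENNReal.ofReal_lt_ofReal_iff (by linarith)).mpr (by linarith)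
    refine hlt.trans_le (le_sSup ⟨l', ⟨by linarith, ?_⟩, rfl⟩)
    rw [Set.infinite_iff_exists_gt] 
    intro n
    obtain ⟨q, hq, hqq⟩ := hxP n
    exact ⟨q, ⟨by omega, hqq⟩, hq⟩
  intro n a b hab hsub hb1
  set K := 1 + |A| + |B| with hKdef
  have hK : 1 ≤ K := by have := abs_nonneg A; have := abs_nonneg B; linarith
  have hba : 0 < b - a := by linarith
  have E1 := bad_small K m η ((b - a) / 16) hK hη hη2 (by linarith) (by linarith) (by positivity)
  have E2 := good_point K m η l' n hK hη hη2 (by linarith) (by linarith) (by linarith)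
    (by linarith)
  have E3 := ev_small 16 (2 * m - 2 + 9 * η) ((b - a) / 16) (by linarith) (by positivity)
  have E4 := ev_small 2 (1 - 3 * m - 9 * η) 1 (by linarith) (by norm_num)
  have E5 := ev_small (64 / (b - a)) (-(2 - 2 * m - 9 * η - (m + 1) * s)) 1 (by linarith)
    (by norm_num)
  obtain ⟨Q, e1, e2, e3, e4, e5, hQ⟩ := (E1.and (E2.and (E3.and (E4.and
    (E5.and (eventually_ge_atTop (1:ℝ))))))).exists
  have hQ0 : 0 < Q := by linarith
  have hm' : ∀ u v : ℝ, Q ^ u * Q ^ v = Q ^ (u + v) := fun u v => (Real.rpow_add hQ0 u v).symm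
  have hpos : ∀ u : ℝ, 0 < Q ^ u := fun u => Real.rpow_pos_of_pos hQ0 _
  set r := Q ^ (-m - 1) with hr
  set t := Q ^ (2 * m - 2 + 9 * η) with ht
  have hr0 : 0 < r := hpos _
  have ht0 : 0 < t := hpos _
  have hrt : 2 * r ≤ t := by
    have h := mul_le_mul_of_nonneg_right e4 ht0.le
    rw [mul_assoc, ht, hm', one_mul] at h
    rw [hr, ht]; ring_nf at h ⊢; linarith
  have hst : 64 * t ≤ (b - a) * r ^ s := by
    have h := mul_le_mul_of_nonneg_right e5 (hpos ((-m - 1) * s)).le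
    rw [mul_assoc, hm', one_mul] at h
    have h' : -(2 - 2 * m - 9 * η - (m + 1) * s) + (-m - 1) * s = 2 * m - 2 + 9 * η := by ring
    rw [h', div_mul_eq_mul_div, div_le_iff₀ hba] at h
    rw [hr, ← Real.rpow_mul hQ0.le]; linarith
  obtain ⟨N, f, hN1, hN2, hf, hsp⟩ := cells a b (16 * t)
    {y | ∀ z ∈ Set.Icc (y - r) (y + r), z ∈ PP l' n} (BadQ K m η Q) hab (by positivity)
    (by linarith) e1 (by
      intro x hx hxb
      have hxAB := hsub hx
      have hxK : |x| ≤ K := by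
        rw [abs_le]
        constructor
        · have := neg_abs_le A; have := abs_nonneg B; linarith [hxAB.1]
        · have := le_abs_self B; have := abs_nonneg A; linarith [hxAB.2]
      obtain ⟨y, hy1, hy2⟩ := e2 x hxK hxb
      exact ⟨y, hy2, by linarith⟩)
  have hN4 : (4:ℝ) ≤ N := by
    refine le_trans ?_ hN1
    rw [le_div_iff₀ (by positivity)]; linarith
  have hN0 : (0:ℝ) < N := by linarith
  have hNl : (b - a) / N ≤ 4 * (16 * t) := by
    rw [div_le_iff₀ (by positivity)] at hN1 ⊢; linarith
  have hNu : 2 * (16 * t) ≤ (b - a) / N := by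
    rw [le_div_iff₀ (by positivity)] at hN2 ⊢; linarith
  refine ⟨N, r, f, ?_, hr0, ?_, ?_, ?_, ?_⟩
  · have : (2:ℝ) ≤ N := by linarith
    exact_mod_cast this
  · intro i hi z hz
    obtain ⟨g1, g2, g3⟩ := hf i hi
    exact ⟨⟨by linarith [hz.1], by linarith [hz.2]⟩, g1 z hz⟩
  · intro i j hij hj
    refine le_trans ?_ (hsp i j hij hj)
    have hji : (0:ℝ) ≤ (j:ℝ) - i := by
      have : (i:ℝ) ≤ j := by exact_mod_cast hij.le
      linarith
    have := mul_le_mul_of_nonneg_left hNl hji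
    have h' : 1 / 16 * ((j:ℝ) - i) * (b - a) / N = 1 / 16 * (((j:ℝ) - i) * ((b - a) / N)) := by
      ring
    rw [h']; linarith
  · have h' : 1 / 16 * (b - a) / (4 * N) = (b - a) / N / 64 := by field_simp; norm_num
    rw [h']; linarith
  · have h3 : r ^ s ≤ (2 * r) ^ s := Real.rpow_le_rpow hr0.le (by linarith) hs.le
    calc (1:ℝ) ≤ (b - a) / (4 * (16 * t)) * r ^ s := by
          rw [div_mul_eq_mul_div, le_div_iff₀ (by positivity)]; linarith
      _ ≤ N * (2 * r) ^ s := by gcongr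

theorem lower (A B lam : ℝ) (hAB : A < B) (h1 : 1 / 3 ≤ lam) (h2 : lam ≤ 1 / 2) :
    ENNReal.ofReal ((2 - 2 * lam) / (1 + lam)) ≤ dimH (SimSet 3 (Set.Ioo A B) lam) := by
  set s0 := (2 - 2 * lam) / (1 + lam) with hs0
  have hpos : 0 < s0 := div_pos (by linarith) (by linarith)
  have ht : Tendsto (fun s => ENNReal.ofReal s) (𝓝[<] s0) (𝓝 (ENNReal.ofReal s0)) :=
    (ENNReal.continuous_ofReal.tendsto s0).mono_left nhdsWithin_le_nhds
  refine le_of_tendsto ht ?_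
  filter_upwards [Ioo_mem_nhdsLT hpos] with s hs
  exact lower_aux A B lam s hAB h1 h2 hs.1 hs.2

end Part15

/-- For a nonempty open interval `I` and `1/3 ≤ λ ≤ 1/2`,
`dim S_3(I, λ) = (2 - 2λ)/(1+λ)`. -/
theorem stmt3 (a b : ℝ) (hab : a < b)
    (lam : ℝ) (h1 : 1 / 3 ≤ lam) (h2 : lam ≤ 1 / 2) :
    dimH (SimSet 3 (Set.Ioo a b) lam) =
      ENNReal.ofReal ((2 - 2 * lam) / (1 + lam)) := by
  exact le_antisymm (upper a b lam h1 h2) (lower a b lam hab h1 h2)
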